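/- Let r and s be integers with r/2 ≤ s < r and let γ > 0. Then for all sufficiently large C the following holds. Let n be divisible by r and let G be an n-vertex graph with minimum degree at least (1 − s/r)·n in which every vertex subset of size sn/r contains at least γn² edges of G. Then for p = C·n^{−2/s}·(log n)^{2/(s(s−1))}, with high probability (as n → ∞) the graph G^p = G ∪ G_{n,p} contains a K_r-factor. -/

import Mathlib

open Finset
open scoped Classical

/-- The degree of a vertex (number of neighbours). -/
noncomputable def degR {V : Type*} (G : SimpleGraph V) (v : V) : ℕ :=
  Nat.card (G.neighborSet v)

/-- The number of edges of a graph on `Fin n`. -/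
noncomputable def edgeCount {n : ℕ} (H : SimpleGraph (Fin n)) : ℕ := Nat.card H.edgeSet

/-- The probability that the binomial random graph `G_{n,p}` satisfies the property `P`. -/
noncomputable def Pr (n : ℕ) (p : ℝ) (P : SimpleGraph (Fin n) → Prop) : ℝ :=
  ∑ H : SimpleGraph (Fin n),
    if P H then p ^ edgeCount H * (1 - p) ^ (n.choose 2 - edgeCount H) else 0

/-- `G` has a `K_r`-factor: a partition of the vertex set into `r`-cliques. -/
def HasCliqueFactor {n : ℕ} (G : SimpleGraph (Fin n)) (r : ℕ) : Prop :=
  ∃ P : Finpartition (Finset.univ : Finset (Fin n)), ∀ c ∈ P.parts, G.IsNClique r c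

/-- The threshold function `p_s(n)`: `log n / n` if `s = 2` and `n^{-φ(s)}` with
`φ(s) = 2s/((s-1)(s+2))` if `s ≥ 3`. -/
noncomputable def pThr (s n : ℕ) : ℝ :=
  if s = 2 then Real.log n / n
  else (n : ℝ) ^ (-(2 * (s : ℝ)) / (((s : ℝ) - 1) * ((s : ℝ) + 2)))

/-- The number of edges of `G` within the vertex set `S`. -/
noncomputable def edgesIn {V : Type*} (G : SimpleGraph V) (S : Set V) : ℕ :=
  Nat.card {e : Sym2 V // e ∈ G.edgeSet ∧ ∀ v ∈ e, v ∈ S}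

/-- The number of ordered adjacent pairs between `S` and `T`. -/
noncomputable def edgesBtw {V : Type*} (G : SimpleGraph V) (S T : Set V) : ℕ :=
  Nat.card {p : V × V // p.1 ∈ S ∧ p.2 ∈ T ∧ G.Adj p.1 p.2}

/-- The edge density of the pair `(S, T)` in `G`. -/
noncomputable def density {V : Type*} (G : SimpleGraph V) (S T : Set V) : ℝ :=
  (edgesBtw G S T : ℝ) / ((S.ncard : ℝ) * (T.ncard : ℝ))

/-- The pair `(S, T)` is `(ε, d)`-regular in `G`. -/
def IsRegularPair {V : Type*} (G : SimpleGraph V) (S T : Set V) (ε d : ℝ) : Prop :=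
  ∀ X ⊆ S, ∀ Y ⊆ T, ε * S.ncard ≤ (X.ncard : ℝ) → ε * T.ncard ≤ (Y.ncard : ℝ) →
    |density G X Y - d| < ε

/-- The pair `(S, T)` is `(ε, d, ϑ)`-super-regular in `G`. -/
def IsSuperRegularPair {V : Type*} (G : SimpleGraph V) (S T : Set V) (ε d ϑ : ℝ) : Prop :=
  IsRegularPair G S T ε d ∧
  (∀ v ∈ S, ϑ * T.ncard ≤ ((T ∩ G.neighborSet v).ncard : ℝ)) ∧
  (∀ v ∈ T, ϑ * S.ncard ≤ ((S ∩ G.neighborSet v).ncard : ℝ))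


open Finset
open scoped Classical

section RandomSubset
variable {α : Type*}

/-- Expectation over a `p`-random subset of `A`. -/
noncomputable def Ex (p : ℝ) (A : Finset α) (g : Finset α → ℝ) : ℝ :=
  ∑ S ∈ A.powerset, p ^ S.card * (1 - p) ^ (A.card - S.card) * g S

lemma Ex_mass (p : ℝ) (A : Finset α) : Ex p A (fun _ => 1) = 1 := by
  unfold Ex
  have := Finset.sum_pow_mul_eq_add_pow p (1 - p) A
  simp only [mul_one]
  rw [this]; simp

lemma Ex_insert (p : ℝ) (A : Finset α) (e : α) (he : e ∉ A) (g : Finset α → ℝ) :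
    Ex p (insert e A) g = p * Ex p A (fun S => g (insert e S)) + (1 - p) * Ex p A g := by
  unfold Ex
  rw [Finset.sum_powerset_insert he, add_comm, Finset.mul_sum, Finset.mul_sum]
  congr 1
  · apply Finset.sum_congr rfl
    intro S hS
    have hS' : S ⊆ A := Finset.mem_powerset.1 hS
    have : e ∉ S := fun h => he (hS' h)
    rw [Finset.card_insert_of_notMem this, Finset.card_insert_of_notMem he]
    rw [show A.card + 1 - (S.card + 1) = A.card - S.card by omega, pow_succ]; ring
  · apply Finset.sum_congr rfl
    intro S hS
    have hS' : S ⊆ A := Finset.mem_powerset.1 hS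
    have := Finset.card_le_card hS'
    rw [Finset.card_insert_of_notMem he]
    rw [show A.card + 1 - S.card = (A.card - S.card) + 1 by omega, pow_succ]; ring

lemma Ex_mono {p : ℝ} (hp : 0 ≤ p) (hp1 : p ≤ 1) (A : Finset α) {g g' : Finset α → ℝ}
    (h : ∀ S ⊆ A, g S ≤ g' S) : Ex p A g ≤ Ex p A g' := by
  unfold Ex
  apply Finset.sum_le_sum
  intro S hS
  have : 0 ≤ 1 - p := by linarith
  exact mul_le_mul_of_nonneg_left (h S (Finset.mem_powerset.1 hS)) (by positivity)

lemma Ex_congr {p : ℝ} (A : Finset α) {g g' : Finset α → ℝ}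
    (h : ∀ S ⊆ A, g S = g' S) : Ex p A g = Ex p A g' := by
  unfold Ex
  apply Finset.sum_congr rfl
  intro S hS
  rw [h S (Finset.mem_powerset.1 hS)]

lemma Ex_add (p : ℝ) (A : Finset α) (g g' : Finset α → ℝ) :
    Ex p A (fun S => g S + g' S) = Ex p A g + Ex p A g' := by
  unfold Ex; rw [← Finset.sum_add_distrib]; exact Finset.sum_congr rfl fun _ _ => by ring

lemma Ex_sub (p : ℝ) (A : Finset α) (g g' : Finset α → ℝ) :
    Ex p A (fun S => g S - g' S) = Ex p A g - Ex p A g' := by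
  unfold Ex; rw [← Finset.sum_sub_distrib]; exact Finset.sum_congr rfl fun _ _ => by ring

lemma Ex_const_mul (p : ℝ) (A : Finset α) (c : ℝ) (g : Finset α → ℝ) :
    Ex p A (fun S => c * g S) = c * Ex p A g := by
  unfold Ex; rw [Finset.mul_sum]; exact Finset.sum_congr rfl fun _ _ => by ring

lemma Ex_sum {ι : Type*} (p : ℝ) (A : Finset α) (I : Finset ι) (g : ι → Finset α → ℝ) :
    Ex p A (fun S => ∑ i ∈ I, g i S) = ∑ i ∈ I, Ex p A (g i) := by
  unfold Ex; rw [Finset.sum_comm]; exact Finset.sum_congr rfl fun _ _ => by rw [Finset.mul_sum]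

/-- Conditioning on `T ⊆ S`. -/
lemma Ex_cond (p : ℝ) (A T : Finset α) (hT : T ⊆ A) (g : Finset α → ℝ) :
    Ex p A (fun S => if T ⊆ S then g S else 0) = p ^ T.card * Ex p A (fun S => g (S ∪ T)) := by
  induction T using Finset.induction_on generalizing g with
  | empty => simp
  | insert e T he ih =>
    have hT' : T ⊆ A := fun x hx => hT (Finset.mem_insert_of_mem hx)
    have heA : e ∈ A := hT (Finset.mem_insert_self _ _)
    have key : ∀ g' : Finset α → ℝ, Ex p A (fun S => if e ∈ S then g' S else 0)
        = p * Ex p A (fun S => g' (insert e S)) := by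
      intro g'
      obtain ⟨B, hB, rfl⟩ : ∃ B, e ∉ B ∧ A = insert e B :=
        ⟨A.erase e, Finset.notMem_erase _ _, (Finset.insert_erase heA).symm⟩
      rw [Ex_insert p B e hB, Ex_insert p B e hB]
      have h1 : Ex p B (fun S => if e ∈ S then g' S else 0) = 0 := by
        unfold Ex
        apply Finset.sum_eq_zero
        intro S hS
        have : e ∉ S := fun h => hB (Finset.mem_powerset.1 hS h)
        simp [this]
      simp only [Finset.mem_insert_self, if_true, Finset.insert_idem]
      rw [h1]; ring
    have := ih hT' (fun S => if e ∈ S then g S else 0)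
    have h2 : (fun S => if insert e T ⊆ S then g S else 0)
        = (fun S => if T ⊆ S then (if e ∈ S then g S else 0) else 0) := by
      funext S
      simp only [Finset.insert_subset_iff]
      by_cases h1 : e ∈ S <;> by_cases h2 : T ⊆ S <;> simp [h1, h2]
    rw [h2, this, Finset.card_insert_of_notMem he, pow_succ, mul_assoc]
    congr 1
    have h3 : (fun S => if e ∈ S ∪ T then g (S ∪ T) else 0)
        = (fun S => if e ∈ S then (fun R => g (R ∪ T)) S else 0) := by
      funext S; simp [he]
    rw [h3, key]
    congr 2
    funext S
    congr 1
    ext x; simp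

/-- Boppana–Spencer step form of Janson. -/
lemma janson_basic {ι : Type*} {p : ℝ} (hp : 0 ≤ p) (hp1 : p ≤ 1) (A : Finset α)
    (D : ι → Finset α) (hD : ∀ i, D i ⊆ A) (I : Finset ι) :
    ∃ R : Finset (ι × ι), R ⊆ (I ×ˢ I).filter (fun x => x.1 ≠ x.2 ∧ ¬ Disjoint (D x.1) (D x.2)) ∧
    Ex p A (fun S => if ∀ i ∈ I, ¬ D i ⊆ S then 1 else 0) ≤
      Real.exp (-(∑ i ∈ I, p ^ (D i).card - ∑ x ∈ R, p ^ (D x.1 ∪ D x.2).card)) := by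
  induction I using Finset.induction_on with
  | empty => exact ⟨∅, by simp, by simp [Ex_mass]⟩
  | insert i I hi ih =>
    obtain ⟨R, hR, hb⟩ := ih
    set J := I.filter (fun j => ¬ Disjoint (D i) (D j)) with hJ
    set R' := R ∪ J.image (fun j => (i, j)) with hR'
    have hRI : ∀ x ∈ R, x.1 ∈ I ∧ x.2 ∈ I := by
      intro x hx
      have := hR hx
      simp only [Finset.mem_filter, Finset.mem_product] at this
      exact this.1
    refine ⟨R', ?_, ?_⟩
    · intro x hx
      rw [hR', Finset.mem_union] at hx
      rcases hx with hx | hx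
      · have := hR hx
        simp only [Finset.mem_filter, Finset.mem_product, Finset.mem_insert] at this ⊢
        tauto
      · obtain ⟨j, hj, rfl⟩ := Finset.mem_image.1 hx
        simp only [hJ, Finset.mem_filter, Finset.mem_product, Finset.mem_insert] at hj ⊢
        refine ⟨⟨by simp, Or.inr hj.1⟩, ?_, hj.2⟩
        rintro h; rw [h] at hi; exact hi hj.1
    · -- main estimate
      have hdisj : Disjoint R (J.image (fun j => (i, j))) := by
        rw [Finset.disjoint_left]
        intro x hx hx'
        obtain ⟨j, hj, hh⟩ := Finset.mem_image.1 hx'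
        have := hRI _ hx
        rw [← hh] at this; exact hi this.1
      rw [hR', Finset.sum_union hdisj, Finset.sum_image (by intro a _ b _ h; simpa using h),
        Finset.sum_insert hi]
      set x : ℝ := p ^ (D i).card - ∑ j ∈ J, p ^ (D i ∪ D j).card with hx
      set B := Ex p A (fun S => if ∀ i ∈ I, ¬ D i ⊆ S then (1:ℝ) else 0) with hB
      set B' := Ex p A (fun S => if ∀ j ∈ insert i I, ¬ D j ⊆ S then (1:ℝ) else 0) with hB'
      have hB0 : 0 ≤ B := by
        have := Ex_mono hp hp1 A (g := fun _ => 0) (g' := fun S => if ∀ i ∈ I, ¬ D i ⊆ S then (1:ℝ) else 0)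
          (by intro S _; split_ifs <;> norm_num)
        have h0 : Ex p A (fun _ => (0:ℝ)) = 0 := by simp [Ex]
        linarith
      -- the far event
      set F : Finset α → Prop := fun S => ∀ j ∈ I, j ∉ J → ¬ D j ⊆ S with hF
      set PF := Ex p A (fun S => if F S then (1:ℝ) else 0) with hPF
      have hstep : B' ≤ B - x * PF := by
        have e1 : p ^ (D i).card * PF = Ex p A (fun S => if D i ⊆ S then (if F S then (1:ℝ) else 0) else 0) := by
          rw [Ex_cond p A (D i) (hD i)]
          congr 1
          apply Ex_congr
          intro S _
          have : F S ↔ F (S ∪ D i) := by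
            simp only [hF]
            refine forall_congr' fun j => forall_congr' fun hj => forall_congr' fun hjJ => not_congr ?_
            have hd : Disjoint (D i) (D j) := by
              by_contra h; exact hjJ (by simp [hJ, hj, h])
            constructor
            · exact fun h => h.trans Finset.subset_union_left
            · intro h y hy
              rcases Finset.mem_union.1 (h hy) with h1 | h1
              · exact h1
              · exact absurd hy (Finset.disjoint_left.1 hd h1)
          simp only [← this]
        have e2 : ∀ j ∈ J, Ex p A (fun S => if D i ∪ D j ⊆ S then (if F S then (1:ℝ) else 0) else 0)
            ≤ p ^ (D i ∪ D j).card * PF := by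
          intro j hj
          rw [Ex_cond p A _ (Finset.union_subset (hD i) (hD j))]
          apply mul_le_mul_of_nonneg_left _ (by positivity)
          apply Ex_mono hp hp1
          intro S _
          by_cases h : F S
          · rw [if_pos h]; split_ifs <;> norm_num
          · rw [if_neg h, if_neg]
            intro h'; apply h
            intro a ha haJ has
            exact h' a ha haJ (has.trans Finset.subset_union_left)
        have e3 : Ex p A (fun S => if D i ⊆ S then (if F S then (1:ℝ) else 0) else 0)
            ≤ Ex p A (fun S => ((if ∀ i ∈ I, ¬ D i ⊆ S then (1:ℝ) else 0)
              - (if ∀ j ∈ insert i I, ¬ D j ⊆ S then (1:ℝ) else 0))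
              + ∑ j ∈ J, (if D i ∪ D j ⊆ S then (if F S then (1:ℝ) else 0) else 0)) := by
          apply Ex_mono hp hp1
          intro S _
          have hnn : ∀ j ∈ J, (0:ℝ) ≤ (if D i ∪ D j ⊆ S then (if F S then (1:ℝ) else 0) else 0) := by
            intro j _; split_ifs <;> norm_num
          have hsn := Finset.sum_nonneg hnn
          have hsl := fun j hj => Finset.single_le_sum hnn (a := j) hj
          generalize (∑ j ∈ J, (if D i ∪ D j ⊆ S then (if F S then (1:ℝ) else 0) else 0)) = Z at hsn hsl ⊢
          have hle : (if ∀ j ∈ insert i I, ¬ D j ⊆ S then (1:ℝ) else 0) ≤ (if ∀ i ∈ I, ¬ D i ⊆ S then (1:ℝ) else 0) := by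
            by_cases h : ∀ j ∈ insert i I, ¬ D j ⊆ S
            · rw [if_pos h, if_pos (fun j hj => h j (Finset.mem_insert_of_mem hj))]
            · rw [if_neg h]; split_ifs <;> norm_num
          by_cases h1 : D i ⊆ S
          · by_cases h2 : F S
            · rw [if_pos h1, if_pos h2]
              by_cases h3 : ∀ i ∈ I, ¬ D i ⊆ S
              · rw [if_pos h3, if_neg (fun h => h i (Finset.mem_insert_self _ _) h1)]
                linarith
              · push Not at h3
                obtain ⟨j, hj, hjS⟩ := h3
                have hjJ : j ∈ J := by by_contra h; exact h2 j hj h hjS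
                have := hsl j hjJ
                simp only [if_pos (Finset.union_subset h1 hjS), if_pos h2] at this
                linarith
            · rw [if_pos h1, if_neg h2]; linarith
          · rw [if_neg h1]; linarith
        rw [Ex_add, Ex_sub, Ex_sum, ← e1] at e3
        have e4 := Finset.sum_le_sum e2
        rw [← Finset.sum_mul] at e4
        rw [hx]
        linarith
      have hPFB : B ≤ PF := by
        apply Ex_mono hp hp1
        intro S _
        by_cases h : ∀ i ∈ I, ¬ D i ⊆ S
        · rw [if_pos h, if_pos (fun j hj _ => h j hj)]
        · rw [if_neg h]; split_ifs <;> norm_num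
      have hBB : B' ≤ B := by
        apply Ex_mono hp hp1
        intro S _
        by_cases h : ∀ j ∈ insert i I, ¬ D j ⊆ S
        · rw [if_pos h, if_pos (fun j hj => h j (Finset.mem_insert_of_mem hj))]
        · rw [if_neg h]; split_ifs <;> norm_num
      have hfin : B' ≤ B * Real.exp (-x) := by
        rcases le_or_gt 0 x with hx0 | hx0
        · have h1 := mul_le_mul_of_nonneg_left hPFB hx0
          have h2 := mul_le_mul_of_nonneg_left (Real.add_one_le_exp (-x)) hB0
          nlinarith
        · have : 1 ≤ Real.exp (-x) := Real.one_le_exp (by linarith)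
          nlinarith
      calc B' ≤ B * Real.exp (-x) := hfin
        _ ≤ Real.exp (-(∑ i ∈ I, p ^ (D i).card - ∑ x ∈ R, p ^ (D x.1 ∪ D x.2).card)) * Real.exp (-x) :=
            mul_le_mul_of_nonneg_right hb (Real.exp_pos _).le
        _ = _ := by rw [← Real.exp_add]; congr 1; rw [hx]; ring

end RandomSubset

open Finset
open scoped Classical

section RandomSubset2
variable {α : Type*}

lemma Ex_exists_ge {p : ℝ} (hp : 0 ≤ p) (hp1 : p ≤ 1) (A : Finset α) (g : Finset α → ℝ) :
    ∃ S ⊆ A, Ex p A g ≤ g S := by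
  obtain ⟨S, hS, hmax⟩ := Finset.exists_max_image A.powerset g ⟨∅, by simp⟩
  refine ⟨S, Finset.mem_powerset.1 hS, ?_⟩
  have h1 : Ex p A g ≤ Ex p A (fun _ => g S * 1) :=
    Ex_mono hp hp1 A (fun T hT => by simpa using hmax T (Finset.mem_powerset.2 hT))
  rw [Ex_const_mul, Ex_mass] at h1
  linarith

lemma Ex_prob (p : ℝ) (A T : Finset α) (hT : T ⊆ A) (b : ℝ) :
    Ex p A (fun S => if T ⊆ S then b else 0) = p ^ T.card * b := by
  rw [Ex_cond p A T hT]
  have := Ex_const_mul p A b (fun _ => 1)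
  rw [Ex_mass] at this
  simp only [mul_one] at this
  rw [this]

lemma janson {ι : Type*} {p : ℝ} (hp : 0 ≤ p) (hp1 : p ≤ 1) (A : Finset α)
    (D : ι → Finset α) (hD : ∀ i, D i ⊆ A) (I : Finset ι) (Δ : ℝ) (hΔ0 : 0 < Δ)
    (hΔ : ∑ x ∈ (I ×ˢ I).filter (fun x => x.1 = x.2 ∨ ¬ Disjoint (D x.1) (D x.2)),
      p ^ (D x.1 ∪ D x.2).card ≤ Δ) :
    Ex p A (fun S => if ∀ i ∈ I, ¬ D i ⊆ S then 1 else 0) ≤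
      Real.exp (-((∑ i ∈ I, p ^ (D i).card) ^ 2 / (4 * Δ))) := by
  set μ := ∑ i ∈ I, p ^ (D i).card with hμ
  set O := (I ×ˢ I).filter (fun x => x.1 ≠ x.2 ∧ ¬ Disjoint (D x.1) (D x.2)) with hO
  have hμ0 : 0 ≤ μ := Finset.sum_nonneg fun i _ => by positivity
  have hsplit : μ + ∑ x ∈ O, p ^ (D x.1 ∪ D x.2).card ≤ Δ := by
    refine le_trans ?_ hΔ
    have hd : Disjoint (I.image (fun i => (i, i))) O := by
      rw [Finset.disjoint_left]
      intro x hx hx'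
      obtain ⟨j, _, rfl⟩ := Finset.mem_image.1 hx
      simp [hO] at hx'
    have : μ = ∑ x ∈ I.image (fun i => (i, i)), p ^ (D x.1 ∪ D x.2).card := by
      rw [Finset.sum_image (by intro a _ b _ h; simpa using h)]
      simp [hμ]
    rw [this, ← Finset.sum_union hd]
    apply Finset.sum_le_sum_of_subset_of_nonneg
    · intro x hx
      rcases Finset.mem_union.1 hx with h | h
      · obtain ⟨j, hj, rfl⟩ := Finset.mem_image.1 h
        simp [hj]
      · simp only [hO, Finset.mem_filter] at h ⊢
        exact ⟨h.1, Or.inr h.2.2⟩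
    · intro x _ _; positivity
  have hO0 : 0 ≤ ∑ x ∈ O, p ^ (D x.1 ∪ D x.2).card := Finset.sum_nonneg fun i _ => by positivity
  set q := μ / (2 * Δ) with hq
  have hq0 : 0 ≤ q := by positivity
  have hq1 : q ≤ 1 := by rw [hq, div_le_one (by positivity)]; linarith
  obtain ⟨I', hI', hval⟩ := Ex_exists_ge hq0 hq1 I (fun J =>
    ∑ i ∈ I, (if ({i} : Finset ι) ⊆ J then p ^ (D i).card else 0) -
    ∑ x ∈ O, (if ({x.1, x.2} : Finset ι) ⊆ J then p ^ (D x.1 ∪ D x.2).card else 0))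
  rw [Ex_sub, Ex_sum, Ex_sum] at hval
  have e1 : ∑ i ∈ I, Ex q I (fun J => if ({i} : Finset ι) ⊆ J then p ^ (D i).card else 0) = q * μ := by
    rw [hμ, Finset.mul_sum]
    apply Finset.sum_congr rfl
    intro i hi
    rw [Ex_prob _ _ _ (by simpa using hi)]; simp
  have e2 : ∑ x ∈ O, Ex q I (fun J => if ({x.1, x.2} : Finset ι) ⊆ J then p ^ (D x.1 ∪ D x.2).card else 0)
      = q ^ 2 * ∑ x ∈ O, p ^ (D x.1 ∪ D x.2).card := by
    rw [Finset.mul_sum]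
    apply Finset.sum_congr rfl
    intro x hx
    simp only [hO, Finset.mem_filter, Finset.mem_product] at hx
    rw [Ex_prob _ _ _ (by intro y; simp; rintro (rfl | rfl); exacts [hx.1.1, hx.1.2]),
      Finset.card_pair hx.2.1]
  rw [e1, e2] at hval
  obtain ⟨R, hR, hb⟩ := janson_basic hp hp1 A D hD I'
  have f1 : ∑ i ∈ I, (if ({i} : Finset ι) ⊆ I' then p ^ (D i).card else 0) = ∑ i ∈ I', p ^ (D i).card := by
    rw [← Finset.sum_filter]
    apply Finset.sum_congr _ (fun _ _ => rfl)
    ext i; simp; exact fun h => hI' h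
  have f2 : ∑ x ∈ R, p ^ (D x.1 ∪ D x.2).card ≤
      ∑ x ∈ O, (if ({x.1, x.2} : Finset ι) ⊆ I' then p ^ (D x.1 ∪ D x.2).card else 0) := by
    rw [← Finset.sum_filter]
    apply Finset.sum_le_sum_of_subset_of_nonneg
    · intro x hx
      have := hR hx
      simp only [hO, Finset.mem_filter, Finset.mem_product] at this ⊢
      refine ⟨⟨⟨hI' this.1.1, hI' this.1.2⟩, this.2⟩, ?_⟩
      intro y; simp; rintro (rfl | rfl); exacts [this.1.1, this.1.2]
    · intro x _ _; positivity
  have g1 : Ex p A (fun S => if ∀ i ∈ I, ¬ D i ⊆ S then (1:ℝ) else 0) ≤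
      Ex p A (fun S => if ∀ i ∈ I', ¬ D i ⊆ S then (1:ℝ) else 0) := by
    apply Ex_mono hp hp1
    intro S _
    by_cases h : ∀ i ∈ I, ¬ D i ⊆ S
    · rw [if_pos h, if_pos (fun j hj => h j (hI' hj))]
    · rw [if_neg h]; split_ifs <;> norm_num
  refine g1.trans (hb.trans (Real.exp_le_exp.2 (neg_le_neg ?_)))
  have g2 : μ ^ 2 / (4 * Δ) = q * μ - q ^ 2 * Δ := by rw [hq]; field_simp; ring
  have g3 : q ^ 2 * ∑ x ∈ O, p ^ (D x.1 ∪ D x.2).card ≤ q ^ 2 * Δ :=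
    mul_le_mul_of_nonneg_left (by linarith) (by positivity)
  rw [g2]
  linarith
end RandomSubset2

section PrBasics
variable {n : ℕ}

/-- The set of potential edges. -/
noncomputable def allE (n : ℕ) : Finset (Sym2 (Fin n)) := univ.filter (fun e => ¬ e.IsDiag)

lemma allE_card (n : ℕ) : (allE n).card = n.choose 2 := by
  have := Sym2.card_subtype_not_diag (α := Fin n)
  rw [Fintype.card_fin, Fintype.card_subtype] at this
  rw [← this, allE]

lemma Pr_eq_Ex (p : ℝ) (P : SimpleGraph (Fin n) → Prop) :
    Pr n p P = Ex p (allE n) (fun S => if P (SimpleGraph.fromEdgeSet (S : Set (Sym2 (Fin n)))) then 1 else 0) := by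
  unfold Pr Ex
  symm
  apply Finset.sum_bij' (i := fun (S : Finset (Sym2 (Fin n))) _ => SimpleGraph.fromEdgeSet (S : Set (Sym2 (Fin n))))
    (j := fun (H : SimpleGraph (Fin n)) _ => (H.edgeFinset : Finset (Sym2 (Fin n))))
  · intro S hS; simp
  · intro H _
    rw [Finset.mem_powerset]
    intro e he
    simp only [allE, Finset.mem_filter, Finset.mem_univ, true_and]
    exact H.not_isDiag_of_mem_edgeSet (by simpa using he)
  · intro S hS
    rw [Finset.mem_powerset] at hS
    ext e
    simp only [SimpleGraph.mem_edgeFinset, SimpleGraph.edgeSet_fromEdgeSet]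
    constructor
    · intro h; exact_mod_cast h.1
    · intro h
      refine ⟨by exact_mod_cast h, ?_⟩
      have := hS h
      simpa [allE] using this
  · intro H _; simp
  · intro S hS
    rw [Finset.mem_powerset] at hS
    have hc : edgeCount (SimpleGraph.fromEdgeSet (S : Set (Sym2 (Fin n)))) = S.card := by
      unfold edgeCount
      rw [SimpleGraph.edgeSet_fromEdgeSet]
      have : ((S : Set (Sym2 (Fin n))) \ {e | e.IsDiag}) = (S : Set (Sym2 (Fin n))) := by
        ext e
        constructor
        · exact fun h => h.1
        · intro h
          refine ⟨h, ?_⟩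
          have := hS (by exact_mod_cast h)
          simpa [allE] using this
      have h2 : ((S : Set (Sym2 (Fin n))) \ Sym2.diagSet) = (S : Set (Sym2 (Fin n))) := by
        convert this using 2
        ext e; simp
      rw [h2]; simp
    rw [hc, allE_card]
    by_cases h : P (SimpleGraph.fromEdgeSet (S : Set (Sym2 (Fin n)))) <;> simp [h]

lemma Pr_mono {p : ℝ} (hp : 0 ≤ p) (hp1 : p ≤ 1) {P Q : SimpleGraph (Fin n) → Prop}
    (h : ∀ H, P H → Q H) : Pr n p P ≤ Pr n p Q := by
  unfold Pr
  apply Finset.sum_le_sum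
  intro H _
  have : 0 ≤ 1 - p := by linarith
  by_cases hH : P H
  · rw [if_pos hH, if_pos (h H hH)]
  · rw [if_neg hH]; split_ifs
    · positivity
    · exact le_rfl

lemma Pr_nonneg {p : ℝ} (hp : 0 ≤ p) (hp1 : p ≤ 1) (P : SimpleGraph (Fin n) → Prop) : 0 ≤ Pr n p P := by
  unfold Pr
  apply Finset.sum_nonneg
  intro H _
  have : 0 ≤ 1 - p := by linarith
  split_ifs <;> positivity

lemma Pr_true (p : ℝ) : Pr n p (fun _ => True) = 1 := by
  rw [Pr_eq_Ex]; simp [Ex_mass]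

lemma Pr_false (p : ℝ) : Pr n p (fun _ => False) = 0 := by
  simp [Pr]

lemma Pr_compl (p : ℝ) (P : SimpleGraph (Fin n) → Prop) : Pr n p P = 1 - Pr n p (fun H => ¬ P H) := by
  rw [← Pr_true (n := n) p, eq_sub_iff_add_eq]
  unfold Pr
  rw [← Finset.sum_add_distrib]
  apply Finset.sum_congr rfl
  intro H _
  by_cases h : P H <;> simp [h]

lemma Pr_exists_le {ι : Type*} {p : ℝ} (hp : 0 ≤ p) (hp1 : p ≤ 1) (I : Finset ι)
    (P : ι → SimpleGraph (Fin n) → Prop) :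
    Pr n p (fun H => ∃ i ∈ I, P i H) ≤ ∑ i ∈ I, Pr n p (P i) := by
  unfold Pr
  rw [Finset.sum_comm]
  apply Finset.sum_le_sum
  intro H _
  have h0 : 0 ≤ 1 - p := by linarith
  have hn : ∀ i ∈ I, 0 ≤ (if P i H then p ^ edgeCount H * (1 - p) ^ (n.choose 2 - edgeCount H) else 0) := by
    intro i _; split_ifs <;> positivity
  by_cases h : ∃ i ∈ I, P i H
  · rw [if_pos h]
    obtain ⟨i, hi, hP⟩ := h
    have := Finset.single_le_sum hn hi
    simpa [hP] using this
  · rw [if_neg h]; exact Finset.sum_nonneg hn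

lemma Pr_or_le {p : ℝ} (hp : 0 ≤ p) (hp1 : p ≤ 1) (P Q : SimpleGraph (Fin n) → Prop) :
    Pr n p (fun H => P H ∨ Q H) ≤ Pr n p P + Pr n p Q := by
  have := Pr_exists_le hp hp1 (univ : Finset Bool) (fun b => if b then P else Q)
  simp at this
  refine le_trans (Pr_mono hp hp1 ?_) this
  tauto

/-- Union bound over a finite type with a uniform bound. -/
lemma Pr_exists_le_card {ι : Type*} [Fintype ι] {p : ℝ} (hp : 0 ≤ p) (hp1 : p ≤ 1)
    (P : ι → SimpleGraph (Fin n) → Prop) (b : ℝ) (hb : ∀ i, Pr n p (P i) ≤ b) :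
    Pr n p (fun H => ∃ i, P i H) ≤ Fintype.card ι * b := by
  have := Pr_exists_le hp hp1 (univ : Finset ι) P
  simp only [Finset.mem_univ, true_and] at this
  refine this.trans ?_
  refine (Finset.sum_le_card_nsmul _ _ b (fun i _ => hb i)).trans ?_
  simp
end PrBasics

open Finset
open scoped Classical

/-- Admissible edge probability: every small clique count is at least `Λ log n` (rooted). -/
structure GoodP (n s : ℕ) (p Λ : ℝ) : Prop where
  nonneg : 0 ≤ p
  le_one : p ≤ 1
  lam : ∀ i, 2 ≤ i → i ≤ s → Λ * Real.log n ≤ (n : ℝ) ^ (i - 1) * p ^ (i.choose 2)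

lemma GoodP.mono {n s : ℕ} {p Λ Λ' : ℝ} (h : GoodP n s p Λ) (hn : 1 ≤ n) (hΛ : Λ' ≤ Λ) : GoodP n s p Λ' :=
  ⟨h.nonneg, h.le_one, fun i h2 hs => le_trans
    (mul_le_mul_of_nonneg_right hΛ (Real.log_nonneg (by exact_mod_cast hn))) (h.lam i h2 hs)⟩

/-- Edges of the clique on `R`. -/
noncomputable def DD {n : ℕ} (R : Finset (Fin n)) : Finset (Sym2 (Fin n)) := R.offDiag.image (fun x => s(x.1, x.2))

lemma mem_DD {n : ℕ} (R : Finset (Fin n)) (x y : Fin n) : s(x, y) ∈ DD R ↔ x ∈ R ∧ y ∈ R ∧ x ≠ y := by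
  unfold DD
  simp only [Finset.mem_image, Finset.mem_offDiag, Prod.exists, Sym2.eq_iff]
  constructor
  · rintro ⟨a, b, ⟨ha, hb, hab⟩, (⟨rfl, rfl⟩ | ⟨rfl, rfl⟩)⟩
    · exact ⟨ha, hb, hab⟩
    · exact ⟨hb, ha, hab.symm⟩
  · rintro ⟨hx, hy, hxy⟩
    exact ⟨x, y, ⟨hx, hy, hxy⟩, Or.inl ⟨rfl, rfl⟩⟩

lemma DD_card {n : ℕ} (R : Finset (Fin n)) : (DD R).card = R.card.choose 2 := by
  unfold DD
  exact Sym2.card_image_offDiag R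

lemma DD_sub {n : ℕ} (R : Finset (Fin n)) : DD R ⊆ allE n := by
  intro e
  induction e using Sym2.ind with
  | _ x y => rw [mem_DD]; simp [allE]

lemma DD_inter {n : ℕ} (R R' : Finset (Fin n)) : DD R ∩ DD R' = DD (R ∩ R') := by
  ext e
  induction e using Sym2.ind with
  | _ x y => simp only [Finset.mem_inter, mem_DD]; tauto

lemma DD_union_card {n : ℕ} (R R' : Finset (Fin n)) :
    (DD R ∪ DD R').card + (R ∩ R').card.choose 2 = R.card.choose 2 + R'.card.choose 2 := by
  rw [← DD_card (R ∩ R'), ← DD_inter, Finset.card_union_add_card_inter, DD_card, DD_card]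

lemma rooted_clique {κ : Type*} [Fintype κ] (s : ℕ) (hκ1 : 1 ≤ Fintype.card κ) (hκs : Fintype.card κ ≤ s)
    (n : ℕ) (hn : 2 ≤ n) (p c K Λ : ℝ) (hc : 0 < c) (hK : 0 < K)
    (hΛ : Λ = 4 * 2 ^ s * (s:ℝ) ^ s * K / c)
    (hg : GoodP n s p Λ) (t : ℕ) (F : Finset (κ → Fin n)) (hinj : ∀ f ∈ F, Function.Injective f)
    (hF : c * t * (n:ℝ) ^ (Fintype.card κ - 1) ≤ F.card) :
    Pr n p (fun H => ∀ f ∈ F, ¬ ∀ a b, a ≠ b → H.Adj (f a) (f b)) ≤ Real.exp (-(K * t * Real.log n)) := by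
  have hp := hg.nonneg
  have hp1 := hg.le_one
  set j := Fintype.card κ with hj
  have hn0 : (0:ℝ) < n := by positivity
  have hlog : 0 < Real.log n := Real.log_pos (by exact_mod_cast hn)
  have htriv : ∀ P, Pr n p P ≤ 1 := fun P => by
    rw [← Pr_true (n := n) p]; exact Pr_mono hp hp1 (fun _ _ => trivial)
  rcases F.eq_empty_or_nonempty with hFe | hFne
  · subst hFe
    have : t = 0 := by
      by_contra h
      have : (0:ℝ) < t := by positivity
      have : 0 < c * t * (n:ℝ) ^ (j - 1) := by positivity
      simp at hF; linarith
    subst this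
    simpa using htriv _
  have hs1 : 1 ≤ s := hκ1.trans hκs
  have hs0 : (0:ℝ) < s := by exact_mod_cast hs1
  rcases Nat.lt_or_ge j 2 with hj2 | hj2
  · obtain ⟨f, hf⟩ := hFne
    have : Pr n p (fun H => ∀ f ∈ F, ¬ ∀ a b, a ≠ b → H.Adj (f a) (f b)) ≤ Pr n p (fun _ => False) := by
      apply Pr_mono hp hp1
      intro H h
      apply h f hf
      intro a b hab
      have : Subsingleton κ := Fintype.card_le_one_iff_subsingleton.1 (by omega)
      exact absurd (Subsingleton.elim a b) hab
    rw [Pr_false] at this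
    exact this.trans (Real.exp_pos _).le
  have hΛ0 : 0 < Λ := by rw [hΛ]; positivity
  have hp0 : 0 < p := by
    rcases hp.lt_or_eq with h | h
    · exact h
    · have := hg.lam 2 le_rfl (hj2.trans hκs)
      rw [← h] at this
      have h3 : 0 < Λ * Real.log n := by positivity
      simp at this; linarith
  set Ch := j.choose 2 with hCh
  set W : ℝ := 2 ^ j * (j:ℝ) ^ j * (n:ℝ) ^ (j - 1) * p ^ Ch / (Λ * Real.log n) with hW
  have hW0 : 0 < W := by
    have : (0:ℝ) < j := by exact_mod_cast hκ1
    positivity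
  set D : (κ → Fin n) → Finset (Sym2 (Fin n)) := fun f => DD (univ.image f) with hD
  have hRc : ∀ f ∈ F, (univ.image f).card = j := by
    intro f hf
    rw [Finset.card_image_of_injective _ (hinj f hf)]; simp [hj]
  have hDc : ∀ f ∈ F, (D f).card = Ch := by
    intro f hf
    rw [hD]; simp only; rw [DD_card, hRc f hf]
  have hFc : (0:ℝ) < F.card := by exact_mod_cast hFne.card_pos
  have hJ := janson hp hp1 (allE n) D (fun f => DD_sub _) F (F.card * (p ^ Ch * W)) (by positivity) ?_
  · rw [Pr_eq_Ex]
    refine le_trans ?_ (hJ.trans ?_)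
    · apply Ex_mono hp hp1
      intro S _
      by_cases h : ∀ f ∈ F, ¬ ∀ a b, a ≠ b → (SimpleGraph.fromEdgeSet (S : Set (Sym2 (Fin n)))).Adj (f a) (f b)
      · rw [if_pos h, if_pos]
        intro f hf hsub
        apply h f hf
        intro a b hab
        have hne : f a ≠ f b := fun h' => hab (hinj f hf h')
        rw [SimpleGraph.fromEdgeSet_adj]
        refine ⟨?_, hne⟩
        have : s(f a, f b) ∈ D f := by
          rw [hD]; simp only; rw [mem_DD]
          exact ⟨by simp, by simp, hne⟩
        exact_mod_cast hsub this
      · rw [if_neg h]; split_ifs <;> norm_num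
    · apply Real.exp_le_exp.2
      apply neg_le_neg
      rw [Finset.sum_congr rfl (fun f hf => by rw [hDc f hf]), Finset.sum_const, nsmul_eq_mul]
      have e1 : ((F.card:ℝ) * p ^ Ch) ^ 2 / (4 * (F.card * (p ^ Ch * W))) = F.card * p ^ Ch / (4 * W) := by
        field_simp
      rw [e1, le_div_iff₀ (by positivity), hW]
      have e2 : K * t * Real.log n * (4 * (2 ^ j * (j:ℝ) ^ j * (n:ℝ) ^ (j - 1) * p ^ Ch / (Λ * Real.log n)))
          = (4 * 2 ^ j * (j:ℝ)^j * K / Λ) * t * (n:ℝ) ^ (j - 1) * p ^ Ch := by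
        field_simp
      rw [e2]
      apply mul_le_mul_of_nonneg_right _ (by positivity)
      refine le_trans ?_ hF
      apply mul_le_mul_of_nonneg_right _ (by positivity)
      apply mul_le_mul_of_nonneg_right _ (by positivity)
      rw [div_le_iff₀ hΛ0, hΛ]
      have e3 : c * (4 * 2 ^ s * (s:ℝ) ^ s * K / c) = 4 * 2 ^ s * (s:ℝ)^s * K := by field_simp
      rw [e3]
      have e4 : (2:ℝ) ^ j ≤ 2 ^ s := pow_le_pow_right₀ (by norm_num) hκs
      have e5 : (j:ℝ) ^ j ≤ (s:ℝ) ^ s := by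
        calc (j:ℝ) ^ j ≤ (s:ℝ) ^ j := pow_le_pow_left₀ (by positivity) (by exact_mod_cast hκs) _
          _ ≤ (s:ℝ) ^ s := pow_le_pow_right₀ (by exact_mod_cast hs1) hκs
      gcongr
  · -- the Δ bound
    rw [Finset.sum_filter, Finset.sum_product]
    rw [← nsmul_eq_mul]
    apply Finset.sum_le_card_nsmul
    intro f hf
    dsimp only
    refine le_trans (le_of_eq ?_) (?_ : ∑ y ∈ F.filter (fun y => f = y ∨ ¬ Disjoint (D f) (D y)), p ^ (D f ∪ D y).card ≤ _)
    · rw [Finset.sum_filter]; congr!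
    set R := univ.image f with hR
    set pos : (κ → Fin n) → Finset κ := fun f' => univ.filter (fun a => f' a ∈ R) with hpos
    rw [← Finset.sum_fiberwise _ pos]
    have hbd : ∀ I : Finset κ, ∑ f' ∈ (F.filter (fun f' => f = f' ∨ ¬ Disjoint (D f) (D f'))).filter (fun f' => pos f' = I),
        p ^ (D f ∪ D f').card ≤ (j:ℝ) ^ j * p ^ Ch * ((n:ℝ) ^ (j - 1) * p ^ Ch / (Λ * Real.log n)) := by
      intro I
      set Z := (F.filter (fun f' => f = f' ∨ ¬ Disjoint (D f) (D f'))).filter (fun f' => pos f' = I) with hZ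
      rcases Z.eq_empty_or_nonempty with hZe | ⟨f₀, hf₀⟩
      · rw [hZe]; simp; positivity
      have hposc : ∀ f' ∈ F, (pos f').card = (R ∩ univ.image f').card := by
        intro f' hf'
        rw [← Finset.card_image_of_injective (pos f') (hinj f' hf')]
        congr 1
        ext x
        simp only [hpos, Finset.mem_image, Finset.mem_filter, Finset.mem_univ, true_and, Finset.mem_inter]
        constructor
        · rintro ⟨a, ha, rfl⟩; exact ⟨ha, a, rfl⟩
        · rintro ⟨hx, a, rfl⟩; exact ⟨a, hx, rfl⟩
      have hI2 : 2 ≤ I.card := by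
        simp only [hZ, Finset.mem_filter] at hf₀
        obtain ⟨⟨h1, h2⟩, rfl⟩ := hf₀
        rw [hposc f₀ h1]
        rcases h2 with rfl | h2
        · rw [← hR, Finset.inter_self, hR, hRc f hf]; exact hj2
        · by_contra hlt
          apply h2
          rw [Finset.disjoint_iff_inter_eq_empty]
          rw [hD]; simp only; rw [DD_inter, ← Finset.card_eq_zero, DD_card]
          rw [← hR]; exact Nat.choose_eq_zero_of_lt (by omega)
      have hIj : I.card ≤ j := by rw [hj]; exact Finset.card_le_univ I
      have hterm : ∀ f' ∈ Z, p ^ (D f ∪ D f').card = p ^ (2 * Ch - I.card.choose 2) := by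
        intro f' hf'
        simp only [hZ, Finset.mem_filter] at hf'
        obtain ⟨⟨h1, h2⟩, h3⟩ := hf'
        congr 1
        have := DD_union_card (univ.image f) (univ.image f')
        rw [← hR, ← hposc f' h1, h3, hR, hRc f hf, hRc f' h1] at this
        show (DD (univ.image f) ∪ DD (univ.image f')).card = _
        omega
      rw [Finset.sum_congr rfl hterm, Finset.sum_const, nsmul_eq_mul]
      have hcount : Z.card ≤ j ^ j * n ^ (j - I.card) := by
        have hsub : Z ⊆ Fintype.piFinset (fun a => if a ∈ I then R else univ) := by
          intro f' hf'
          simp only [hZ, Finset.mem_filter] at hf'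
          rw [Fintype.mem_piFinset]
          intro a
          split_ifs with ha
          · rw [← hf'.2] at ha
            simpa [hpos] using ha
          · simp
        refine (Finset.card_le_card hsub).trans ?_
        rw [Fintype.card_piFinset]
        have : ∏ a : κ, (if a ∈ I then R else univ).card = ∏ a : κ, (if a ∈ I then j else n) := by
          apply Finset.prod_congr rfl
          intro a _
          split_ifs
          · exact hRc f hf
          · simp
        rw [this, Finset.prod_ite, Finset.prod_const, Finset.prod_const]
        have e1 : (univ.filter (fun a => a ∈ I)).card = I.card := by simp
        have e2 : (univ.filter (fun a => a ∉ I)).card = j - I.card := by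
          have := Finset.card_compl I
          rw [← hj] at this
          rw [← this]; congr 1; ext; simp
        rw [e1, e2]
        exact Nat.mul_le_mul_right _ (Nat.pow_le_pow_right hκ1 hIj)
      have hl := hg.lam I.card hI2 (hIj.trans hκs)
      have hch : I.card.choose 2 ≤ Ch := Nat.choose_le_choose 2 hIj
      calc (Z.card:ℝ) * p ^ (2 * Ch - I.card.choose 2)
          ≤ ((j:ℝ) ^ j * (n:ℝ) ^ (j - I.card)) * p ^ (2 * Ch - I.card.choose 2) := by
            apply mul_le_mul_of_nonneg_right _ (by positivity)
            exact_mod_cast hcount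
        _ ≤ _ := by
            rw [show 2 * Ch - I.card.choose 2 = Ch + (Ch - I.card.choose 2) by omega, pow_add]
            rw [show (j:ℝ) ^ j * (n:ℝ) ^ (j - I.card) * (p ^ Ch * p ^ (Ch - I.card.choose 2))
              = (j:ℝ) ^ j * p ^ Ch * ((n:ℝ) ^ (j - I.card) * p ^ (Ch - I.card.choose 2)) by ring]
            apply mul_le_mul_of_nonneg_left _ (by positivity)
            rw [le_div_iff₀ (by positivity)]
            calc (n:ℝ) ^ (j - I.card) * p ^ (Ch - I.card.choose 2) * (Λ * Real.log n)
                ≤ (n:ℝ) ^ (j - I.card) * p ^ (Ch - I.card.choose 2) * ((n:ℝ) ^ (I.card - 1) * p ^ (I.card.choose 2)) :=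
                  mul_le_mul_of_nonneg_left hl (by positivity)
              _ = ((n:ℝ) ^ (j - I.card) * (n:ℝ) ^ (I.card - 1)) * (p ^ (Ch - I.card.choose 2) * p ^ (I.card.choose 2)) := by ring
              _ = _ := by
                rw [← pow_add, ← pow_add]
                congr 2 <;> omega
    refine (Finset.sum_le_sum (fun I _ => hbd I)).trans ?_
    rw [Finset.sum_const, Finset.card_univ, Fintype.card_finset, ← hj, nsmul_eq_mul, hW]
    push_cast
    apply le_of_eq
    ring

open Finset
open scoped Classical

section Counting
variable {κ : Type*} [Fintype κ] {n : ℕ}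

lemma card_fix (B : Finset κ) (a : κ → Fin n) :
    (univ.filter (fun a' : κ → Fin n => ∀ i ∈ B, a' i = a i)).card = n ^ (Fintype.card κ - B.card) := by
  have : univ.filter (fun a' : κ → Fin n => ∀ i ∈ B, a' i = a i)
      = Fintype.piFinset (fun i => if i ∈ B then {a i} else univ) := by
    ext a'
    simp only [Finset.mem_filter, Finset.mem_univ, true_and, Fintype.mem_piFinset]
    refine forall_congr' fun i => ?_
    by_cases h : i ∈ B <;> simp [h]
  rw [this, Fintype.card_piFinset]
  have h2 : ∏ i : κ, (if i ∈ B then ({a i} : Finset (Fin n)) else univ).card = ∏ i : κ, (if i ∈ B then 1 else n) := by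
    apply Finset.prod_congr rfl
    intro i _
    split_ifs <;> simp
  rw [h2, Finset.prod_ite, Finset.prod_const, Finset.prod_const, one_pow, one_mul]
  congr 1
  rw [← Finset.card_compl]; congr 1; ext; simp

lemma card_noninj (hn : 1 ≤ n) :
    (univ.filter (fun f : κ → Fin n => ¬ Function.Injective f)).card ≤ (Fintype.card κ) ^ 2 * n ^ (Fintype.card κ - 1) := by
  have hsub : univ.filter (fun f : κ → Fin n => ¬ Function.Injective f) ⊆
      (univ : Finset κ).offDiag.biUnion (fun x => (univ : Finset (Fin n)).biUnion (fun y =>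
        univ.filter (fun a' : κ → Fin n => ∀ i ∈ ({x.1, x.2} : Finset κ), a' i = (fun _ => y) i))) := by
    intro f hf
    have hf := (Finset.mem_filter.1 hf).2
    have hf' : ∃ i j, f i = f j ∧ i ≠ j := by by_contra hcon; push Not at hcon; exact hf (fun i j h => hcon i j h)
    obtain ⟨i, j, h1, h2⟩ := hf'
    simp only [Finset.mem_biUnion, Finset.mem_filter, Finset.mem_univ, true_and, Finset.mem_offDiag]
    exact ⟨(i, j), h2, f i, by simp [h1]⟩
  refine (Finset.card_le_card hsub).trans ?_
  refine (Finset.card_biUnion_le_card_mul _ _ (n ^ (Fintype.card κ - 1)) ?_).trans ?_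
  · intro x hx
    rw [Finset.mem_offDiag] at hx
    refine (Finset.card_biUnion_le_card_mul _ _ (n ^ (Fintype.card κ - 2)) ?_).trans ?_
    · intro y _
      rw [card_fix, Finset.card_pair hx.2.2]
    · have : 2 ≤ Fintype.card κ := by
        rw [← Finset.card_pair hx.2.2]; exact Finset.card_le_univ _
      rw [Finset.card_univ, Fintype.card_fin, ← pow_succ']
      exact Nat.pow_le_pow_right hn (by omega)
  · apply Nat.mul_le_mul_right
    rw [Finset.offDiag_card, Finset.card_univ, sq]
    omega

lemma card_noninj_le (hn : 1 ≤ n) (Z : Finset (κ → Fin n)) (hZ : ∀ f ∈ Z, ¬ Function.Injective f) :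
    Z.card ≤ (Fintype.card κ) ^ 2 * n ^ (Fintype.card κ - 1) :=
  (Finset.card_le_card (fun f hf => by simpa using hZ f hf)).trans (card_noninj hn)

lemma card_root_le (v : κ) (X : Finset (Fin n)) (Z : Finset (κ → Fin n)) (hZ : ∀ f ∈ Z, f v ∈ X) :
    Z.card ≤ X.card * n ^ (Fintype.card κ - 1) := by
  have hsub : Z ⊆ X.biUnion (fun x => univ.filter (fun a' : κ → Fin n => ∀ i ∈ ({v} : Finset κ), a' i = (fun _ => x) i)) := by
    intro f hf
    simp only [Finset.mem_biUnion, Finset.mem_filter, Finset.mem_univ, true_and, Finset.mem_singleton, forall_eq]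
    exact ⟨_, hZ f hf, rfl⟩
  refine (Finset.card_le_card hsub).trans ?_
  apply Finset.card_biUnion_le_card_mul
  intro x _
  rw [card_fix]; simp
end Counting

/-- `f` maps the block `B` to a clique of `H`. -/
def Cl {ι : Type*} {n : ℕ} (H : SimpleGraph (Fin n)) (f : ι → Fin n) (B : Finset ι) : Prop :=
  ∀ a ∈ B, ∀ b ∈ B, a ≠ b → H.Adj (f a) (f b)

/-- Ordered star-forest condition for a list of blocks. -/
def FL {ι : Type*} (s : ℕ) : List (Finset ι) → Prop
  | [] => True
  | B :: l => (∃ v ∈ B, ∀ x ∈ B, x ≠ v → ∀ B' ∈ l, x ∉ B') ∧ B.card ≤ s ∧ FL s l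

lemma two_pow_le_exp (n : ℕ) (hn : 3 ≤ n) : (2:ℝ) ^ n ≤ Real.exp (n * Real.log n) := by
  have h1 : (2:ℝ) ^ n ≤ (n:ℝ) ^ n := pow_le_pow_left₀ (by norm_num) (by exact_mod_cast (by omega : 2 ≤ n)) _
  have : Real.exp (n * Real.log n) = (n:ℝ) ^ n := by
    rw [mul_comm, Real.exp_mul, Real.exp_log (by positivity), Real.rpow_natCast]
  rw [this]; exact h1

lemma npow_eq_exp (n b : ℕ) (hn : 1 ≤ n) : ((n:ℝ) ^ b) = Real.exp (b * Real.log n) := by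
  rw [mul_comm, Real.exp_mul, Real.exp_log (by positivity), Real.rpow_natCast]

lemma one_le_log (n : ℕ) (hn : 3 ≤ n) : 1 ≤ Real.log n := by
  rw [Real.le_log_iff_exp_le (by positivity)]
  have := Real.exp_one_lt_d9
  have : (3:ℝ) ≤ n := by exact_mod_cast hn
  linarith

set_option maxHeartbeats 1600000 in
theorem star_forest_aux {ι : Type*} [Fintype ι] (s : ℕ) (l : List (Finset ι)) (hl : FL s l) :
    ∀ K c : ℝ, 0 < K → 0 < c → ∃ Λ : ℝ, ∃ n₀ : ℕ, 0 < Λ ∧ ∀ n, n₀ ≤ n → ∀ p, GoodP n s p Λ →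
      ∀ A : Finset (ι → Fin n), c * (n:ℝ) ^ (Fintype.card ι) ≤ A.card →
        Pr n p (fun H => ¬ ∃ a ∈ A, ∀ B ∈ l, Cl H a B) ≤ Real.exp (-(K * n * Real.log n)) := by
  induction l with
  | nil =>
    intro K c hK hc
    refine ⟨1, 1, one_pos, fun n hn p hg A hA => ?_⟩
    have : 0 < (A.card : ℝ) := lt_of_lt_of_le (by positivity) hA
    have hne : A.Nonempty := by rw [← Finset.card_pos]; exact_mod_cast this
    obtain ⟨a, ha⟩ := hne
    have h0 : Pr n p (fun H => ¬ ∃ a ∈ A, ∀ B ∈ ([] : List (Finset ι)), Cl H a B) ≤ Pr n p (fun _ => False) :=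
      Pr_mono hg.nonneg hg.le_one (fun H h => h ⟨a, ha, by simp⟩)
    rw [Pr_false] at h0
    exact h0.trans (Real.exp_pos _).le
  | cons B l ih =>
    obtain ⟨⟨v, hvB, hv⟩, hBs, hl'⟩ := hl
    intro K c hK hc
    set m := Fintype.card ι with hm
    set b := B.card with hb
    have hb1 : 1 ≤ b := Finset.card_pos.2 ⟨v, hvB⟩
    have hbm : b ≤ m := Finset.card_le_univ B
    have hcardB : Fintype.card B = b := by simp [hb]
    obtain ⟨Λ₁, n₁, hΛ₁, hind⟩ := ih hl' (K + s + 2) (c / 8 * (c / 2)) (by positivity) (by positivity)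
    set Λ₂ : ℝ := 4 * 2 ^ s * (s:ℝ) ^ s * (K + 2) / (c / 4) with hΛ₂
    have hs0 : (0:ℝ) < s := by exact_mod_cast (hb1.trans hBs)
    have hΛ₂0 : 0 < Λ₂ := by positivity
    obtain ⟨n₂, hn₂⟩ := exists_nat_gt (8 * (b:ℝ) ^ 2 / c)
    refine ⟨max Λ₁ Λ₂, max (max n₁ n₂) 3, lt_max_of_lt_left hΛ₁, fun n hn p hg A hA => ?_⟩
    have hn3 : 3 ≤ n := (le_max_right _ _).trans hn
    have hnn1 : n₁ ≤ n := (le_max_left _ _).trans ((le_max_left _ _).trans hn)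
    have hnn2 : n₂ ≤ n := (le_max_right _ _).trans ((le_max_left _ _).trans hn)
    have hn0 : (0:ℝ) < n := by positivity
    have hlog : 1 ≤ Real.log n := one_le_log n hn3
    have hg1 := hg.mono (by omega) (le_max_left Λ₁ Λ₂)
    have hg2 := hg.mono (by omega) (le_max_right Λ₁ Λ₂)
    have hp := hg.nonneg
    have hp1 := hg.le_one
    -- restriction to B, extensions
    set ext : (B → Fin n) → Finset (ι → Fin n) := fun g => A.filter (fun a => (fun i : B => a i) = g) with hext
    set Dn : Finset (B → Fin n) := univ.filter (fun g => c / 2 * (n:ℝ) ^ (m - b) ≤ (ext g).card) with hDn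
    have hextc : ∀ g, (ext g).card ≤ n ^ (m - b) := by
      intro g
      rcases (ext g).eq_empty_or_nonempty with h | ⟨a, ha⟩
      · rw [h]; simp
      · rw [← card_fix B a]
        apply Finset.card_le_card
        intro a' ha'
        simp only [hext, Finset.mem_filter, Finset.mem_univ, true_and] at ha ha' ⊢
        intro i hi
        have := ha'.2.trans ha.2.symm
        exact congrFun this ⟨i, hi⟩
    have hDnc : c / 2 * (n:ℝ) ^ b ≤ Dn.card := by
      have h1 : (A.card : ℝ) = ∑ g : B → Fin n, ((ext g).card : ℝ) := by
        rw [Finset.card_eq_sum_card_fiberwise (f := fun a => (fun i : B => a i)) (t := univ) (by intro x _; simp)]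
        push_cast
        rfl
      have h2 : (A.card : ℝ) ≤ Dn.card * (n:ℝ) ^ (m - b) + (n:ℝ) ^ b * (c / 2 * (n:ℝ) ^ (m - b)) := by
        rw [h1, ← Finset.sum_filter_add_sum_filter_not univ (fun g => c / 2 * (n:ℝ) ^ (m - b) ≤ ((ext g).card : ℝ))]
        apply add_le_add
        · rw [← nsmul_eq_mul]
          apply Finset.sum_le_card_nsmul
          intro g _
          exact_mod_cast hextc g
        · refine (Finset.sum_le_card_nsmul _ _ (c / 2 * (n:ℝ) ^ (m - b)) ?_).trans ?_
          · intro g hg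
            simp only [Finset.mem_filter] at hg
            exact (not_le.1 hg.2).le
          · rw [nsmul_eq_mul]
            apply mul_le_mul_of_nonneg_right _ (by positivity)
            have := Finset.card_le_univ (univ.filter (fun g => ¬ c / 2 * (n:ℝ) ^ (m - b) ≤ ((ext g).card : ℝ)))
            rw [Fintype.card_fun, Fintype.card_fin, hcardB] at this
            exact_mod_cast this
      have h3 : (n:ℝ) ^ m = (n:ℝ) ^ b * (n:ℝ) ^ (m - b) := by rw [← pow_add]; congr 1; omega
      have h4 : (0:ℝ) < (n:ℝ) ^ (m - b) := by positivity
      rw [h3] at hA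
      have h5 : c / 2 * (n:ℝ) ^ b * (n:ℝ) ^ (m - b) ≤ Dn.card * (n:ℝ) ^ (m - b) := by nlinarith
      exact le_of_mul_le_mul_right h5 h4
    -- dense injective tuples rooted outside X
    set FX : Finset (Fin n) → Finset (B → Fin n) := fun X =>
      Dn.filter (fun g => Function.Injective g ∧ g ⟨v, hvB⟩ ∉ X) with hFX
    have hFXc : ∀ X : Finset (Fin n), (X.card : ℝ) ≤ c / 8 * n → c / 4 * n * (n:ℝ) ^ (b - 1) ≤ (FX X).card := by
      intro X hX
      have hsub : Dn ⊆ FX X ∪ (Dn.filter (fun f => ¬ Function.Injective f) ∪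
          Dn.filter (fun f => f ⟨v, hvB⟩ ∈ X)) := by
        intro g hg
        simp only [hFX, Finset.mem_union, Finset.mem_filter]
        tauto
      have h1 := (Finset.card_le_card hsub).trans ((Finset.card_union_le _ _).trans
        (Nat.add_le_add_left (Finset.card_union_le _ _) _))
      have h2 := card_root_le (⟨v, hvB⟩ : B) X (Dn.filter (fun f => f ⟨v, hvB⟩ ∈ X)) (fun f hf => (Finset.mem_filter.1 hf).2)
      have h3 := card_noninj_le (by omega) (Dn.filter (fun f => ¬ Function.Injective f)) (fun f hf => (Finset.mem_filter.1 hf).2)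
      rw [hcardB] at h3 h2
      have h4 : (Dn.card : ℝ) ≤ (FX X).card + ((b:ℝ) ^ 2 * (n:ℝ) ^ (b - 1) + X.card * (n:ℝ) ^ (b - 1)) := by
        have := h1.trans (Nat.add_le_add_left (Nat.add_le_add h3 h2) _)
        exact_mod_cast this
      have h5 : (n:ℝ) ^ b = n * (n:ℝ) ^ (b - 1) := by rw [← pow_succ']; congr 1; omega
      have h6 : (b:ℝ) ^ 2 ≤ c / 8 * n := by
        have : 8 * (b:ℝ) ^ 2 / c < n := hn₂.trans_le (by exact_mod_cast hnn2)
        rw [div_lt_iff₀ hc] at this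
        nlinarith
      have h7 : (0:ℝ) < (n:ℝ) ^ (b - 1) := by positivity
      rw [h5] at hDnc
      nlinarith
    -- event 1
    set E1 : SimpleGraph (Fin n) → Prop := fun H => ∃ X : Finset (Fin n), (X.card : ℝ) ≤ c / 8 * n ∧
      ∀ g ∈ FX X, ¬ ∀ a b, a ≠ b → H.Adj (g a) (g b) with hE1
    have hPE1 : Pr n p E1 ≤ Real.exp (-((K + 1) * n * Real.log n)) := by
      have hb1' : ∀ X : Finset (Fin n), Pr n p (fun H => (X.card : ℝ) ≤ c / 8 * n ∧
          ∀ g ∈ FX X, ¬ ∀ a b, a ≠ b → H.Adj (g a) (g b)) ≤ Real.exp (-((K + 2) * n * Real.log n)) := by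
        intro X
        by_cases hX : (X.card : ℝ) ≤ c / 8 * n
        · refine (Pr_mono hp hp1 (fun H h => h.2)).trans ?_
          exact rooted_clique s (by omega) (by omega) n (by omega) p (c / 4) (K + 2) Λ₂ (by positivity)
            (by positivity) hΛ₂ hg2 n (FX X) (fun f hf => (Finset.mem_filter.1 hf).2.1)
            (by rw [hcardB]; exact hFXc X hX)
        · refine (Pr_mono hp hp1 (Q := fun _ => False) (fun H h => hX h.1)).trans ?_
          rw [Pr_false]; exact (Real.exp_pos _).le
      refine (Pr_exists_le_card hp hp1 _ _ hb1').trans ?_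
      rw [Fintype.card_finset, Fintype.card_fin]
      push_cast
      refine (mul_le_mul_of_nonneg_right (two_pow_le_exp n hn3) (Real.exp_pos _).le).trans ?_
      rw [← Real.exp_add]
      apply Real.exp_le_exp.2
      apply le_of_eq; ring
    -- event 2
    set upd : (Fin n → B → Fin n) → (ι → Fin n) → (ι → Fin n) := fun g a i =>
      if h : i ∈ B then g (a v) ⟨i, h⟩ else a i with hupd
    set A' : Finset (Fin n) → (Fin n → B → Fin n) → Finset (ι → Fin n) := fun Y g =>
      univ.filter (fun a => a v ∈ Y ∧ upd g a ∈ A) with hA'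
    set ok : Finset (Fin n) → (Fin n → B → Fin n) → Prop := fun Y g =>
      c / 8 * n ≤ Y.card ∧ ∀ x ∈ Y, g x ∈ Dn ∧ g x ⟨v, hvB⟩ = x with hok
    have hA'c : ∀ Y g, ok Y g → c / 8 * (c / 2) * (n:ℝ) ^ m ≤ (A' Y g).card := by
      intro Y g hYg
      obtain ⟨hY, hgY⟩ := hYg
      set fib : (ι → Fin n) → Finset (ι → Fin n) := fun a =>
        univ.filter (fun a' : ι → Fin n => ∀ i ∈ (B.erase v)ᶜ, a' i = a i) with hfib
      have hfc : ∀ a, (fib a).card = n ^ (b - 1) := by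
        intro a
        rw [hfib]; simp only
        rw [card_fix, Finset.card_compl, Finset.card_erase_of_mem hvB]
        congr 1; omega
      -- sum over x and a
      have hsub : Y.biUnion (fun x => (ext (g x)).biUnion fib) ⊆ A' Y g := by
        intro a' ha'
        simp only [Finset.mem_biUnion] at ha'
        obtain ⟨x, hx, a, ha, haa⟩ := ha'
        simp only [hext, Finset.mem_filter] at ha
        simp only [hfib, Finset.mem_filter, Finset.mem_univ, true_and, Finset.mem_compl, Finset.mem_erase, not_and] at haa
        simp only [hA', Finset.mem_filter, Finset.mem_univ, true_and]
        have h1 : a' v = a v := haa v (by simp)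
        have h2 : a v = x := by
          rw [← (hgY x hx).2, ← ha.2]
        refine ⟨by rw [h1, h2]; exact hx, ?_⟩
        have : upd g a' = a := by
          funext i
          simp only [hupd]
          split_ifs with hi
          · rw [h1, h2, ← ha.2]
          · exact haa i (fun _ => hi)
        rw [this]; exact ha.1
      have hval : ∀ x ∈ Y, ∀ a' ∈ (ext (g x)).biUnion fib, a' v = x := by
        intro x hx a' ha'
        simp only [Finset.mem_biUnion] at ha'
        obtain ⟨a, ha, haa⟩ := ha'
        simp only [hext, Finset.mem_filter] at ha
        simp only [hfib, Finset.mem_filter, Finset.mem_univ, true_and, Finset.mem_compl, Finset.mem_erase, not_and] at haa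
        have h1 : a' v = a v := haa v (by simp)
        rw [h1, ← (hgY x hx).2, ← ha.2]
      have hin : ∀ x ∈ Y, c / 2 * (n:ℝ) ^ (m - b) * (n:ℝ) ^ (b - 1) ≤ ((ext (g x)).biUnion fib).card := by
        intro x hx
        rw [Finset.card_biUnion]
        · rw [Finset.sum_congr rfl (fun a _ => hfc a), Finset.sum_const, smul_eq_mul]
          push_cast
          apply mul_le_mul_of_nonneg_right _ (by positivity)
          have := (hgY x hx).1
          simpa [hDn] using this
        · intro a ha a2 ha2 hne
          show Disjoint _ _
          rw [Finset.disjoint_left]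
          intro a' h1 h2
          apply hne
          rw [Finset.mem_coe] at ha ha2
          simp only [hext, Finset.mem_filter] at ha ha2
          simp only [hfib, Finset.mem_filter, Finset.mem_univ, true_and, Finset.mem_compl, Finset.mem_erase, not_and] at h1 h2
          funext i
          by_cases hi : i ∈ B
          · exact congrFun (ha.2.trans ha2.2.symm) ⟨i, hi⟩
          · rw [← h1 i (fun _ => hi), h2 i (fun _ => hi)]
      have hcard : (((Y.biUnion (fun x => (ext (g x)).biUnion fib)).card : ℕ) : ℝ) = ∑ x ∈ Y, (((ext (g x)).biUnion fib).card : ℝ) := by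
        rw [Finset.card_biUnion]
        · push_cast; rfl
        · intro x hx y hy hne
          show Disjoint _ _
          rw [Finset.disjoint_left]
          intro a' h1 h2
          exact hne ((hval x hx a' h1).symm.trans (hval y hy a' h2))
      have hle : ((Y.biUnion (fun x => (ext (g x)).biUnion fib)).card : ℝ) ≤ (A' Y g).card := by
        exact_mod_cast Finset.card_le_card hsub
      refine le_trans ?_ hle
      rw [hcard]
      refine le_trans ?_ (Finset.card_nsmul_le_sum _ _ _ hin)
      rw [nsmul_eq_mul]
      have h3 : (n:ℝ) ^ m = n * ((n:ℝ) ^ (m - b) * (n:ℝ) ^ (b - 1)) := by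
        rw [← pow_add, ← pow_succ']; congr 1; omega
      rw [h3]
      have : c / 8 * (c / 2) * (n * ((n:ℝ) ^ (m - b) * (n:ℝ) ^ (b - 1))) = (c / 8 * n) * (c / 2 * (n:ℝ) ^ (m - b) * (n:ℝ) ^ (b - 1)) := by ring
      rw [this]
      exact mul_le_mul_of_nonneg_right hY (by positivity)
    set E2 : SimpleGraph (Fin n) → Prop := fun H => ∃ Yg : Finset (Fin n) × (Fin n → B → Fin n),
      ok Yg.1 Yg.2 ∧ ¬ ∃ a ∈ A' Yg.1 Yg.2, ∀ B ∈ l, Cl H a B with hE2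
    have hPE2 : Pr n p E2 ≤ Real.exp (-((K + 1) * n * Real.log n)) := by
      have hb2' : ∀ Yg : Finset (Fin n) × (Fin n → B → Fin n), Pr n p (fun H => ok Yg.1 Yg.2 ∧
          ¬ ∃ a ∈ A' Yg.1 Yg.2, ∀ B ∈ l, Cl H a B) ≤ Real.exp (-((K + s + 2) * n * Real.log n)) := by
        intro Yg
        by_cases hX : ok Yg.1 Yg.2
        · refine (Pr_mono hp hp1 (fun H h => h.2)).trans ?_
          exact hind n hnn1 p hg1 _ (hA'c _ _ hX)
        · refine (Pr_mono hp hp1 (Q := fun _ => False) (fun H h => hX h.1)).trans ?_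
          rw [Pr_false]; exact (Real.exp_pos _).le
      refine (Pr_exists_le_card hp hp1 _ _ hb2').trans ?_
      rw [Fintype.card_prod, Fintype.card_finset, Fintype.card_fun, Fintype.card_fun, Fintype.card_fin, hcardB]
      push_cast
      rw [← pow_mul, npow_eq_exp n (b * n) (by omega)]
      refine (mul_le_mul_of_nonneg_right (mul_le_mul_of_nonneg_right (two_pow_le_exp n hn3) (Real.exp_pos _).le) (Real.exp_pos _).le).trans ?_
      rw [← Real.exp_add, ← Real.exp_add]
      apply Real.exp_le_exp.2
      have : (b:ℝ) ≤ s := by exact_mod_cast hBs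
      have h2 : (b:ℝ) * (n * Real.log n) ≤ s * (n * Real.log n) := mul_le_mul_of_nonneg_right this (by positivity)
      push_cast
      nlinarith
    -- conclusion
    have hcover : ∀ H, (¬ ∃ a ∈ A, ∀ B' ∈ B :: l, Cl H a B') → E1 H ∨ E2 H := by
      intro H hH
      by_contra hcon
      push Not at hcon
      obtain ⟨hn1, hn2⟩ := hcon
      apply hH
      set Y : Finset (Fin n) := univ.filter (fun x => ∃ g ∈ Dn, Function.Injective g ∧ g ⟨v, hvB⟩ = x ∧
        ∀ a b, a ≠ b → H.Adj (g a) (g b)) with hY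
      have hYc : c / 8 * n ≤ Y.card := by
        by_contra hlt
        apply hn1
        refine ⟨Y, (not_le.1 hlt).le, ?_⟩
        intro g hg hcl
        simp only [hFX, Finset.mem_filter] at hg
        apply hg.2.2
        simp only [hY, Finset.mem_filter, Finset.mem_univ, true_and]
        exact ⟨g, hg.1, hg.2.1, rfl, hcl⟩
      have hch : ∀ x, ∃ g : B → Fin n, x ∈ Y → (g ∈ Dn ∧ Function.Injective g ∧ g ⟨v, hvB⟩ = x ∧
        ∀ a b, a ≠ b → H.Adj (g a) (g b)) := by
        intro x
        by_cases hx : x ∈ Y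
        · have := hx
          simp only [hY, Finset.mem_filter, Finset.mem_univ, true_and] at this
          obtain ⟨g, h⟩ := this
          exact ⟨g, fun _ => h⟩
        · exact ⟨fun _ => x, fun h => absurd h hx⟩
      choose g hg using hch
      have hokk : ok Y g := ⟨hYc, fun x hx => ⟨(hg x hx).1, (hg x hx).2.2.1⟩⟩
      have : ∃ a ∈ A' Y g, ∀ B ∈ l, Cl H a B := by
        by_contra hno
        exact hn2 ⟨(Y, g), hokk, hno⟩
      obtain ⟨a, ha, hcl⟩ := this
      simp only [hA', Finset.mem_filter, Finset.mem_univ, true_and] at ha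
      refine ⟨upd g a, ha.2, ?_⟩
      have hav : upd g a v = a v := by
        simp only [hupd, hvB, dif_pos]
        exact (hg _ ha.1).2.2.1
      intro B' hB'
      rcases List.mem_cons.1 hB' with rfl | hB'
      · intro i hi j hj hij
        simp only [hupd, hi, hj, dif_pos]
        exact (hg _ ha.1).2.2.2 _ _ (fun h => hij (by simpa using h))
      · have hsame : ∀ i ∈ B', upd g a i = a i := by
          intro i hi
          by_cases hiB : i ∈ B
          · by_cases hiv : i = v
            · rw [hiv]; exact hav
            · exact absurd hi (hv i hiB hiv B' hB')
          · simp [hupd, hiB]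
        intro i hi j hj hij
        rw [hsame i hi, hsame j hj]
        exact hcl B' hB' i hi j hj hij
    refine (Pr_mono hp hp1 hcover).trans ((Pr_or_le hp hp1 E1 E2).trans ((add_le_add hPE1 hPE2).trans ?_))
    have h1 : Real.exp (-((K + 1) * n * Real.log n)) = Real.exp (-(n * Real.log n)) * Real.exp (-(K * n * Real.log n)) := by
      rw [← Real.exp_add]; congr 1; ring
    have h2 : Real.exp (-(n * Real.log n)) ≤ 1 / 2 := by
      have h3 : (2:ℝ) ≤ Real.exp (n * Real.log n) := by
        refine le_trans ?_ (two_pow_le_exp n hn3)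
        calc (2:ℝ) = 2 ^ 1 := by norm_num
          _ ≤ 2 ^ n := pow_le_pow_right₀ (by norm_num) (by omega)
      rw [Real.exp_neg, one_div]
      exact inv_anti₀ (by norm_num) h3
    rw [h1]
    have := Real.exp_pos (-(K * n * Real.log n))
    nlinarith

open Finset
open scoped Classical

lemma exp_neg_log (n : ℕ) (hn : 1 ≤ n) : Real.exp (-(Real.log n)) = 1 / (n:ℝ) := by
  rw [Real.exp_neg, Real.exp_log (by positivity), one_div]

/-- Uniform star-forest lemma. -/
theorem star_forest {ι : Type*} [Fintype ι] (s : ℕ) (l : List (Finset ι)) (hl : FL s l) (q c : ℝ) (hq : 0 < q) (hc : 0 < c) :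
    ∃ Λ : ℝ, ∃ n₀ : ℕ, 0 < Λ ∧ ∀ n, n₀ ≤ n → ∀ p, GoodP n s p Λ →
      ∀ (σ : Type) [Fintype σ], (Fintype.card σ : ℝ) ≤ Real.exp (q * n * Real.log n) →
      ∀ A : σ → Finset (ι → Fin n),
        Pr n p (fun H => ¬ ∀ x, c * (n:ℝ) ^ (Fintype.card ι) ≤ (A x).card →
          ∃ a ∈ A x, Function.Injective a ∧ ∀ B ∈ l, Cl H a B) ≤ 1 / n := by
  obtain ⟨Λ, n₁, hΛ, h⟩ := star_forest_aux s l hl (q + 1) (c / 2) (by positivity) (by positivity)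
  set m := Fintype.card ι with hm
  obtain ⟨n₂, hn₂⟩ := exists_nat_gt (2 * (m:ℝ) ^ 2 / c)
  refine ⟨Λ, max (max n₁ n₂) 3, hΛ, fun n hn p hg σ _ hσ A => ?_⟩
  have hn3 : 3 ≤ n := (le_max_right _ _).trans hn
  have hnn1 : n₁ ≤ n := (le_max_left _ _).trans ((le_max_left _ _).trans hn)
  have hnn2 : n₂ ≤ n := (le_max_right _ _).trans ((le_max_left _ _).trans hn)
  have hp := hg.nonneg
  have hp1 := hg.le_one
  have hlog := one_le_log n hn3
  have hn0 : (0:ℝ) < n := by positivity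
  have hn1 : (1:ℝ) ≤ n := by exact_mod_cast (by omega : 1 ≤ n)
  have hb : ∀ x : σ, Pr n p (fun H => c * (n:ℝ) ^ m ≤ (A x).card ∧
      ¬ ∃ a ∈ A x, Function.Injective a ∧ ∀ B ∈ l, Cl H a B) ≤ Real.exp (-((q + 1) * n * Real.log n)) := by
    intro x
    by_cases hx : c * (n:ℝ) ^ m ≤ (A x).card
    · set A' := (A x).filter (fun a => Function.Injective a) with hA'
      have hA'c : c / 2 * (n:ℝ) ^ m ≤ A'.card := by
        have h1 : (A x).card = A'.card + ((A x).filter (fun a => ¬ Function.Injective a)).card :=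
          (Finset.card_filter_add_card_filter_not _).symm
        have h2 := card_noninj_le (by omega) ((A x).filter (fun a => ¬ Function.Injective a))
          (fun f hf => (Finset.mem_filter.1 hf).2)
        rcases Nat.eq_zero_or_pos m with h0 | h0
        · have h3 : ((A x).card : ℝ) ≤ A'.card := by
            rw [← hm, h0] at h2
            simp only [ne_eq, OfNat.ofNat_ne_zero, not_false_eq_true, zero_pow, zero_mul, nonpos_iff_eq_zero] at h2
            rw [h1, h2]; simp
          have : 0 ≤ c * (n:ℝ) ^ m := by positivity
          linarith
        · have h3 : ((A x).card : ℝ) ≤ A'.card + (m:ℝ) ^ 2 * (n:ℝ) ^ (m - 1) := by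
            rw [h1]; push_cast; rw [← hm] at h2
            have : (((A x).filter (fun a => ¬ Function.Injective a)).card : ℝ) ≤ (m:ℝ) ^ 2 * (n:ℝ) ^ (m - 1) := by exact_mod_cast h2
            linarith
          have h5 : (n:ℝ) ^ m = n * (n:ℝ) ^ (m - 1) := by rw [← pow_succ']; congr 1; omega
          have h6 : (m:ℝ) ^ 2 ≤ c / 2 * n := by
            have : 2 * (m:ℝ) ^ 2 / c < n := hn₂.trans_le (by exact_mod_cast hnn2)
            rw [div_lt_iff₀ hc] at this
            linarith
          have h7 : (0:ℝ) < (n:ℝ) ^ (m - 1) := by positivity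
          rw [h5] at hx ⊢
          nlinarith
      refine le_trans (Pr_mono hp hp1 ?_) (h n hnn1 p hg A' hA'c)
      rintro H ⟨_, hH⟩ ⟨a, ha, hcl⟩
      rw [hA', Finset.mem_filter] at ha
      exact hH ⟨a, ha.1, ha.2, hcl⟩
    · refine (Pr_mono hp hp1 (Q := fun _ => False) (fun H h => hx h.1)).trans ?_
      rw [Pr_false]; exact (Real.exp_pos _).le
  have h1 := Pr_exists_le_card hp hp1 _ _ hb
  refine le_trans (Pr_mono hp hp1 ?_) (h1.trans ?_)
  · intro H hH
    push Not at hH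
    obtain ⟨x, hx, hx2⟩ := hH
    refine ⟨x, hx, ?_⟩
    push Not
    exact hx2
  · refine (mul_le_mul_of_nonneg_right hσ (Real.exp_pos _).le).trans ?_
    rw [← Real.exp_add, ← exp_neg_log n (by omega)]
    apply Real.exp_le_exp.2
    nlinarith

lemma card_small_sets (n m : ℕ) :
    (univ.filter (fun W : Finset (Fin n) => W.card ≤ m)).card ≤ (n + 1) ^ m := by
  have hsub : univ.filter (fun W : Finset (Fin n) => W.card ≤ m) ⊆
      univ.image (fun w : Fin m → Option (Fin n) => univ.filter (fun x => some x ∈ univ.image w)) := by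
    intro W hW
    have hW := (Finset.mem_filter.1 hW).2
    rw [Finset.mem_image]
    refine ⟨fun i => if h : (i:ℕ) < W.card then some (W.equivFin.symm ⟨i, h⟩ : Fin n) else none, Finset.mem_univ _, ?_⟩
    ext x
    simp only [Finset.mem_filter, Finset.mem_univ, true_and, Finset.mem_image]
    constructor
    · rintro ⟨i, hi⟩
      split_ifs at hi with h
      simp only [Option.some.injEq] at hi
      rw [← hi]; exact (W.equivFin.symm ⟨i, h⟩).2
    · intro hx
      have hlt := (W.equivFin ⟨x, hx⟩).2
      refine ⟨⟨W.equivFin ⟨x, hx⟩, by omega⟩, ?_⟩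
      rw [dif_pos hlt]
      simp
  refine (Finset.card_le_card hsub).trans (Finset.card_image_le.trans ?_)
  rw [Finset.card_univ, Fintype.card_fun]; simp

/-- Uniform rooted clique lemma. -/
theorem rooted_uniform {κ : Type*} [Fintype κ] (s : ℕ) (hκ1 : 1 ≤ Fintype.card κ) (hκs : Fintype.card κ ≤ s)
    (L : ℕ) (c : ℝ) (hc : 0 < c) :
    ∃ Λ : ℝ, ∃ n₀ : ℕ, 0 < Λ ∧ ∀ n, n₀ ≤ n → ∀ p, GoodP n s p Λ →
      ∀ F : Finset (Fin n) → Finset (Fin n) → Finset (κ → Fin n),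
      (∀ U W, ∀ f ∈ F U W, Function.Injective f) →
        Pr n p (fun H => ¬ ∀ U W : Finset (Fin n), U.Nonempty → W.card ≤ L * U.card →
          c * U.card * (n:ℝ) ^ (Fintype.card κ - 1) ≤ (F U W).card →
          ∃ f ∈ F U W, ∀ a b, a ≠ b → H.Adj (f a) (f b)) ≤ 1 / n := by
  set K : ℝ := 2 * (L + 1) + 2 with hK
  have hs0 : (0:ℝ) < s := by exact_mod_cast (hκ1.trans hκs)
  refine ⟨4 * 2 ^ s * (s:ℝ) ^ s * K / c, 3, by positivity, fun n hn p hg F hF => ?_⟩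
  have hp := hg.nonneg
  have hp1 := hg.le_one
  have hlog := one_le_log n hn
  have hn0 : (0:ℝ) < n := by positivity
  set small : ℕ → Finset (Finset (Fin n)) := fun m => univ.filter (fun W : Finset (Fin n) => W.card ≤ m) with hsm
  have hsplit : ∀ t ∈ Finset.Icc 1 n, Pr n p (fun H => ∃ UW ∈ small t ×ˢ small (L * t), UW.1.card = t ∧
      c * UW.1.card * (n:ℝ) ^ (Fintype.card κ - 1) ≤ (F UW.1 UW.2).card ∧
      ∀ f ∈ F UW.1 UW.2, ¬ ∀ a b, a ≠ b → H.Adj (f a) (f b)) ≤ Real.exp (-(2 * Real.log n)) := by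
    intro t ht
    rw [Finset.mem_Icc] at ht
    refine (Pr_exists_le hp hp1 _ _).trans ?_
    have hterm : ∀ UW ∈ small t ×ˢ small (L * t), Pr n p (fun H => UW.1.card = t ∧
      c * UW.1.card * (n:ℝ) ^ (Fintype.card κ - 1) ≤ (F UW.1 UW.2).card ∧
      ∀ f ∈ F UW.1 UW.2, ¬ ∀ a b, a ≠ b → H.Adj (f a) (f b)) ≤ Real.exp (-(K * t * Real.log n)) := by
      intro UW _
      by_cases h : UW.1.card = t ∧ c * UW.1.card * (n:ℝ) ^ (Fintype.card κ - 1) ≤ (F UW.1 UW.2).card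
      · refine (Pr_mono hp hp1 (fun H h => h.2.2)).trans ?_
        exact rooted_clique s hκ1 hκs n (by omega) p c K _ hc (by positivity) rfl hg t _ (hF _ _)
          (by rw [← h.1]; exact h.2)
      · refine (Pr_mono hp hp1 (Q := fun _ => False) (fun H h' => h ⟨h'.1, h'.2.1⟩)).trans ?_
        rw [Pr_false]; exact (Real.exp_pos _).le
    refine (Finset.sum_le_card_nsmul _ _ _ hterm).trans ?_
    rw [nsmul_eq_mul, Finset.card_product]
    have hc1 : (((small t).card * (small (L * t)).card : ℕ) : ℝ) ≤ (n:ℝ) ^ (2 * (L + 1) * t) := by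
      have h1 := Nat.mul_le_mul (card_small_sets n t) (card_small_sets n (L * t))
      have h2 : (n + 1) ^ t * (n + 1) ^ (L * t) ≤ n ^ (2 * (L + 1) * t) := by
        rw [← pow_add, show 2 * (L + 1) * t = 2 * (t + L * t) by ring, pow_mul n 2]
        exact Nat.pow_le_pow_left (by nlinarith) _
      exact_mod_cast h1.trans h2
    refine (mul_le_mul_of_nonneg_right hc1 (Real.exp_pos _).le).trans ?_
    rw [npow_eq_exp n _ (by omega), ← Real.exp_add]
    apply Real.exp_le_exp.2
    have ht1 : (1:ℝ) ≤ t := by exact_mod_cast ht.1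
    push_cast
    rw [hK]
    nlinarith
  have htot := (Pr_exists_le hp hp1 (Finset.Icc 1 n) _).trans (Finset.sum_le_card_nsmul _ _ _ hsplit)
  refine le_trans (Pr_mono hp hp1 ?_) (htot.trans ?_)
  · intro H hH
    push Not at hH
    obtain ⟨U, W, hU, hW, hFc, hno⟩ := hH
    refine ⟨U.card, ?_, (U, W), ?_, rfl, hFc, ?_⟩
    · rw [Finset.mem_Icc]
      refine ⟨hU.card_pos, ?_⟩
      have := Finset.card_le_univ U
      simpa using this
    · simp [hsm, hW]
    · intro f hf hcl
      obtain ⟨a, b, hab, hnadj⟩ := hno f hf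
      exact hnadj (hcl a b hab)
  · rw [Nat.card_Icc, nsmul_eq_mul]
    have h2 : Real.exp (-(2 * Real.log n)) = 1 / (n:ℝ) * (1 / (n:ℝ)) := by
      rw [← exp_neg_log n (by omega), ← Real.exp_add]; congr 1; ring
    rw [h2]
    simp only [Nat.add_sub_cancel]
    apply le_of_eq; field_simp

/-- The edge probability of the theorem is admissible. -/
theorem goodP_of_large (s : ℕ) (hs : 2 ≤ s) (Λ : ℝ) (hΛ : 0 < Λ) : ∃ C₀ : ℝ, 0 < C₀ ∧ ∀ C, C₀ ≤ C → ∃ n₀ : ℕ, ∀ n : ℕ, n₀ ≤ n →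
    GoodP n s (C * (n : ℝ) ^ (-(2 : ℝ) / (s : ℝ)) *
              (Real.log n) ^ ((2 : ℝ) / ((s : ℝ) * ((s : ℝ) - 1)))) Λ := by
  refine ⟨max 1 Λ, by positivity, fun C hC => ?_⟩
  have hC1 : 1 ≤ C := (le_max_left _ _).trans hC
  have hCΛ : Λ ≤ C := (le_max_right _ _).trans hC
  have hs2 : (2:ℝ) ≤ s := by exact_mod_cast hs
  have hs0 : (0:ℝ) < s := by linarith
  have hlogo : ∀ᶠ n : ℕ in Filter.atTop, Real.log n ≤ (n:ℝ) ^ (1 / (s:ℝ)) := by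
    have h1 := (isLittleO_log_rpow_atTop (r := 1 / (s:ℝ)) (by positivity)).bound (c := 1) one_pos
    have h2 := tendsto_natCast_atTop_atTop (R := ℝ) |>.eventually h1
    filter_upwards [h2, Filter.eventually_ge_atTop 1] with n hn hn1
    rw [one_mul] at hn
    have h3 : ‖(n:ℝ) ^ (1 / (s:ℝ))‖ = (n:ℝ) ^ (1 / (s:ℝ)) := Real.norm_of_nonneg (by positivity)
    rw [← h3]
    exact (le_abs_self _).trans hn
  have hbig : ∀ᶠ n : ℕ in Filter.atTop, C ≤ (n:ℝ) ^ (1 / (s:ℝ)) := by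
    have := (tendsto_rpow_atTop (y := 1 / (s:ℝ)) (by positivity)).comp (tendsto_natCast_atTop_atTop (R := ℝ))
    exact this.eventually_ge_atTop C
  obtain ⟨n₀, hn₀⟩ := Filter.eventually_atTop.1 (hlogo.and (hbig.and (Filter.eventually_ge_atTop 3)))
  refine ⟨n₀, fun n hn => ?_⟩
  obtain ⟨h1, h2, h3⟩ := hn₀ n hn
  have hlog := one_le_log n h3
  have hn1 : (1:ℝ) ≤ n := by exact_mod_cast (by omega : 1 ≤ n)
  have hn0 : (0:ℝ) < n := by linarith
  set e : ℝ := (2 : ℝ) / ((s : ℝ) * ((s : ℝ) - 1)) with he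
  have hss : (2:ℝ) ≤ (s:ℝ) * ((s:ℝ) - 1) := by nlinarith
  have he0 : 0 < e := by rw [he]; apply div_pos <;> linarith
  have he1 : e ≤ 1 := by rw [he, div_le_one (by linarith)]; exact hss
  set lg := Real.log n with hlg
  have hle1 : 1 ≤ lg ^ e := Real.one_le_rpow hlog he0.le
  have hle2 : lg ^ e ≤ lg := by
    calc lg ^ e ≤ lg ^ (1:ℝ) := Real.rpow_le_rpow_of_exponent_le hlog he1
      _ = lg := Real.rpow_one _
  have hnp : 0 < (n:ℝ) ^ (-(2 : ℝ) / (s : ℝ)) := Real.rpow_pos_of_pos hn0 _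
  have hp0 : 0 ≤ C * (n : ℝ) ^ (-(2 : ℝ) / (s : ℝ)) * lg ^ e := by positivity
  refine ⟨hp0, ?_, ?_⟩
  · have hx : 0 < (n:ℝ) ^ (1 / (s:ℝ)) := Real.rpow_pos_of_pos hn0 _
    have h4 : (n:ℝ) ^ (-(2 : ℝ) / (s : ℝ)) * ((n:ℝ) ^ (1 / (s:ℝ)) * (n:ℝ) ^ (1 / (s:ℝ))) = 1 := by
      rw [← Real.rpow_add hn0, ← Real.rpow_add hn0]
      rw [show -(2 : ℝ) / (s : ℝ) + (1 / (s:ℝ) + 1 / (s:ℝ)) = 0 by field_simp; norm_num, Real.rpow_zero]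
    calc C * (n : ℝ) ^ (-(2 : ℝ) / (s : ℝ)) * lg ^ e
        ≤ (n:ℝ) ^ (1 / (s:ℝ)) * (n : ℝ) ^ (-(2 : ℝ) / (s : ℝ)) * (n:ℝ) ^ (1 / (s:ℝ)) := by
          gcongr
          exact hle2.trans h1
      _ = (n:ℝ) ^ (-(2 : ℝ) / (s : ℝ)) * ((n:ℝ) ^ (1 / (s:ℝ)) * (n:ℝ) ^ (1 / (s:ℝ))) := by ring
      _ = 1 := h4
  · intro i hi2 his
    have hch : 1 ≤ i.choose 2 := Nat.choose_pos hi2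
    have hchr : ((i.choose 2 : ℕ) : ℝ) = i * (i - 1) / 2 := by
      rw [Nat.cast_choose_two]
    have hi2' : (2:ℝ) ≤ i := by exact_mod_cast hi2
    have hCp : C ≤ C ^ (i.choose 2) := le_self_pow₀ hC1 (by omega)
    rw [mul_pow, mul_pow]
    have hnpow : (n:ℝ) ^ (i - 1) * ((n : ℝ) ^ (-(2 : ℝ) / (s : ℝ))) ^ (i.choose 2) = (n:ℝ) ^ (((i:ℝ) - 1) * (1 - i / s)) := by
      rw [← Real.rpow_natCast (n:ℝ), ← Real.rpow_mul_natCast hn0.le, ← Real.rpow_add hn0]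
      congr 1
      rw [hchr, Nat.cast_sub (by omega)]
      push_cast
      field_simp
      ring
    have hlpow : (lg ^ e) ^ (i.choose 2) = lg ^ (e * (i * (i - 1) / 2)) := by
      rw [← Real.rpow_mul_natCast (by linarith), hchr]
    rw [show (n:ℝ) ^ (i - 1) * (C ^ i.choose 2 * ((n : ℝ) ^ (-(2 : ℝ) / (s : ℝ))) ^ (i.choose 2) * (lg ^ e) ^ (i.choose 2))
      = C ^ i.choose 2 * (((n:ℝ) ^ (i - 1) * ((n : ℝ) ^ (-(2 : ℝ) / (s : ℝ))) ^ (i.choose 2)) * (lg ^ e) ^ (i.choose 2)) by ring, hnpow]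
    have hmain : lg ≤ (n:ℝ) ^ (((i:ℝ) - 1) * (1 - i / s)) * (lg ^ e) ^ (i.choose 2) := by
      rcases his.lt_or_eq with hlt | heq
      · have h5 : 1 ≤ (lg ^ e) ^ (i.choose 2) := one_le_pow₀ hle1
        have h6 : (n:ℝ) ^ (1 / (s:ℝ)) ≤ (n:ℝ) ^ (((i:ℝ) - 1) * (1 - i / s)) := by
          apply Real.rpow_le_rpow_of_exponent_le hn1
          have : (i:ℝ) + 1 ≤ s := by exact_mod_cast hlt
          rw [show ((i:ℝ) - 1) * (1 - i / s) = (((i:ℝ) - 1) * (s - i)) / s by field_simp]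
          apply div_le_div_of_nonneg_right _ hs0.le
          nlinarith
        have h7 : 0 ≤ (n:ℝ) ^ (1 / (s:ℝ)) := by positivity
        calc lg ≤ (n:ℝ) ^ (1 / (s:ℝ)) * 1 := by rw [mul_one]; exact h1
          _ ≤ _ := by gcongr
      · subst heq
        rw [div_self hs0.ne', sub_self, mul_zero, Real.rpow_zero, one_mul, hlpow]
        have : e * ((i:ℝ) * (i - 1) / 2) = 1 := by
          have h9 : (i:ℝ) - 1 ≠ 0 := by intro h; linarith
          rw [he]; field_simp
        rw [this, Real.rpow_one]
    calc Λ * lg ≤ C ^ i.choose 2 * lg := by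
          apply mul_le_mul_of_nonneg_right _ (by linarith)
          linarith
      _ ≤ _ := mul_le_mul_of_nonneg_left hmain (by positivity)

open Finset
open scoped Classical

/-- Blow-up of one coordinate of a dense relation. -/
lemma blow1 {α β τ : Type*} [Fintype α] [Fintype β] [Fintype τ] (P : α → β → Prop) (c : ℝ) (hc : 0 ≤ c)
    (Y : Finset (α × β)) (hY : ∀ x ∈ Y, P x.1 x.2)
    (h : c * Fintype.card α * Fintype.card β ≤ (Y.card : ℝ))
    (Z : Finset ((τ → α) × β)) (hZ : ∀ f b, (∀ i, P (f i) b) → (f, b) ∈ Z) :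
    c ^ (Fintype.card τ) * (Fintype.card α : ℝ) ^ (Fintype.card τ) * Fintype.card β ≤ (Z.card : ℝ) := by
  set d : β → Finset α := fun b => univ.filter (fun a => P a b) with hd
  have hYd : (Y.card : ℝ) ≤ ∑ b, ((d b).card : ℝ) := by
    have : Y.card ≤ (univ.sigma (fun b => d b) : Finset (Σ _ : β, α)).card := by
      apply Finset.card_le_card_of_injOn (fun x => ⟨x.2, x.1⟩)
      · intro x hx
        simp [hd, hY x hx]
      · rintro ⟨a, b⟩ _ ⟨a', b'⟩ _ h
        simp at h
        simp [h]
    rw [Finset.card_sigma] at this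
    exact_mod_cast this
  have hZd : ∑ b, ((d b).card : ℝ) ^ (Fintype.card τ) ≤ (Z.card : ℝ) := by
    have : (univ.sigma (fun b => Fintype.piFinset (fun _ : τ => d b)) : Finset (Σ _ : β, τ → α)).card ≤ Z.card := by
      apply Finset.card_le_card_of_injOn (fun x => (x.2, x.1))
      · rintro ⟨b, f⟩ hx
        simp [hd] at hx
        exact hZ f b hx
      · rintro ⟨a, b⟩ _ ⟨a', b'⟩ _ h
        simp at h
        simp [h]
    rw [Finset.card_sigma] at this
    have h2 : ∀ b, (Fintype.piFinset (fun _ : τ => d b)).card = (d b).card ^ (Fintype.card τ) := by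
      intro b
      rw [Fintype.card_piFinset]; simp
    simp only [h2] at this
    exact_mod_cast this
  refine le_trans ?_ hZd
  rcases Nat.eq_zero_or_pos (Fintype.card τ) with h0 | h0
  · simp [h0]
  obtain ⟨t, ht⟩ : ∃ t, Fintype.card τ = t + 1 := ⟨_, (Nat.succ_pred_eq_of_pos h0).symm⟩
  rw [ht]
  rcases Nat.eq_zero_or_pos (Fintype.card β) with hb | hb
  · have : IsEmpty β := Fintype.card_eq_zero_iff.1 hb
    simp
  have hJ := pow_sum_div_card_le_sum_pow (s := (univ : Finset β)) (f := fun b => ((d b).card : ℝ)) (fun _ _ => by positivity) t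
  refine le_trans ?_ hJ
  rw [Finset.card_univ, le_div_iff₀ (by positivity)]
  calc c ^ (t + 1) * (Fintype.card α : ℝ) ^ (t + 1) * Fintype.card β * (Fintype.card β : ℝ) ^ t
      = (c * Fintype.card α * Fintype.card β) ^ (t + 1) := by ring
    _ ≤ _ := by
      apply pow_le_pow_left₀ (by positivity)
      exact h.trans hYd

lemma blow2 {n : ℕ} {τ₁ τ₂ : Type*} [Fintype τ₁] [Fintype τ₂] (P : Fin n → Fin n → Prop) (c : ℝ) (hc : 0 ≤ c)
    (Y : Finset (Fin n × Fin n)) (hY : ∀ x ∈ Y, P x.1 x.2) (h : c * (n:ℝ) ^ 2 ≤ (Y.card : ℝ))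
    (Z : Finset (τ₁ ⊕ τ₂ → Fin n))
    (hZ : ∀ f : τ₁ ⊕ τ₂ → Fin n, (∀ i j, P (f (Sum.inl i)) (f (Sum.inr j))) → f ∈ Z) :
    c ^ (Fintype.card τ₁ * Fintype.card τ₂) * (n:ℝ) ^ (Fintype.card (τ₁ ⊕ τ₂)) ≤ (Z.card : ℝ) := by
  have h1 := blow1 (τ := τ₁) P c hc Y hY (by simp only [Fintype.card_fin]; nlinarith)
    (univ.filter (fun x => ∀ i, P (x.1 i) x.2)) (by intro f b hh; simpa using hh)
  have h2 := blow1 (τ := τ₂) (fun (b : Fin n) (f : τ₁ → Fin n) => ∀ i, P (f i) b) (c ^ Fintype.card τ₁) (by positivity)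
    ((univ.filter (fun x : (τ₁ → Fin n) × Fin n => ∀ i, P (x.1 i) x.2)).image Prod.swap) (by
      intro x hx
      simp only [mem_image, mem_filter, mem_univ, true_and] at hx
      obtain ⟨y, hy, rfl⟩ := hx
      exact hy) (by
      rw [Finset.card_image_of_injective _ Prod.swap_injective]
      refine le_trans (le_of_eq ?_) h1
      simp only [Fintype.card_fun, Fintype.card_fin]
      push_cast; ring)
    (Z.image (fun f => (fun j => f (Sum.inr j), fun i => f (Sum.inl i)))) (by
      intro f b hh
      simp only [mem_image]
      exact ⟨Sum.elim b f, hZ _ (fun i j => hh j i), rfl⟩)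
  refine le_trans (le_of_eq ?_) (h2.trans (by exact_mod_cast Finset.card_image_le))
  simp only [Fintype.card_fun, Fintype.card_fin, Fintype.card_sum]
  push_cast
  ring

lemma blow3 {n : ℕ} {τ₁ τ₂ τ₃ : Type*} [Fintype τ₁] [Fintype τ₂] [Fintype τ₃]
    (P : Fin n → Fin n → Fin n → Prop) (c : ℝ) (hc : 0 ≤ c)
    (Y : Finset (Fin n × Fin n × Fin n)) (hY : ∀ x ∈ Y, P x.1 x.2.1 x.2.2) (h : c * (n:ℝ) ^ 3 ≤ (Y.card : ℝ))
    (Z : Finset (τ₁ ⊕ τ₂ ⊕ τ₃ → Fin n))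
    (hZ : ∀ f : τ₁ ⊕ τ₂ ⊕ τ₃ → Fin n,
      (∀ i j l, P (f (Sum.inl i)) (f (Sum.inr (Sum.inl j))) (f (Sum.inr (Sum.inr l)))) → f ∈ Z) :
    c ^ (Fintype.card τ₁ * Fintype.card τ₂ * Fintype.card τ₃) * (n:ℝ) ^ (Fintype.card (τ₁ ⊕ τ₂ ⊕ τ₃)) ≤ (Z.card : ℝ) := by
  have h1 := blow1 (τ := τ₁) (fun a (b : Fin n × Fin n) => P a b.1 b.2) c hc Y hY
    (by simp only [Fintype.card_fin, Fintype.card_prod]; push_cast; nlinarith)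
    (univ.filter (fun x => ∀ i, P (x.1 i) x.2.1 x.2.2)) (by intro f b hh; simpa using hh)
  have h2 := blow1 (τ := τ₂) (fun (b : Fin n) (f : (τ₁ → Fin n) × Fin n) => ∀ i, P (f.1 i) b f.2) (c ^ Fintype.card τ₁) (by positivity)
    ((univ.filter (fun x : (τ₁ → Fin n) × (Fin n × Fin n) => ∀ i, P (x.1 i) x.2.1 x.2.2)).image
      (fun x => (x.2.1, (x.1, x.2.2)))) (by
      intro x hx
      simp only [mem_image, mem_filter, mem_univ, true_and] at hx
      obtain ⟨y, hy, rfl⟩ := hx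
      exact hy) (by
      rw [Finset.card_image_of_injective]
      · refine le_trans (le_of_eq ?_) h1
        simp only [Fintype.card_fun, Fintype.card_fin, Fintype.card_prod]
        push_cast; ring
      · rintro ⟨a, b, d⟩ ⟨a', b', d'⟩ hh
        simp at hh ⊢; tauto)
    (univ.filter (fun x => ∀ j i, P (x.2.1 i) (x.1 j) x.2.2)) (by intro f b hh; simpa using hh)
  have h3 := blow1 (τ := τ₃) (fun (b : Fin n) (f : (τ₂ → Fin n) × (τ₁ → Fin n)) => ∀ j i, P (f.2 i) (f.1 j) b)
    ((c ^ Fintype.card τ₁) ^ Fintype.card τ₂) (by positivity)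
    ((univ.filter (fun x : (τ₂ → Fin n) × ((τ₁ → Fin n) × Fin n) => ∀ j i, P (x.2.1 i) (x.1 j) x.2.2)).image
      (fun x => (x.2.2, (x.1, x.2.1)))) (by
      intro x hx
      simp only [mem_image, mem_filter, mem_univ, true_and] at hx
      obtain ⟨y, hy, rfl⟩ := hx
      exact hy) (by
      rw [Finset.card_image_of_injective]
      · refine le_trans (le_of_eq ?_) h2
        simp only [Fintype.card_fun, Fintype.card_fin, Fintype.card_prod]
        push_cast; ring
      · rintro ⟨a, b, d⟩ ⟨a', b', d'⟩ hh
        simp at hh ⊢; tauto)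
    (Z.image (fun f => (fun j => f (Sum.inr (Sum.inr j)), (fun j => f (Sum.inr (Sum.inl j)), fun i => f (Sum.inl i))))) (by
      intro f b hh
      simp only [mem_image]
      exact ⟨Sum.elim b.2 (Sum.elim b.1 f), hZ _ (fun i j l => hh l j i), rfl⟩)
  refine le_trans (le_of_eq ?_) (h3.trans (by exact_mod_cast Finset.card_image_le))
  simp only [Fintype.card_fun, Fintype.card_fin, Fintype.card_sum, Fintype.card_prod]
  push_cast
  ring

/-- Averaging: few pairs outside the rich rows. -/
lemma rich_rows {α β : Type*} [Fintype α] [Fintype β] (Y : Finset (α × β)) (c : ℝ)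
    (h : 2 * c * Fintype.card α * Fintype.card β ≤ (Y.card : ℝ)) (hc : 0 ≤ c) (hb : 0 < Fintype.card β)
    (Z : Finset α) (hZ : ∀ a, c * Fintype.card β ≤ ((univ.filter (fun b => (a, b) ∈ Y)).card : ℝ) → a ∈ Z) :
    c * Fintype.card α ≤ (Z.card : ℝ) := by
  have h1 : (Y.card : ℝ) = ∑ a, ((univ.filter (fun b => (a, b) ∈ Y)).card : ℝ) := by
    have : Y.card = ∑ a, (univ.filter (fun b => (a, b) ∈ Y)).card := by
      rw [← Finset.card_sigma]
      apply Finset.card_bij' (fun x _ => ⟨x.1, x.2⟩) (fun x _ => (x.1, x.2)) <;> simp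
    exact_mod_cast this
  have h2 : ∀ a, ((univ.filter (fun b => (a, b) ∈ Y)).card : ℝ) ≤ c * Fintype.card β + if a ∈ Z then (Fintype.card β : ℝ) else 0 := by
    intro a
    by_cases ha : a ∈ Z
    · rw [if_pos ha]
      have : ((univ.filter (fun b => (a, b) ∈ Y)).card : ℝ) ≤ Fintype.card β := by
        exact_mod_cast Finset.card_le_univ _
      have : 0 ≤ c * Fintype.card β := by positivity
      linarith
    · rw [if_neg ha, add_zero]
      by_contra hh
      exact ha (hZ a (le_of_lt (not_le.1 hh)))
  have h3 := Finset.sum_le_sum (fun a (_ : a ∈ univ) => h2 a)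
  rw [← h1, Finset.sum_add_distrib, Finset.sum_const, ← Finset.sum_filter, Finset.sum_const] at h3
  simp only [Finset.card_univ, nsmul_eq_mul, Finset.filter_mem_eq_inter, Finset.univ_inter] at h3
  have hb' : (0:ℝ) < Fintype.card β := by exact_mod_cast hb
  have : (c * Fintype.card α) * Fintype.card β ≤ Z.card * Fintype.card β := by nlinarith
  exact le_of_mul_le_mul_right this hb'

open Finset
open scoped Classical

section Haxell
variable {α V : Type*}

/-- Alternating-structure state for the Haxell argument. -/
structure HxValid (E : α → Finset V → Prop) (A1 : Finset α) (a0 : α) (M : α → Finset V) (ℓ : ℕ)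
    (a : ℕ → α) (S : ℕ → Finset V) : Prop where
  hM : ∀ x ∈ A1, E x (M x)
  hdis : ∀ x ∈ A1, ∀ y ∈ A1, x ≠ y → Disjoint (M x) (M y)
  hE : ∀ i < ℓ, E (a i) (S i)
  hne : ∀ i < ℓ, ∃ x ∈ A1, ¬ Disjoint (M x) (S i)
  hroot : ∀ i < ℓ, a i = a0 ∨ ∃ j < i, a i ∈ A1 ∧ ¬ Disjoint (M (a i)) (S j)
  hSS : ∀ i < ℓ, ∀ j < i, Disjoint (S i) (S j)
  hSM : ∀ i < ℓ, ∀ j < i, ∀ x ∈ A1, ¬ Disjoint (M x) (S j) → Disjoint (S i) (M x)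

theorem haxell (E : α → Finset V → Prop) (m : ℕ) (hm : ∀ a S, E a S → S.card ≤ m) (A0 : Finset α)
    (h : ∀ A' ⊆ A0, A'.Nonempty → ∀ W : Finset V, W.card ≤ 2 * m * A'.card → ∃ a ∈ A', ∃ S, E a S ∧ Disjoint S W) :
    ∃ f : α → Finset V, (∀ a ∈ A0, E a (f a)) ∧ ∀ a ∈ A0, ∀ b ∈ A0, a ≠ b → Disjoint (f a) (f b) := by
  induction A0 using Finset.induction_on with
  | empty => exact ⟨fun _ => ∅, by simp, by simp⟩
  | insert a0 A1 ha0 ih =>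
    obtain ⟨f, hf1, hf2⟩ := ih (fun A' hA' => h A' (hA'.trans (Finset.subset_insert _ _)))
    by_contra hno
    set F : (α → Finset V) → (ℕ → Finset V) → ℕ → Finset α := fun M S i => A1.filter (fun x => ¬ Disjoint (M x) (S i)) with hF
    set sig : ((α → Finset V) × ℕ × (ℕ → α) × (ℕ → Finset V)) → Lex (Fin (A1.card + 1) → ℕ) := fun st =>
      toLex (fun i => if i.val < st.2.1 then (F st.1 st.2.2.2 i).card else A1.card + 1) with hsig
    have hwf : WellFounded (fun x y => sig x < sig y) := InvImage.wf sig wellFounded_lt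
    obtain ⟨⟨M, ℓ, a, S⟩, hval, hmin⟩ := hwf.has_min
      {st | HxValid E A1 a0 st.1 st.2.1 st.2.2.1 st.2.2.2}
      ⟨(f, 0, fun _ => a0, fun _ => ∅), ⟨hf1, hf2, by simp, by simp, by simp, by simp, by simp⟩⟩
    simp only [Set.mem_setOf_eq] at hval hmin
    -- the sets F are pairwise disjoint
    have hFd : ∀ i < ℓ, ∀ j < i, Disjoint (F M S i) (F M S j) := by
      intro i hi j hj
      rw [Finset.disjoint_left]
      intro x hx hx'
      simp only [hF, mem_filter] at hx hx'
      exact hx.2 (hval.hSM i hi j hj x hx'.1 hx'.2).symm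
    have hFsum : ∀ i ≤ ℓ, i ≤ ((range i).biUnion (F M S)).card ∧ ((range i).biUnion (F M S)).card = ∑ j ∈ range i, (F M S j).card := by
      intro i hi
      have hc : ((range i).biUnion (F M S)).card = ∑ j ∈ range i, (F M S j).card := by
        apply Finset.card_biUnion
        intro x hx y hy hxy
        show Disjoint _ _
        simp only [Finset.mem_coe, mem_range] at hx hy
        rcases lt_or_gt_of_ne hxy with h1 | h1
        · exact (hFd y (by omega) x h1).symm
        · exact hFd x (by omega) y h1
      refine ⟨?_, hc⟩
      rw [hc]
      calc i = ∑ j ∈ range i, 1 := by simp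
        _ ≤ _ := by
          apply Finset.sum_le_sum
          intro j hj
          obtain ⟨x, hx, hx2⟩ := hval.hne j (by simp at hj; omega)
          exact Finset.card_pos.2 ⟨x, by simp [hF, hx, hx2]⟩
    have hℓ : ℓ ≤ A1.card := by
      refine (hFsum ℓ le_rfl).1.trans (Finset.card_le_card ?_)
      intro x hx
      simp only [mem_biUnion, hF, mem_filter] at hx
      obtain ⟨_, _, h1, _⟩ := hx
      exact h1
    have hFle : ∀ M S i, (F M S i).card ≤ A1.card := fun M S i => Finset.card_filter_le _ _
    -- a free edge gives a contradiction
    have hfree : ∀ j ≤ ℓ, ∀ M', HxValid E A1 a0 M' j a S → (∀ i < j, F M' S i = F M S i) →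
        ∀ x T, E x T → (x = a0 ∨ ∃ i < j, x ∈ F M' S i) → (∀ y ∈ A1, Disjoint T (M' y)) →
        (∀ i < j, Disjoint T (S i)) → False := by
      intro j
      induction j using Nat.strong_induction_on with
      | _ j ihj =>
      intro hj M' hv hFF x T hE hx hTM hTS
      rcases hx with rfl | ⟨i, hij, hxi⟩
      · apply hno
        refine ⟨Function.update M' x T, ?_, ?_⟩
        · intro b hb
          rcases Finset.mem_insert.1 hb with rfl | hb
          · simpa using hE
          · have : b ≠ x := fun hh => ha0 (hh ▸ hb)
            simpa [Function.update_of_ne this] using hv.hM b hb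
        · intro b hb d hd hbd
          rcases Finset.mem_insert.1 hb with rfl | hb
          · rcases Finset.mem_insert.1 hd with rfl | hd
            · exact absurd rfl hbd
            · rw [Function.update_self, Function.update_of_ne (Ne.symm hbd)]
              exact hTM d hd
          · have hbx : b ≠ x := fun hh => ha0 (hh ▸ hb)
            have hTb := hTM b hb
            rcases Finset.mem_insert.1 hd with rfl | hd
            · rw [Function.update_self, Function.update_of_ne hbx]
              exact hTb.symm
            · have hdx : d ≠ x := fun hh => ha0 (hh ▸ hd)
              rw [Function.update_of_ne hbx, Function.update_of_ne hdx]
              exact hv.hdis b hb d hd hbd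
      · -- switch
        have hxA : x ∈ A1 := (Finset.mem_filter.1 hxi).1
        have hxn : ¬ Disjoint (M' x) (S i) := (Finset.mem_filter.1 hxi).2
        set M'' := Function.update M' x T with hM''
        have hxl : ∀ l < i, Disjoint (M' x) (S l) := by
          intro l hl
          by_contra hcon
          exact hxn (hv.hSM i hij l hl x hxA hcon).symm
        have hF'' : ∀ l ≤ i, ∀ y ∈ A1, (¬ Disjoint (M'' y) (S l)) ↔ (¬ Disjoint (M' y) (S l) ∧ y ≠ x) := by
          intro l hl y hy
          by_cases hyx : y = x
          · subst hyx
            simp only [hM'', Function.update_self, ne_eq, not_true_eq_false, and_false, iff_false, not_not]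
            exact hTS l (by omega)
          · simp [hM'', Function.update_of_ne hyx, hyx]
        have hF''l : ∀ l < i, ∀ y ∈ A1, (¬ Disjoint (M'' y) (S l)) ↔ (¬ Disjoint (M' y) (S l)) := by
          intro l hl y hy
          rw [hF'' l hl.le y hy]
          constructor
          · exact fun h => h.1
          · intro h
            refine ⟨h, ?_⟩
            rintro rfl
            exact h (hxl l hl)
        have hM1 : ∀ y ∈ A1, E y (M'' y) := by
          intro y hy
          by_cases hyx : y = x
          · subst hyx; simpa [hM''] using hE
          · simpa [hM'', Function.update_of_ne hyx] using hv.hM y hy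
        have hM2 : ∀ y ∈ A1, ∀ z ∈ A1, y ≠ z → Disjoint (M'' y) (M'' z) := by
          intro y hy z hz hyz
          by_cases hyx : y = x
          · subst hyx
            rw [hM'', Function.update_self, Function.update_of_ne (Ne.symm hyz)]
            exact hTM z hz
          · by_cases hzx : z = x
            · subst hzx
              rw [hM'', Function.update_self, Function.update_of_ne hyz]
              exact (hTM y hy).symm
            · rw [hM'', Function.update_of_ne hzx, Function.update_of_ne hyx]
              exact hv.hdis y hy z hz hyz
        have hroot'' : ∀ l ≤ i, a l = a0 ∨ ∃ j' < l, a l ∈ A1 ∧ ¬ Disjoint (M'' (a l)) (S j') := by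
          intro l hl
          rcases hv.hroot l (by omega) with h1 | ⟨j', hj', h1, h2⟩
          · exact Or.inl h1
          · exact Or.inr ⟨j', hj', h1, (hF''l j' (by omega) _ h1).2 h2⟩
        have hSM'' : ∀ l ≤ i, ∀ j' < l, ∀ y ∈ A1, ¬ Disjoint (M'' y) (S j') → Disjoint (S l) (M'' y) := by
          intro l hl j' hj' y hy hd
          have h1 := (hF'' j' (by omega) y hy).1 hd
          rw [hM'', Function.update_of_ne h1.2]
          exact hv.hSM l (by omega) j' hj' y hy h1.1
        have hFeq : ∀ l < i, F M'' S l = F M S l := by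
          intro l hl
          rw [← hFF l (by omega)]
          apply Finset.filter_congr
          intro y hy
          exact hF''l l hl y hy
        have hpre : HxValid E A1 a0 M'' i a S := by
          refine ⟨hM1, hM2, fun l hl => hv.hE l (by omega), ?_, fun l hl => hroot'' l hl.le,
            fun l hl => hv.hSS l (by omega), fun l hl => hSM'' l hl.le⟩
          intro l hl
          obtain ⟨y, hy, h1⟩ := hv.hne l (by omega)
          exact ⟨y, hy, (hF''l l hl y hy).2 h1⟩
        by_cases hemp : ∃ y ∈ A1, ¬ Disjoint (M'' y) (S i)
        · -- smaller state
          apply hmin (M'', i + 1, a, S)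
          · change HxValid E A1 a0 M'' (i + 1) a S
            refine ⟨hM1, hM2, fun l hl => hv.hE l (by omega), ?_, fun l hl => hroot'' l (by omega),
              fun l hl => hv.hSS l (by omega), fun l hl => hSM'' l (by omega)⟩
            intro l hl
            rcases Nat.lt_succ_iff_lt_or_eq.1 hl with hl | rfl
            · exact hpre.hne l hl
            · exact hemp
          · rw [hsig]
            refine ⟨⟨i, by omega⟩, ?_, ?_⟩
            · intro l hl
              have hl' : l.val < i := hl
              simp only [Pi.toLex_apply]
              rw [if_pos (show l.val < i + 1 by omega), if_pos (show l.val < ℓ by omega), hFeq l hl']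
            · simp only [Pi.toLex_apply]
              rw [if_pos (Nat.lt_succ_self i), if_pos (show i < ℓ by omega), ← hFF i hij]
              apply Finset.card_lt_card
              rw [Finset.ssubset_iff_of_subset]
              · exact ⟨x, hxi, by simp [hF, hM'', hTS i hij]⟩
              · intro y hy
                simp only [hF, mem_filter] at hy ⊢
                exact ⟨hy.1, ((hF'' i le_rfl y hy.1).1 hy.2).1⟩
        · push Not at hemp
          refine ihj i hij (by omega) M'' hpre hFeq (a i) (S i) (hv.hE i hij) ?_ (fun y hy => (hemp y hy).symm)
            (fun l hl => hv.hSS i hij l hl)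
          rcases hroot'' i le_rfl with h1 | ⟨j', hj', h1, h2⟩
          · exact Or.inl h1
          · exact Or.inr ⟨j', hj', by simp [hF, h1, h2]⟩
    -- extend
    set A' := insert a0 ((range ℓ).biUnion (F M S)) with hA'
    set W := ((range ℓ).biUnion S) ∪ ((range ℓ).biUnion (F M S)).biUnion M with hW
    have hsubA : (range ℓ).biUnion (F M S) ⊆ A1 := by
      intro x hx
      simp only [mem_biUnion, hF, mem_filter] at hx
      obtain ⟨_, _, h1, _⟩ := hx
      exact h1
    have hWc : W.card ≤ 2 * m * A'.card := by
      have h1 : ((range ℓ).biUnion S).card ≤ ℓ * m := by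
        calc _ ≤ ∑ i ∈ range ℓ, (S i).card := Finset.card_biUnion_le
          _ ≤ ∑ i ∈ range ℓ, m := Finset.sum_le_sum (fun i hi => hm _ _ (hval.hE i (by simpa using hi)))
          _ = ℓ * m := by simp
      have h2 : (((range ℓ).biUnion (F M S)).biUnion M).card ≤ ((range ℓ).biUnion (F M S)).card * m := by
        calc _ ≤ ∑ i ∈ ((range ℓ).biUnion (F M S)), (M i).card := Finset.card_biUnion_le
          _ ≤ ∑ i ∈ ((range ℓ).biUnion (F M S)), m := Finset.sum_le_sum (fun i hi => hm _ _ (hval.hM i (hsubA hi)))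
          _ = _ := by simp
      have h3 : ((range ℓ).biUnion (F M S)).card ≤ A'.card := Finset.card_le_card (Finset.subset_insert _ _)
      have h4 := (hFsum ℓ le_rfl).1
      calc W.card ≤ _ := Finset.card_union_le _ _
        _ ≤ ℓ * m + ((range ℓ).biUnion (F M S)).card * m := add_le_add h1 h2
        _ ≤ A'.card * m + A'.card * m := by gcongr; omega
        _ = 2 * m * A'.card := by ring
    obtain ⟨x, hx, T, hET, hTW⟩ := h A' (Finset.insert_subset_insert _ hsubA) ⟨a0, by simp [hA']⟩ W hWc
    have hTS : ∀ i < ℓ, Disjoint T (S i) := fun i hi => Finset.disjoint_of_subset_right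
      (fun y hy => Finset.mem_union_left _ (Finset.mem_biUnion.2 ⟨i, by simpa using hi, hy⟩)) hTW
    have hTM : ∀ i < ℓ, ∀ y ∈ F M S i, Disjoint T (M y) := fun i hi y hy => Finset.disjoint_of_subset_right
      (fun z hz => Finset.mem_union_right _ (Finset.mem_biUnion.2 ⟨y, Finset.mem_biUnion.2 ⟨i, by simpa using hi, hy⟩, hz⟩)) hTW
    have hx' : x = a0 ∨ ∃ i < ℓ, x ∈ F M S i := by
      rcases Finset.mem_insert.1 hx with h1 | h1
      · exact Or.inl h1
      · obtain ⟨i, hi, h2⟩ := Finset.mem_biUnion.1 h1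
        exact Or.inr ⟨i, by simpa using hi, h2⟩
    by_cases hT : ∀ y ∈ A1, Disjoint T (M y)
    · exact hfree ℓ le_rfl M hval (fun _ _ => rfl) x T hET hx' hT hTS
    · push Not at hT
      obtain ⟨y, hy, hTy⟩ := hT
      set a' := Function.update a ℓ x
      set S' := Function.update S ℓ T
      have ha' : ∀ i < ℓ, a' i = a i := fun i hi => Function.update_of_ne (by omega) _ _
      have hS' : ∀ i < ℓ, S' i = S i := fun i hi => Function.update_of_ne (by omega) _ _
      have haℓ : a' ℓ = x := Function.update_self _ _ _
      have hSℓ : S' ℓ = T := Function.update_self _ _ _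
      apply hmin (M, ℓ + 1, a', S')
      · change HxValid E A1 a0 M (ℓ + 1) a' S'
        refine ⟨hval.hM, hval.hdis, ?_, ?_, ?_, ?_, ?_⟩
        · intro i hi
          rcases Nat.lt_succ_iff_lt_or_eq.1 hi with hi | rfl
          · simp only [ha' i hi, hS' i hi]; exact hval.hE i hi
          · simp only [haℓ, hSℓ]; exact hET
        · intro i hi
          rcases Nat.lt_succ_iff_lt_or_eq.1 hi with hi | rfl
          · simp only [hS' i hi]; exact hval.hne i hi
          · simp only [hSℓ]; exact ⟨y, hy, fun h => hTy h.symm⟩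
        · intro i hi
          rcases Nat.lt_succ_iff_lt_or_eq.1 hi with hi | rfl
          · simp only [ha' i hi]
            rcases hval.hroot i hi with h1 | ⟨j, hj, h1⟩
            · exact Or.inl h1
            · exact Or.inr ⟨j, hj, by simp only [hS' j (by omega)]; exact h1⟩
          · simp only [haℓ]
            rcases hx' with h1 | ⟨j, hj, h1⟩
            · exact Or.inl h1
            · exact Or.inr ⟨j, hj, by simp only [hS' j hj]; exact Finset.mem_filter.1 h1⟩
        · intro i hi j hj
          simp only [hS' j (show j < ℓ by omega)]
          rcases Nat.lt_succ_iff_lt_or_eq.1 hi with hi | rfl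
          · simp only [hS' i hi]; exact hval.hSS i hi j hj
          · simp only [hSℓ]; exact hTS j hj
        · intro i hi j hj z hz hd
          simp only [hS' j (show j < ℓ by omega)] at hd
          rcases Nat.lt_succ_iff_lt_or_eq.1 hi with hi | rfl
          · simp only [hS' i hi]; exact hval.hSM i hi j hj z hz hd
          · simp only [hSℓ]; exact hTM j hj z (Finset.mem_filter.2 ⟨hz, hd⟩)
      · rw [hsig]
        refine ⟨⟨ℓ, by omega⟩, ?_, ?_⟩
        · intro l hl
          have hl' : l.val < ℓ := hl
          simp only [Pi.toLex_apply]
          rw [if_pos (show l.val < ℓ + 1 by omega), if_pos hl']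
          simp only [hF, hS' l.val hl']
        · simp only [Pi.toLex_apply]
          rw [if_pos (Nat.lt_succ_self ℓ), if_neg (lt_irrefl ℓ)]
          exact Nat.lt_succ_of_le (hFle _ _ _)

end Haxell

open Finset
open scoped Classical

/-- Removing non-injective tuples and tuples meeting a small set. -/
lemma clean {κ : Type*} [Fintype κ] {n : ℕ} (c : ℝ) (hc : 0 < c)
    (hn : 4 * ((Fintype.card κ : ℝ) + 1) ^ 2 / c + 1 ≤ n)
    (A : Finset (κ → Fin n)) (hA : c * (n:ℝ) ^ Fintype.card κ ≤ A.card) (X : Finset (Fin n))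
    (hX : (X.card : ℝ) ≤ c / (4 * ((Fintype.card κ : ℝ) + 1)) * n)
    (Z : Finset (κ → Fin n)) (hZ : ∀ f ∈ A, Function.Injective f → (∀ x, f x ∉ X) → f ∈ Z) :
    c / 2 * (n:ℝ) ^ Fintype.card κ ≤ Z.card := by
  set m := Fintype.card κ with hm
  have h0 : 0 ≤ 4 * ((m : ℝ) + 1) ^ 2 / c := by positivity
  have hn1 : 1 ≤ n := by
    have : (1:ℝ) ≤ n := by linarith
    exact_mod_cast this
  have hsub : A ⊆ Z ∪ (A.filter (fun f => ¬ Function.Injective f) ∪ univ.biUnion (fun x => A.filter (fun f => f x ∈ X))) := by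
    intro f hf
    by_cases h1 : Function.Injective f
    · by_cases h2 : ∀ x, f x ∉ X
      · exact mem_union_left _ (hZ f hf h1 h2)
      · push Not at h2
        obtain ⟨x, hx⟩ := h2
        exact mem_union_right _ (mem_union_right _ (mem_biUnion.2 ⟨x, mem_univ _, mem_filter.2 ⟨hf, hx⟩⟩))
    · exact mem_union_right _ (mem_union_left _ (mem_filter.2 ⟨hf, h1⟩))
  have h1 : A.card ≤ Z.card + (m ^ 2 * n ^ (m - 1) + m * (X.card * n ^ (m - 1))) := by
    refine (card_le_card hsub).trans ((card_union_le _ _).trans (Nat.add_le_add_left ((card_union_le _ _).trans (Nat.add_le_add ?_ ?_)) _))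
    · exact card_noninj_le hn1 _ (fun f hf => (mem_filter.1 hf).2)
    · calc _ ≤ ∑ x : κ, (A.filter (fun f => f x ∈ X)).card := card_biUnion_le
        _ ≤ ∑ x : κ, X.card * n ^ (m - 1) := Finset.sum_le_sum (fun x _ => card_root_le x X _ (fun f hf => (mem_filter.1 hf).2))
        _ = _ := by simp [hm]
  have h1' : (A.card : ℝ) ≤ Z.card + ((m:ℝ) ^ 2 * (n:ℝ) ^ (m - 1) + m * (X.card * (n:ℝ) ^ (m - 1))) := by exact_mod_cast h1
  rcases Nat.eq_zero_or_pos m with h | h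
  · rw [h] at h1' hA ⊢
    simp at h1' hA ⊢
    have : (A.card : ℝ) ≤ Z.card := by exact_mod_cast h1'
    linarith
  · have hp : (n:ℝ) ^ m = n * (n:ℝ) ^ (m - 1) := by
      rw [← pow_succ', Nat.sub_add_cancel h]
    have hpos : 0 ≤ (n:ℝ) ^ (m - 1) := by positivity
    have hm0 : (0:ℝ) ≤ m := by positivity
    have h2 : (m:ℝ) ^ 2 ≤ c / 4 * n := by
      have : 4 * ((m:ℝ) + 1) ^ 2 / c ≤ n := by linarith
      rw [div_le_iff₀ hc] at this
      nlinarith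
    have h3 : (m:ℝ) * X.card ≤ c / 4 * n := by
      calc (m:ℝ) * X.card ≤ (m + 1) * (c / (4 * ((m : ℝ) + 1)) * n) := by
            apply mul_le_mul (by linarith) hX (by positivity) (by positivity)
        _ = c / 4 * n := by field_simp
    have h4 : (m:ℝ) ^ 2 * (n:ℝ) ^ (m - 1) + m * (X.card * (n:ℝ) ^ (m - 1)) ≤ c / 2 * (n:ℝ) ^ m := by
      rw [hp]
      nlinarith [mul_le_mul_of_nonneg_right h2 hpos, mul_le_mul_of_nonneg_right h3 hpos]
    linarith

lemma code_bound (n b : ℕ) (hn : 3 ≤ n) : (n:ℝ) ^ b * 2 ^ n ≤ Real.exp (((b:ℝ) + 1) * n * Real.log n) := by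
  have h1 := two_pow_le_exp n hn
  have h2 := npow_eq_exp n b (by omega)
  have h3 := one_le_log n hn
  have hn' : (3:ℝ) ≤ n := by exact_mod_cast hn
  rw [h2]
  calc _ ≤ Real.exp (b * Real.log n) * Real.exp (n * Real.log n) := by gcongr
    _ = Real.exp (b * Real.log n + n * Real.log n) := by rw [Real.exp_add]
    _ ≤ _ := by
      apply Real.exp_le_exp.2
      have : (b:ℝ) * Real.log n ≤ b * n * Real.log n := by
        have : (0:ℝ) ≤ b * Real.log n := by positivity
        nlinarith
      nlinarith

set_option maxHeartbeats 1600000 in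
theorem hax_pair (s t₁ t₂ : ℕ) (h1 : t₁ + 1 ≤ s) (h2 : t₂ ≤ s) (h3 : 1 ≤ t₂) (c : ℝ) (hc : 0 < c) :
    ∃ η : ℝ, 0 < η ∧ ∃ Λ : ℝ, ∃ n₀ : ℕ, 0 < Λ ∧ ∀ n, n₀ ≤ n → ∀ p, GoodP n s p Λ →
      ∀ Rel : Fin n → Finset (Fin t₁ ⊕ Fin t₂ → Fin n),
      Pr n p (fun H => ¬ ∀ A₀ : Finset (Fin n), (A₀.card : ℝ) ≤ η * n →
        (∀ v ∈ A₀, c * (n:ℝ) ^ (t₁ + t₂) ≤ (Rel v).card) →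
        ∃ F : Fin n → (Fin t₁ ⊕ Fin t₂ → Fin n),
          (∀ v ∈ A₀, F v ∈ Rel v ∧ Function.Injective (F v) ∧ (∀ i, H.Adj v (F v (Sum.inl i))) ∧
            (∀ i j, i ≠ j → H.Adj (F v (Sum.inl i)) (F v (Sum.inl j))) ∧
            (∀ i j, i ≠ j → H.Adj (F v (Sum.inr i)) (F v (Sum.inr j)))) ∧
          ∀ v ∈ A₀, ∀ w ∈ A₀, v ≠ w → ∀ x y, F v x ≠ F w y) ≤ 2 / n := by
  set m := t₁ + t₂ with hm
  have hcm : Fintype.card (Fin t₁ ⊕ Fin t₂) = m := by simp [hm]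
  obtain ⟨Λ₁, n₁, hΛ₁, hev1⟩ := rooted_uniform (κ := Option (Fin t₁)) s (by simp) (by simpa using h1) (2 * m) (c / 4) (by positivity)
  obtain ⟨Λ₂, n₂, hΛ₂, hev2⟩ := star_forest (ι := Fin t₂) s [univ]
    ⟨⟨⟨0, h3⟩, mem_univ _, by simp⟩, by simpa using h2, trivial⟩ ((t₁ + 1 : ℕ) + 1) (c / 4) (by positivity) (by positivity)
  refine ⟨c / (4 * ((m : ℝ) + 1)) / (2 * (2 * m + 1)), by positivity, max Λ₁ Λ₂,
    max (max n₁ n₂) (max 3 (max ⌈4 * ((m : ℝ) + 1) ^ 2 / c + 1⌉₊ ⌈1 / (c / (4 * ((m : ℝ) + 1)) / 2)⌉₊)), lt_max_of_lt_left hΛ₁, ?_⟩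
  intro n hn p hp Rel
  simp only [max_le_iff] at hn
  obtain ⟨⟨hn1, hn2⟩, hn3, hn4, hn5⟩ := hn
  have hn4' : 4 * ((m : ℝ) + 1) ^ 2 / c + 1 ≤ n := (Nat.le_ceil _).trans (by exact_mod_cast hn4)
  have hn5' : 1 / (c / (4 * ((m : ℝ) + 1)) / 2) ≤ n := (Nat.le_ceil _).trans (by exact_mod_cast hn5)
  have hn1' : 1 ≤ n := by omega
  have hnpos : (0:ℝ) < n := by exact_mod_cast (by omega : 0 < n)
  set Kset : Fin n → (Fin t₁ → Fin n) → Finset (Fin n) → Finset (Fin t₂ → Fin n) := fun v g W =>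
    univ.filter (fun K => Sum.elim g K ∈ Rel v ∧ ∀ j, K j ∉ W ∧ ∀ i, K j ≠ g i) with hKset
  set F : Finset (Fin n) → Finset (Fin n) → Finset (Option (Fin t₁) → Fin n) := fun U W =>
    univ.filter (fun f => f none ∈ U ∧ Function.Injective f ∧ (∀ i, f (some i) ∉ W) ∧
      c / 4 * (n:ℝ) ^ t₂ ≤ (Kset (f none) (fun i => f (some i)) W).card) with hF
  have e1 := hev1 n hn1 p (hp.mono hn1' (le_max_left _ _)) F (by
    intro U W f hf
    simp only [hF, mem_filter] at hf
    exact hf.2.2.1)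
  have e2 := hev2 n hn2 p (hp.mono hn1' (le_max_right _ _)) (Fin n × (Fin t₁ → Fin n) × Finset (Fin n)) (by
    refine le_trans (le_of_eq ?_) (code_bound n (t₁ + 1) hn3)
    simp only [Fintype.card_prod, Fintype.card_fun, Fintype.card_fin, Fintype.card_finset]
    push_cast
    ring) (fun x => Kset x.1 x.2.1 x.2.2)
  have hor := Pr_or_le hp.nonneg hp.le_one _ _ |>.trans (add_le_add e1 e2)
  refine le_trans (Pr_mono hp.nonneg hp.le_one ?_) (hor.trans (le_of_eq (by ring)))
  intro H hH
  by_contra hcon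
  push Not at hcon
  obtain ⟨E1, E2⟩ := hcon
  apply hH
  intro A₀ hA₀ hRel
  set E : Fin n → Finset (Fin n) → Prop := fun v S => ∃ f ∈ Rel v, Function.Injective f ∧ (∀ i, H.Adj v (f (Sum.inl i))) ∧
            (∀ i j, i ≠ j → H.Adj (f (Sum.inl i)) (f (Sum.inl j))) ∧
            (∀ i j, i ≠ j → H.Adj (f (Sum.inr i)) (f (Sum.inr j))) ∧ S = univ.image f with hE
  have hx := haxell E m (by
    rintro a S ⟨f, _, _, _, _, _, rfl⟩
    exact card_image_le.trans (by rw [Finset.card_univ, hcm])) A₀ (by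
    intro A' hA' hne W hW
    have hA'r : (1:ℝ) ≤ A'.card := by exact_mod_cast hne.card_pos
    have hA'n : (A'.card : ℝ) ≤ c / (4 * ((m : ℝ) + 1)) / (2 * (2 * m + 1)) * n :=
      le_trans (by exact_mod_cast card_le_card hA') hA₀
    have hXb : ∀ v, ((insert v W).card : ℝ) ≤ c / (4 * ((m : ℝ) + 1)) * n := by
      intro v
      have h5 : ((insert v W).card : ℝ) ≤ W.card + 1 := by exact_mod_cast card_insert_le v W
      have h6 : (W.card : ℝ) ≤ 2 * m * A'.card := by exact_mod_cast hW
      have h7 : (W.card : ℝ) ≤ (2 * m + 1) * (c / (4 * ((m : ℝ) + 1)) / (2 * (2 * m + 1)) * n) := by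
        refine h6.trans (mul_le_mul (by linarith) hA'n (by positivity) (by positivity))
      have h8 : (2 * (m:ℝ) + 1) * (c / (4 * ((m : ℝ) + 1)) / (2 * (2 * m + 1)) * n) = c / (4 * ((m : ℝ) + 1)) / 2 * n := by
        field_simp
      have h9 : 1 ≤ c / (4 * ((m : ℝ) + 1)) / 2 * n := by
        rw [div_le_iff₀ (by positivity)] at hn5'
        linarith
      rw [h8] at h7
      linarith
    -- richness
    have hrich : ∀ v ∈ A', c / 4 * (n:ℝ) ^ t₁ ≤ ((univ.filter (fun g : Fin t₁ → Fin n => Function.Injective (fun o : Option (Fin t₁) => o.elim v g) ∧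
        (∀ i, g i ∉ W) ∧ c / 4 * (n:ℝ) ^ t₂ ≤ (Kset v g W).card)).card : ℝ) := by
      intro v hv
      set Z : Finset (Fin t₁ ⊕ Fin t₂ → Fin n) := (Rel v).filter (fun f => Function.Injective f ∧ ∀ x, f x ∉ insert v W) with hZ
      have hZc := clean (κ := Fin t₁ ⊕ Fin t₂) c hc (by rw [hcm]; exact hn4') (Rel v) (by rw [hcm]; exact hRel v (hA' hv))
        (insert v W) (by rw [hcm]; exact hXb v) Z (by
          intro f hf hi hx
          exact mem_filter.2 ⟨hf, hi, hx⟩)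
      rw [hcm] at hZc
      set Y : Finset ((Fin t₁ → Fin n) × (Fin t₂ → Fin n)) := Z.image (fun f => (fun i => f (Sum.inl i), fun j => f (Sum.inr j))) with hY
      have hYc : Y.card = Z.card := by
        apply card_image_of_injective
        intro f g hfg
        simp only [Prod.mk.injEq] at hfg
        ext x
        rcases x with i | j
        · exact congrArg Fin.val (congrFun hfg.1 i)
        · exact congrArg Fin.val (congrFun hfg.2 j)
      have hYm : ∀ g K, (g, K) ∈ Y → Sum.elim g K ∈ Z := by
        intro g K hgk
        obtain ⟨f, hf, h5⟩ := mem_image.1 hgk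
        simp only [Prod.mk.injEq] at h5
        have : Sum.elim g K = f := by
          rw [← h5.1, ← h5.2]
          ext x
          rcases x with i | j <;> rfl
        rwa [this]
      have := rich_rows Y (c / 4) (by
        rw [hYc]
        refine le_trans (le_of_eq ?_) hZc
        simp only [Fintype.card_fun, Fintype.card_fin]
        push_cast
        rw [hm, pow_add]; ring) (by positivity) (by
          simp only [Fintype.card_fun, Fintype.card_fin]
          positivity) (univ.filter (fun g : Fin t₁ → Fin n => Function.Injective (fun o : Option (Fin t₁) => o.elim v g) ∧
        (∀ i, g i ∉ W) ∧ c / 4 * (n:ℝ) ^ t₂ ≤ (Kset v g W).card)) (by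
          intro g hg
          simp only [Fintype.card_fun, Fintype.card_fin] at hg
          push_cast at hg
          replace hg : c / 4 * (n:ℝ) ^ t₂ ≤ ((univ.filter (fun b => (g, b) ∈ Y)).card : ℝ) := by convert hg
          have hpos : 0 < ((univ.filter (fun b => (g, b) ∈ Y)).card : ℝ) := lt_of_lt_of_le (show (0:ℝ) < c / 4 * (n:ℝ) ^ t₂ by positivity) hg
          obtain ⟨K, hK⟩ := card_pos.1 (by exact_mod_cast hpos)
          have hgK := hYm g K (mem_filter.1 hK).2
          have hgK' := (mem_filter.1 hgK).2
          rw [mem_filter]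
          refine ⟨mem_univ _, ?_, ?_, ?_⟩
          · intro o o' hoo
            rcases o with _ | i <;> rcases o' with _ | i'
            · rfl
            · exact absurd (mem_insert.2 (Or.inl hoo.symm)) (hgK'.2 (Sum.inl i'))
            · exact absurd (mem_insert.2 (Or.inl hoo)) (hgK'.2 (Sum.inl i))
            · have := hgK'.1 (show Sum.elim g K (Sum.inl i) = Sum.elim g K (Sum.inl i') from hoo)
              simp at this
              simp [this]
          · intro i hi
            exact hgK'.2 (Sum.inl i) (mem_insert_of_mem hi)
          · refine hg.trans ?_
            have hle : (univ.filter (fun b => (g, b) ∈ Y)).card ≤ (Kset v g W).card := by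
              apply card_le_card
              intro K' hK'
              have h5 := hYm g K' (mem_filter.1 hK').2
              have h6 := mem_filter.1 h5
              simp only [hKset, mem_filter, mem_univ, true_and]
              refine ⟨h6.1, fun j => ⟨fun hj => h6.2.2 (Sum.inr j) (mem_insert_of_mem hj), fun i hi => ?_⟩⟩
              have := h6.2.1 (show Sum.elim g K' (Sum.inr j) = Sum.elim g K' (Sum.inl i) from hi)
              simp at this
            exact_mod_cast hle)
      simp only [Fintype.card_fun, Fintype.card_fin] at this
      push_cast at this
      exact this
    have hFc : c / 4 * A'.card * (n:ℝ) ^ t₁ ≤ (F A' W).card := by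
      have h5 : (A'.sigma (fun v => univ.filter (fun g : Fin t₁ → Fin n => Function.Injective (fun o : Option (Fin t₁) => o.elim v g) ∧
        (∀ i, g i ∉ W) ∧ c / 4 * (n:ℝ) ^ t₂ ≤ (Kset v g W).card)) : Finset (Σ _ : Fin n, Fin t₁ → Fin n)).card ≤ (F A' W).card := by
        apply card_le_card_of_injOn (fun x => fun o => o.elim x.1 x.2)
        · rintro ⟨v, g⟩ hx
          simp only [coe_sigma, Set.mem_sigma_iff, mem_coe, mem_filter, mem_univ, true_and] at hx
          simp only [hF, coe_filter, mem_univ, true_and, Set.mem_setOf_eq]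
          exact ⟨hx.1, hx.2.1, hx.2.2.1, hx.2.2.2⟩
        · rintro ⟨v, g⟩ _ ⟨v', g'⟩ _ hh
          have ha : v = v' := congrFun hh none
          have hb : g = g' := funext (fun i => congrFun hh (some i))
          simp [ha, hb]
      rw [card_sigma] at h5
      have h6 : ∑ v ∈ A', (c / 4 * (n:ℝ) ^ t₁) ≤ (F A' W).card := by
        refine le_trans (sum_le_sum hrich) ?_
        exact_mod_cast h5
      rw [sum_const, nsmul_eq_mul] at h6
      linarith
    obtain ⟨f, hfF, hfc⟩ := E1 A' W hne hW (by simpa using hFc)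
    simp only [hF, mem_filter, mem_univ, true_and] at hfF
    obtain ⟨K, hK, hKi, hKc⟩ := E2 (f none, (fun i => f (some i)), W) (by simpa using hfF.2.2.2)
    simp only [hKset, mem_filter, mem_univ, true_and] at hK
    refine ⟨f none, hfF.1, univ.image (Sum.elim (fun i => f (some i)) K), ⟨_, hK.1, ?_, ?_, ?_, ?_, rfl⟩, ?_⟩
    · intro x y hxy
      rcases x with i | i <;> rcases y with j | j
      · have : f (some i) = f (some j) := hxy
        have := hfF.2.1 this
        simp at this; simp [this]
      · exact absurd hxy.symm ((hK.2 j).2 i)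
      · exact absurd hxy ((hK.2 i).2 j)
      · have : K i = K j := hxy
        rw [hKi this]
    · intro i; exact hfc none (some i) (by simp)
    · intro i j hij; exact hfc (some i) (some j) (by simpa using hij)
    · intro i j hij; exact hKc univ (by simp) i (mem_univ _) j (mem_univ _) hij
    · rw [Finset.disjoint_left]
      intro x hx hxW
      obtain ⟨y, _, rfl⟩ := mem_image.1 hx
      rcases y with i | j
      · exact hfF.2.2.1 i hxW
      · exact (hK.2 j).1 hxW)
  obtain ⟨f, hf1, hf2⟩ := hx
  choose! F' hF' using hf1
  refine ⟨F', fun v hv => ⟨(hF' v hv).1, (hF' v hv).2.1, (hF' v hv).2.2.1, (hF' v hv).2.2.2.1, (hF' v hv).2.2.2.2.1⟩, ?_⟩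
  intro v hv w hw hvw x y hxy
  have hd := hf2 v hv w hw hvw
  rw [(hF' v hv).2.2.2.2.2, (hF' w hw).2.2.2.2.2, Finset.disjoint_left] at hd
  exact hd (mem_image_of_mem _ (mem_univ x)) (hxy ▸ mem_image_of_mem _ (mem_univ y))

open Finset
open scoped Classical

/-- Number of earlier picks which are good for `R`. -/
noncomputable def hits {n : ℕ} {β : Type*} (h : Fin n → β) (t : ℕ) (R : Finset β) : ℕ :=
  (univ.filter (fun i : Fin n => i.val < t ∧ h i ∈ R)).card

lemma hits_succ {n : ℕ} {β : Type*} (h : Fin n → β) (t : ℕ) (ht : t < n) (a : β) (R : Finset β) :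
    hits (Function.update h ⟨t, ht⟩ a) (t + 1) R = hits h t R + if a ∈ R then 1 else 0 := by
  have hne : ∀ i : Fin n, i.val < t → Function.update h ⟨t, ht⟩ a i = h i := by
    intro i hi
    apply Function.update_of_ne
    intro hh; rw [hh] at hi; simp at hi
  unfold hits
  by_cases ha : a ∈ R
  · rw [if_pos ha]
    have : univ.filter (fun i : Fin n => i.val < t + 1 ∧ Function.update h ⟨t, ht⟩ a i ∈ R)
        = insert ⟨t, ht⟩ (univ.filter (fun i : Fin n => i.val < t ∧ h i ∈ R)) := by
      ext i
      simp only [mem_filter, mem_univ, true_and, mem_insert]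
      constructor
      · rintro ⟨h1, h2⟩
        by_cases hi : i.val < t
        · right; rw [hne i hi] at h2; exact ⟨hi, h2⟩
        · left; ext; simp; omega
      · rintro (rfl | ⟨h1, h2⟩)
        · simp [ha]
        · rw [hne i h1]; exact ⟨by omega, h2⟩
    rw [this, card_insert_of_notMem (by simp)]
  · rw [if_neg ha, add_zero]
    congr 1
    ext i
    simp only [mem_filter, mem_univ, true_and]
    constructor
    · rintro ⟨h1, h2⟩
      by_cases hi : i.val < t
      · rw [hne i hi] at h2; exact ⟨hi, h2⟩
      · have : i = ⟨t, ht⟩ := by ext; simp; omega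
        rw [this, Function.update_self] at h2
        exact absurd h2 ha
    · rintro ⟨h1, h2⟩
      rw [hne i h1]; exact ⟨by omega, h2⟩

lemma hits_zero {n : ℕ} {β : Type*} (h : Fin n → β) (R : Finset β) : hits h 0 R = 0 := by
  simp [hits]

/-- Averaging for weights. -/
lemma weight_avg {X β : Type*} [Fintype β] (X₀ : Finset X) (R : X → Finset β) (w : X → ℝ) (hw : ∀ x, 0 < w x)
    (hne : X₀.Nonempty) (c : ℝ) (hc : 0 < c)
    (h : ∀ x ∈ X₀, c * Fintype.card β ≤ ((R x).card : ℝ)) :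
    c / 2 * Fintype.card β ≤ ((univ.filter (fun a => c / 2 * ∑ x ∈ X₀, w x ≤ ∑ x ∈ X₀, if a ∈ R x then w x else 0)).card : ℝ) := by
  set S := ∑ x ∈ X₀, w x with hS
  have hSpos : 0 < S := sum_pos (fun x _ => hw x) hne
  set D := univ.filter (fun a => c / 2 * S ≤ ∑ x ∈ X₀, if a ∈ R x then w x else 0) with hD
  have h1 : c * Fintype.card β * S ≤ ∑ a : β, ∑ x ∈ X₀, if a ∈ R x then w x else 0 := by
    rw [sum_comm, hS, mul_sum]
    apply sum_le_sum
    intro x hx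
    rw [← sum_filter, sum_const, nsmul_eq_mul]
    have : univ.filter (fun a => a ∈ R x) = R x := by ext; simp
    rw [this]
    exact mul_le_mul_of_nonneg_right (h x hx) (hw x).le
  have h2 : ∀ a : β, (∑ x ∈ X₀, if a ∈ R x then w x else 0) ≤ c / 2 * S + if a ∈ D then S else 0 := by
    intro a
    by_cases ha : a ∈ D
    · rw [if_pos ha]
      have : (∑ x ∈ X₀, if a ∈ R x then w x else 0) ≤ S := by
        apply sum_le_sum
        intro x _
        split_ifs
        · exact le_rfl
        · exact (hw x).le
      have : 0 ≤ c / 2 * S := by positivity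
      linarith
    · rw [if_neg ha, add_zero]
      simp only [hD, mem_filter, mem_univ, true_and, not_le] at ha
      exact ha.le
  have h3 := h1.trans (sum_le_sum (fun a _ => h2 a))
  rw [sum_add_distrib, sum_const, ← sum_filter, sum_const] at h3
  have : univ.filter (fun a => a ∈ D) = D := by ext; simp
  rw [this, nsmul_eq_mul, nsmul_eq_mul, card_univ] at h3
  have h4 : (c / 2 * Fintype.card β) * S ≤ D.card * S := by nlinarith
  exact le_of_mul_le_mul_right h4 hSpos

set_option maxHeartbeats 1600000 in
theorem absorbers {ι J : Type} [Fintype ι] [Fintype J] (s : ℕ) (l : List (Finset ι)) (hl : FL s l)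
    (q c η : ℝ) (hq : 0 < q) (hc : 0 < c) (hη : 0 < η) :
    ∃ θ : ℝ, 0 < θ ∧ ∃ Λ : ℝ, ∃ n₀ : ℕ, 0 < Λ ∧ ∀ n, n₀ ≤ n → ∀ p, GoodP n s p Λ →
      ∀ (σ : Type) [Fintype σ], (Fintype.card σ : ℝ) ≤ Real.exp (q * n * Real.log n) →
      ∀ (X₀ : σ → Finset (J → Fin n)) (R : σ → (J → Fin n) → Finset (ι → Fin n)),
        Pr n p (fun H => ¬ ∀ y, (∀ x ∈ X₀ y, c * (n:ℝ) ^ (Fintype.card ι) ≤ (R y x).card) →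
          ∃ (I : Finset (Fin n)) (a : Fin n → ι → Fin n), (I.card : ℝ) ≤ η * n ∧
            (∀ i ∈ I, Function.Injective (a i) ∧ (∀ B ∈ l, Cl H (a i) B) ∧ ∃ x ∈ X₀ y, a i ∈ R y x) ∧
            (∀ i ∈ I, ∀ j ∈ I, i ≠ j → ∀ u v, a i u ≠ a j v) ∧
            ∀ x ∈ X₀ y, θ * n ≤ ((I.filter (fun i => a i ∈ R y x)).card : ℝ)) ≤ 1 / n := by
  set m := Fintype.card ι with hm
  set η' := min (min η 1) (c / 2 / (4 * ((m : ℝ) + 1)) / (m + 1)) with hη'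
  have hη'0 : 0 < η' := by positivity
  obtain ⟨Λ, n₁, hΛ, hev⟩ := star_forest (ι := ι) s l hl (q + m + 1) (c / 4) (by positivity) (by positivity)
  set θ := c * η' / 16 with hθ
  have hθ0 : 0 < θ := by positivity
  have hlogo : ∀ᶠ n : ℕ in Filter.atTop, (Fintype.card J : ℝ) * Real.log n + c / 4 ≤ θ * n := by
    have h1 := (Real.isLittleO_log_id_atTop).bound (c := θ / 2 / (Fintype.card J + 1)) (by positivity)
    have h2 := tendsto_natCast_atTop_atTop (R := ℝ) |>.eventually h1
    have h3 := (tendsto_natCast_atTop_atTop (R := ℝ)).eventually_ge_atTop (c / 4 / (θ / 2))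
    filter_upwards [h2, h3, Filter.eventually_ge_atTop 1] with n hn hn3 hn1
    have h4 : Real.log n ≤ θ / 2 / (Fintype.card J + 1) * n := by
      refine (le_abs_self _).trans (hn.trans (le_of_eq ?_))
      simp
    have h5 : (Fintype.card J : ℝ) * Real.log n ≤ θ / 2 * n := by
      calc (Fintype.card J : ℝ) * Real.log n ≤ (Fintype.card J + 1) * Real.log n := by
            apply mul_le_mul_of_nonneg_right (by linarith) (Real.log_natCast_nonneg n)
        _ ≤ (Fintype.card J + 1) * (θ / 2 / (Fintype.card J + 1) * n) := by gcongr
        _ = θ / 2 * n := by field_simp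
    rw [div_le_iff₀ (by positivity)] at hn3
    linarith
  obtain ⟨n₂, hn₂⟩ := Filter.eventually_atTop.1 hlogo
  refine ⟨θ, hθ0, Λ, max (max n₁ n₂) (max 3 ⌈4 * ((m : ℝ) + 1) ^ 2 / (c / 2) + 1⌉₊), hΛ, ?_⟩
  intro n hn p hp σ _ hσ X₀ R
  simp only [max_le_iff] at hn
  obtain ⟨⟨hn1, hn2⟩, hn3, hn4⟩ := hn
  have hn4' : 4 * ((m : ℝ) + 1) ^ 2 / (c / 2) + 1 ≤ n := (Nat.le_ceil _).trans (by exact_mod_cast hn4)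
  have hlog := hn₂ n hn2
  have hnpos : (0:ℝ) < n := by exact_mod_cast (by omega : 0 < n)
  set used : (Fin n → ι → Fin n) → ℕ → Finset (Fin n) := fun h t =>
    (univ.filter (fun i : Fin n => i.val < t)).biUnion (fun i => univ.image (h i)) with hused
  set A : σ × (Fin n → ι → Fin n) × Fin n → Finset (ι → Fin n) := fun y =>
    (univ.filter (fun a => c / 2 * ∑ x ∈ X₀ y.1, (1 / 2 : ℝ) ^ hits y.2.1 y.2.2 (R y.1 x) ≤
      ∑ x ∈ X₀ y.1, if a ∈ R y.1 x then (1 / 2 : ℝ) ^ hits y.2.1 y.2.2 (R y.1 x) else 0)).filter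
      (fun a => ∀ u, a u ∉ used y.2.1 y.2.2) with hA
  have e := hev n hn1 p hp (σ × (Fin n → ι → Fin n) × Fin n) (by
    have h1 := npow_eq_exp n (m * n + 1) (by omega)
    have hcard : (Fintype.card (σ × (Fin n → ι → Fin n) × Fin n) : ℝ) = Fintype.card σ * (n:ℝ) ^ (m * n + 1) := by
      simp only [Fintype.card_prod, Fintype.card_fun, Fintype.card_fin]
      push_cast
      rw [← hm, ← pow_mul]; ring
    rw [hcard, h1]
    refine (mul_le_mul_of_nonneg_right hσ (Real.exp_pos _).le).trans ?_
    rw [← Real.exp_add]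
    apply Real.exp_le_exp.2
    push_cast
    have hl1 := one_le_log n hn3
    have : (1:ℝ) ≤ n := by exact_mod_cast (by omega : 1 ≤ n)
    nlinarith) A
  refine le_trans (Pr_mono hp.nonneg hp.le_one ?_) e
  intro H hH hE
  apply hH
  intro y hy
  rcases (X₀ y).eq_empty_or_nonempty with hemp | hne
  · exact ⟨∅, fun _ => Classical.choice ⟨fun _ => ⟨0, by omega⟩⟩, by simp; positivity, by simp, by simp, by simp [hemp]⟩
  set N := ⌊η' * n⌋₊ with hN
  have hNle : (N:ℝ) ≤ η' * n := Nat.floor_le (by positivity)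
  have hNge : η' * n - 1 ≤ N := by
    have := Nat.lt_floor_add_one (η' * n)
    linarith
  have hη1 : η' ≤ 1 := (min_le_left _ _).trans (min_le_right _ _)
  have hηη : η' ≤ η := (min_le_left _ _).trans (min_le_left _ _)
  have hNn : N ≤ n := by
    have : (N:ℝ) ≤ n := by nlinarith
    exact_mod_cast this
  have key : ∀ t, t ≤ N → ∃ h : Fin n → ι → Fin n,
      (∀ i : Fin n, i.val < t → Function.Injective (h i) ∧ (∀ B ∈ l, Cl H (h i) B) ∧ ∃ x ∈ X₀ y, h i ∈ R y x) ∧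
      (∀ i j : Fin n, i.val < t → j.val < t → i ≠ j → ∀ u v, h i u ≠ h j v) ∧
      ∑ x ∈ X₀ y, (1 / 2 : ℝ) ^ hits h t (R y x) ≤ (X₀ y).card * Real.exp (-(c / 4) * t) := by
    intro t
    induction t with
    | zero =>
      intro _
      refine ⟨fun _ => Classical.choice ⟨fun _ => ⟨0, by omega⟩⟩, by simp, by simp, ?_⟩
      simp [hits_zero]
    | succ t ih =>
      intro ht
      obtain ⟨h, hh1, hh2, hh3⟩ := ih (by omega)
      have htn : t < n := by omega
      have hEt := hE (y, h, ⟨t, htn⟩) (by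
        have hw := weight_avg (X₀ y) (R y) (fun x => (1 / 2 : ℝ) ^ hits h t (R y x)) (fun x => by positivity) hne c hc
          (by intro x hx; have := hy x hx; simpa [Fintype.card_fun] using this)
        have hcl := clean (κ := ι) (n := n) (c / 2) (by positivity) (by rw [← hm]; exact hn4') _
          (by
            rw [Fintype.card_fun, Fintype.card_fin] at hw
            push_cast at hw
            exact hw) (used h t) (by
            rw [← hm]
            have h5 : (used h t).card ≤ N * m := by
              calc _ ≤ ∑ i ∈ (univ.filter (fun i : Fin n => i.val < t)), (univ.image (h i)).card := card_biUnion_le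
                _ ≤ ∑ i ∈ (univ.filter (fun i : Fin n => i.val < t)), m := sum_le_sum (fun i _ => card_image_le.trans (by rw [card_univ]))
                _ = (univ.filter (fun i : Fin n => i.val < t)).card * m := by simp
                _ ≤ N * m := by
                  gcongr
                  have : (univ.filter (fun i : Fin n => i.val < t)).card ≤ (range t).card :=
                    card_le_card_of_injOn (fun i => i.val) (by intro i hi; simpa using hi) (by intro a _ b _ hab; exact Fin.ext hab)
                  simp at this; simp; omega
            have h6 : ((used h t).card : ℝ) ≤ N * m := by exact_mod_cast h5
            have h7 : η' ≤ c / 2 / (4 * ((m : ℝ) + 1)) / (m + 1) := min_le_right _ _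
            rw [le_div_iff₀ (by positivity)] at h7
            calc ((used h t).card : ℝ) ≤ N * m := h6
              _ ≤ (η' * n) * (m + 1) := by gcongr; linarith
              _ = (η' * (m + 1)) * n := by ring
              _ ≤ _ := by gcongr)
          (A (y, h, ⟨t, htn⟩)) (by
            intro f hf _ hfu
            simp only [hA, mem_filter, mem_univ, true_and] at hf ⊢
            exact ⟨by convert hf, hfu⟩)
        rw [← hm] at hcl
        refine le_trans (le_of_eq ?_) hcl
        ring)
      obtain ⟨a, haA, hainj, haC⟩ := hEt
      simp only [hA, mem_filter, mem_univ, true_and] at haA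
      obtain ⟨haw, hau⟩ := haA
      have hupne : ∀ i : Fin n, i.val < t → Function.update h ⟨t, htn⟩ a i = h i := by
        intro i hi
        apply Function.update_of_ne
        intro hh; rw [hh] at hi; simp at hi
      have hdis : ∀ i : Fin n, i.val < t → ∀ u v, h i u ≠ a v := by
        intro i hi u v huv
        apply hau v
        rw [← huv]
        simp only [hused, mem_biUnion, mem_filter, mem_univ, true_and, mem_image]
        exact ⟨i, hi, u, rfl⟩
      have hSpos : 0 < ∑ x ∈ X₀ y, (1 / 2 : ℝ) ^ hits h t (R y x) := sum_pos (fun x _ => by positivity) hne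
      refine ⟨Function.update h ⟨t, htn⟩ a, ?_, ?_, ?_⟩
      · intro i hi
        by_cases hit : i.val < t
        · rw [hupne i hit]; exact hh1 i hit
        · have : i = ⟨t, htn⟩ := by ext; simp; omega
          subst this
          rw [Function.update_self]
          refine ⟨hainj, haC, ?_⟩
          by_contra hno
          push Not at hno
          have h0 : (∑ x ∈ X₀ y, if a ∈ R y x then (1 / 2 : ℝ) ^ hits h t (R y x) else 0) = 0 :=
            sum_eq_zero (fun x hx => if_neg (hno x hx))
          rw [h0] at haw
          have : 0 < c / 2 * ∑ x ∈ X₀ y, (1 / 2 : ℝ) ^ hits h t (R y x) := by positivity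
          linarith
      · intro i j hi hj hij u v
        by_cases hit : i.val < t
        · rw [hupne i hit]
          by_cases hjt : j.val < t
          · rw [hupne j hjt]; exact hh2 i j hit hjt hij u v
          · have : j = ⟨t, htn⟩ := by ext; simp; omega
            subst this
            rw [Function.update_self]
            exact hdis i hit u v
        · have h5 : i = ⟨t, htn⟩ := by ext; simp; omega
          by_cases hjt : j.val < t
          · rw [hupne j hjt, h5, Function.update_self]; exact fun hh => hdis j hjt v u hh.symm
          · exfalso; apply hij; rw [h5]; ext; simp; omega
      · have hstep : ∑ x ∈ X₀ y, (1 / 2 : ℝ) ^ hits (Function.update h ⟨t, htn⟩ a) (t + 1) (R y x)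
            = ∑ x ∈ X₀ y, (1 / 2 : ℝ) ^ hits h t (R y x) - 1 / 2 * ∑ x ∈ X₀ y, if a ∈ R y x then (1 / 2 : ℝ) ^ hits h t (R y x) else 0 := by
          rw [mul_sum, ← sum_sub_distrib]
          apply sum_congr rfl
          intro x _
          rw [hits_succ]
          split_ifs
          · rw [pow_succ]; ring
          · simp
        rw [hstep]
        have hexp : 1 - c / 4 ≤ Real.exp (-(c / 4)) := by
          have := Real.add_one_le_exp (-(c / 4)); linarith
        have h6 : Real.exp (-(c / 4) * ((t + 1 : ℕ) : ℝ)) = Real.exp (-(c / 4)) * Real.exp (-(c / 4) * t) := by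
          rw [← Real.exp_add]; push_cast; ring_nf
        rw [h6]
        calc _ ≤ (1 - c / 4) * ∑ x ∈ X₀ y, (1 / 2 : ℝ) ^ hits h t (R y x) := by
              have haw2 : c / 2 * ∑ x ∈ X₀ y, (1 / 2 : ℝ) ^ hits h t (R y x) ≤ ∑ x ∈ X₀ y, if a ∈ R y x then (1 / 2 : ℝ) ^ hits h t (R y x) else 0 := by convert haw
              linarith
          _ ≤ Real.exp (-(c / 4)) * ∑ x ∈ X₀ y, (1 / 2 : ℝ) ^ hits h t (R y x) := by gcongr
          _ ≤ Real.exp (-(c / 4)) * ((X₀ y).card * Real.exp (-(c / 4) * t)) := by gcongr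
          _ = _ := by ring
  obtain ⟨h, hh1, hh2, hh3⟩ := key N le_rfl
  refine ⟨univ.filter (fun i : Fin n => i.val < N), h, ?_, ?_, ?_, ?_⟩
  · have : (univ.filter (fun i : Fin n => i.val < N)).card ≤ (range N).card :=
      card_le_card_of_injOn (fun i => i.val) (by intro i hi; simpa using hi) (by intro a _ b _ hab; exact Fin.ext hab)
    rw [card_range] at this
    calc ((univ.filter (fun i : Fin n => i.val < N)).card : ℝ) ≤ N := by exact_mod_cast this
      _ ≤ η' * n := hNle
      _ ≤ η * n := by gcongr
  · intro i hi
    exact hh1 i (by simpa using hi)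
  · intro i hi j hj hij
    exact hh2 i j (by simpa using hi) (by simpa using hj) hij
  · intro x hx
    have h5 : (univ.filter (fun i : Fin n => i.val < N)).filter (fun i => h i ∈ R y x)
        = univ.filter (fun i : Fin n => i.val < N ∧ h i ∈ R y x) := by
      rw [filter_filter]
    rw [h5]
    have h55 : (univ.filter (fun i : Fin n => i.val < N ∧ h i ∈ R y x)).card = hits h N (R y x) := by
      unfold hits; congr
    rw [h55]
    set b := hits h N (R y x) with hb
    have h6 : (1 / 2 : ℝ) ^ b ≤ (X₀ y).card * Real.exp (-(c / 4) * N) := by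
      refine le_trans ?_ hh3
      exact single_le_sum (f := fun x => (1 / 2 : ℝ) ^ hits h N (R y x)) (fun x _ => by positivity) hx
    have h7 : ((X₀ y).card : ℝ) ≤ Real.exp (Fintype.card J * Real.log n) := by
      rw [← npow_eq_exp n _ (by omega)]
      have : (X₀ y).card ≤ n ^ Fintype.card J := by
        refine (card_le_univ _).trans (le_of_eq ?_)
        simp
      exact_mod_cast this
    have h8 : Real.exp (-(b:ℝ)) ≤ (1 / 2 : ℝ) ^ b := by
      have : Real.exp (-(b:ℝ)) = (Real.exp (-1)) ^ b := by
        rw [← Real.exp_nat_mul]; ring_nf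
      rw [this]
      apply pow_le_pow_left₀ (Real.exp_pos _).le
      rw [Real.exp_neg, one_div]
      apply inv_anti₀ (by norm_num)
      have := Real.add_one_le_exp (1:ℝ); linarith
    have h9 : Real.exp (-(b:ℝ)) ≤ Real.exp (Fintype.card J * Real.log n + -(c / 4) * N) := by
      rw [Real.exp_add]
      exact h8.trans (h6.trans (by gcongr))
    have h10 := Real.exp_le_exp.1 h9
    have h11 : c / 4 * (η' * n - 1) ≤ c / 4 * N := by gcongr
    have h12 : c * η' = 16 * θ := by rw [hθ]; ring
    have h13 : c * η' * n = 16 * θ * n := by rw [h12]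
    have h14 : 0 < θ * n := by positivity
    nlinarith

open Finset
open scoped Classical

/-- `S` can be partitioned into `r`-cliques of `Γ`. -/
def TL {n : ℕ} (Γ : SimpleGraph (Fin n)) (r : ℕ) (S : Finset (Fin n)) : Prop :=
  ∃ T : Finset (Finset (Fin n)), (∀ Q ∈ T, Γ.IsNClique r Q) ∧
    (∀ Q ∈ T, ∀ Q' ∈ T, Q ≠ Q' → Disjoint Q Q') ∧ T.biUnion id = S

lemma TL_empty {n : ℕ} (Γ : SimpleGraph (Fin n)) (r : ℕ) : TL Γ r ∅ :=
  ⟨∅, by simp, by simp, by simp⟩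

lemma TL_clique {n : ℕ} {Γ : SimpleGraph (Fin n)} {r : ℕ} {S : Finset (Fin n)}
    (h : Γ.IsNClique r S) : TL Γ r S :=
  ⟨{S}, by simpa using h, by simp, by simp⟩

lemma TL_union {n : ℕ} {Γ : SimpleGraph (Fin n)} {r : ℕ} {S S' : Finset (Fin n)}
    (h : TL Γ r S) (h' : TL Γ r S') (hd : Disjoint S S') : TL Γ r (S ∪ S') := by
  obtain ⟨T, h1, h2, h3⟩ := h
  obtain ⟨T', h1', h2', h3'⟩ := h'
  have hx : ∀ Q ∈ T, ∀ Q' ∈ T', Disjoint Q Q' := by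
    intro Q hQ Q' hQ'
    refine Disjoint.mono ?_ ?_ hd
    · rw [← h3]; exact subset_biUnion_of_mem id hQ
    · rw [← h3']; exact subset_biUnion_of_mem id hQ'
  refine ⟨T ∪ T', ?_, ?_, ?_⟩
  · intro Q hQ
    rcases mem_union.1 hQ with hQ | hQ
    · exact h1 Q hQ
    · exact h1' Q hQ
  · intro Q hQ Q' hQ' hne
    rcases mem_union.1 hQ with hQ | hQ <;> rcases mem_union.1 hQ' with hQ' | hQ'
    · exact h2 Q hQ Q' hQ' hne
    · exact hx Q hQ Q' hQ'
    · exact (hx Q' hQ' Q hQ).symm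
    · exact h2' Q hQ Q' hQ' hne
  · rw [union_biUnion, h3, h3']

lemma TL_biUnion {n : ℕ} {Γ : SimpleGraph (Fin n)} {r : ℕ} {ι : Type*} (I : Finset ι)
    (D : ι → Finset (Fin n)) (h : ∀ i ∈ I, TL Γ r (D i))
    (hd : ∀ i ∈ I, ∀ j ∈ I, i ≠ j → Disjoint (D i) (D j)) : TL Γ r (I.biUnion D) := by
  induction I using Finset.induction_on with
  | empty => simpa using TL_empty Γ r
  | insert a I ha ih =>
    have e : (insert a I).biUnion D = D a ∪ I.biUnion D := by
      ext x; simp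
    rw [e]
    apply TL_union (h a (mem_insert_self a I))
    · exact ih (fun i hi => h i (mem_insert_of_mem hi)) (fun i hi j hj => hd i (mem_insert_of_mem hi) j (mem_insert_of_mem hj))
    · rw [disjoint_biUnion_right]
      intro i hi
      exact hd a (mem_insert_self a I) i (mem_insert_of_mem hi) (fun hh => ha (hh ▸ hi))

lemma TL_dvd {n : ℕ} {Γ : SimpleGraph (Fin n)} {r : ℕ} {S : Finset (Fin n)}
    (h : TL Γ r S) : r ∣ S.card := by
  obtain ⟨T, h1, h2, h3⟩ := h
  rw [← h3, card_biUnion (t := id) (fun Q hQ Q' hQ' hne => h2 Q hQ Q' hQ' hne)]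
  exact dvd_sum (fun Q hQ => by simp [(h1 Q hQ).card_eq])

lemma TL_factor {n : ℕ} {Γ : SimpleGraph (Fin n)} {r : ℕ} (hr : 1 ≤ r)
    (h : TL Γ r univ) : HasCliqueFactor Γ r := by
  obtain ⟨T, h1, h2, h3⟩ := h
  refine ⟨⟨T, ?_, ?_, ?_⟩, h1⟩
  · rw [Finset.supIndep_iff_pairwiseDisjoint]
    intro Q hQ Q' hQ' hne
    exact h2 Q hQ Q' hQ' hne
  · rw [Finset.sup_eq_biUnion]; exact h3
  · intro hb
    have := (h1 _ hb).card_eq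
    simp at this
    omega

lemma absorb {n : ℕ} {Γ : SimpleGraph (Fin n)} {r : ℕ} {ι β : Type*} (X : Finset β)
    (D : ι → Finset (Fin n)) (O : β → Finset (Fin n))
    (hO : ∀ x ∈ X, ∀ y ∈ X, x ≠ y → Disjoint (O x) (O y)) :
    ∀ I : Finset ι,
    (∀ i ∈ I, ∀ j ∈ I, i ≠ j → Disjoint (D i) (D j)) →
    (∀ i ∈ I, ∀ x ∈ X, Disjoint (D i) (O x)) →
    (∀ i ∈ I, TL Γ r (D i)) →
    (∀ x ∈ X, X.card ≤ (I.filter (fun i => TL Γ r (D i ∪ O x))).card) →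
    TL Γ r (I.biUnion D ∪ X.biUnion O) := by
  induction X using Finset.induction_on with
  | empty =>
    intro I hD _ hT _
    simpa using TL_biUnion I D hT hD
  | insert x X hx ih =>
    intro I hD hDO hT hc
    have h1 := hc x (mem_insert_self x X)
    rw [card_insert_of_notMem hx] at h1
    obtain ⟨i, hi⟩ : (I.filter (fun i => TL Γ r (D i ∪ O x))).Nonempty := by
      rw [← card_pos]; omega
    rw [mem_filter] at hi
    have h2 := ih (fun y hy z hz => hO y (mem_insert_of_mem hy) z (mem_insert_of_mem hz)) (I.erase i)
      (fun a ha b hb => hD a (mem_of_mem_erase ha) b (mem_of_mem_erase hb))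
      (fun a ha y hy => hDO a (mem_of_mem_erase ha) y (mem_insert_of_mem hy))
      (fun a ha => hT a (mem_of_mem_erase ha))
      (by
        intro y hy
        have h3 := hc y (mem_insert_of_mem hy)
        rw [card_insert_of_notMem hx] at h3
        have h4 : ((I.filter (fun i => TL Γ r (D i ∪ O y))).erase i).card ≤ ((I.erase i).filter (fun i => TL Γ r (D i ∪ O y))).card := by
          apply card_le_card
          intro a ha
          simp only [mem_erase, mem_filter] at ha ⊢
          tauto
        have h5 := pred_card_le_card_erase (s := I.filter (fun i => TL Γ r (D i ∪ O y))) (a := i)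
        omega)
    have e : I.biUnion D ∪ (insert x X).biUnion O = (D i ∪ O x) ∪ ((I.erase i).biUnion D ∪ X.biUnion O) := by
      rw [biUnion_insert]
      conv_lhs => rw [← insert_erase hi.1]
      rw [biUnion_insert]
      ext z; simp only [mem_union]; tauto
    rw [e]
    apply TL_union hi.2 h2
    simp only [disjoint_union_left, disjoint_union_right, disjoint_biUnion_right]
    refine ⟨fun a ha => ⟨?_, ?_⟩, fun y hy => ⟨?_, ?_⟩⟩
    · exact hD i hi.1 a (mem_of_mem_erase ha) (ne_of_mem_erase ha).symm
    · exact (hDO a (mem_of_mem_erase ha) x (mem_insert_self x X)).symm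
    · exact hDO i hi.1 y (mem_insert_of_mem hy)
    · exact hO x (mem_insert_self x X) y (mem_insert_of_mem hy) (fun hh => hx (hh ▸ hy))

lemma grouping {n : ℕ} {J : Type} [Fintype J] (S : Finset (Fin n))
    (h : Fintype.card J ∣ S.card) :
    ∃ (m : ℕ) (e : Fin m → J → Fin n), Fintype.card J * m = S.card ∧
      (∀ i j i' j', e i j = e i' j' → i = i' ∧ j = j') ∧ (∀ v, v ∈ S ↔ ∃ i j, e i j = v) := by
  obtain ⟨m, hm⟩ := h
  have E : Fin m × J ≃ S := Fintype.equivOfCardEq (by simp [hm, mul_comm])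
  refine ⟨m, fun i j => (E (i, j)).1, hm.symm, ?_, ?_⟩
  · intro i j i' j' hh
    have := E.injective (Subtype.ext hh)
    simpa using this
  · intro v
    constructor
    · intro hv
      refine ⟨(E.symm ⟨v, hv⟩).1, (E.symm ⟨v, hv⟩).2, ?_⟩
      simp
    · rintro ⟨i, j, rfl⟩
      exact (E (i, j)).2

open Finset
open scoped Classical

/-- number of adjacent ordered pairs -/
noncomputable def eG {n : ℕ} (G : SimpleGraph (Fin n)) (A B : Finset (Fin n)) : ℕ :=
  ((A ×ˢ B).filter (fun p => G.Adj p.1 p.2)).card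

/-- neighbours of `v` in `B` -/
noncomputable def nbh {n : ℕ} (G : SimpleGraph (Fin n)) (v : Fin n) (B : Finset (Fin n)) : Finset (Fin n) :=
  B.filter (fun w => G.Adj v w)

lemma nbh_mono {n : ℕ} (G : SimpleGraph (Fin n)) (v : Fin n) {B B' : Finset (Fin n)} (h : B ⊆ B') :
    nbh G v B ⊆ nbh G v B' := filter_subset_filter _ h

lemma nbh_card_le {n : ℕ} (G : SimpleGraph (Fin n)) (v : Fin n) (B : Finset (Fin n)) :
    (nbh G v B).card ≤ B.card := card_filter_le _ _

lemma eG_sum {n : ℕ} (G : SimpleGraph (Fin n)) (A B : Finset (Fin n)) :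
    eG G A B = ∑ a ∈ A, (nbh G a B).card := by
  unfold eG nbh
  rw [card_filter, sum_product]
  apply sum_congr rfl
  intro a _
  rw [card_filter]

lemma eG_comm {n : ℕ} (G : SimpleGraph (Fin n)) (A B : Finset (Fin n)) :
    eG G A B = eG G B A := by
  unfold eG
  apply card_bij (fun p _ => (p.2, p.1))
  · intro p hp
    simp only [mem_filter, mem_product] at hp ⊢
    exact ⟨⟨hp.1.2, hp.1.1⟩, hp.2.symm⟩
  · rintro ⟨a, b⟩ _ ⟨a', b'⟩ _ h
    simp at h ⊢; tauto
  · rintro ⟨a, b⟩ hp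
    simp only [mem_filter, mem_product] at hp
    refine ⟨(b, a), ?_, rfl⟩
    simp only [mem_filter, mem_product]
    exact ⟨⟨hp.1.2, hp.1.1⟩, hp.2.symm⟩

lemma eG_sdiff {n : ℕ} (G : SimpleGraph (Fin n)) (A X : Finset (Fin n)) :
    eG G A A ≤ eG G (A \ X) (A \ X) + 2 * n * X.card := by
  have h : (A ×ˢ A).filter (fun p => G.Adj p.1 p.2) ⊆
      (((A \ X) ×ˢ (A \ X)).filter (fun p => G.Adj p.1 p.2)) ∪ (X ×ˢ univ ∪ univ ×ˢ X) := by
    intro p hp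
    simp only [mem_filter, mem_product, mem_union, mem_sdiff, mem_univ, and_true, true_and] at hp ⊢
    tauto
  have h2 := card_le_card h
  have h3 := card_union_le (((A \ X) ×ˢ (A \ X)).filter (fun p => G.Adj p.1 p.2)) (X ×ˢ univ ∪ univ ×ˢ X)
  have h4 := card_union_le (X ×ˢ (univ : Finset (Fin n))) (univ ×ˢ X)
  simp only [card_product, card_univ, Fintype.card_fin] at h4
  unfold eG
  nlinarith

/-- dense pairs contain tiles -/
def T1 {n : ℕ} (Γ G : SimpleGraph (Fin n)) (k s : ℕ) (d : ℝ) : Prop :=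
  ∀ A B : Finset (Fin n), d * (n : ℝ) ^ 2 ≤ eG G A B → ∃ K L : Finset (Fin n), K ⊆ A ∧ L ⊆ B ∧
    K.card = k ∧ L.card = s ∧ Disjoint K L ∧ Γ.IsNClique (k + s) (K ∪ L)

/-- a family of disjoint cliques inside `W` -/
def Til {n : ℕ} (Γ : SimpleGraph (Fin n)) (r : ℕ) (T : Finset (Finset (Fin n))) (W : Finset (Fin n)) : Prop :=
  (∀ Q ∈ T, Γ.IsNClique r Q ∧ Q ⊆ W) ∧ (∀ Q ∈ T, ∀ Q' ∈ T, Q ≠ Q' → Disjoint Q Q')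

lemma Til_card {n : ℕ} {Γ : SimpleGraph (Fin n)} {r : ℕ} {T : Finset (Finset (Fin n))} {W : Finset (Fin n)}
    (h : Til Γ r T W) : (T.biUnion id).card = r * T.card := by
  rw [card_biUnion (t := id) (fun Q hQ Q' hQ' hne => h.2 Q hQ Q' hQ' hne)]
  simp only [id]
  rw [sum_const_nat (m := r) (fun Q hQ => (h.1 Q hQ).1.card_eq), mul_comm]

lemma Til_union {n : ℕ} {Γ : SimpleGraph (Fin n)} {r : ℕ} (hr : 1 ≤ r) {T T' : Finset (Finset (Fin n))} {W W' : Finset (Fin n)}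
    (h : Til Γ r T W) (h' : Til Γ r T' W') (hd : ∀ Q ∈ T, ∀ Q' ∈ T', Disjoint Q Q') :
    Til Γ r (T ∪ T') (W ∪ W') ∧ (T ∪ T').card = T.card + T'.card := by
  refine ⟨⟨?_, ?_⟩, ?_⟩
  · intro Q hQ
    rcases mem_union.1 hQ with hQ | hQ
    · exact ⟨(h.1 Q hQ).1, (h.1 Q hQ).2.trans subset_union_left⟩
    · exact ⟨(h'.1 Q hQ).1, (h'.1 Q hQ).2.trans subset_union_right⟩
  · intro Q hQ Q' hQ' hne
    rcases mem_union.1 hQ with hQ | hQ <;> rcases mem_union.1 hQ' with hQ' | hQ'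
    · exact h.2 Q hQ Q' hQ' hne
    · exact hd Q hQ Q' hQ'
    · exact (hd Q' hQ' Q hQ).symm
    · exact h'.2 Q hQ Q' hQ' hne
  · apply card_union_of_disjoint
    rw [disjoint_left]
    intro Q hQ hQ'
    have h1 := hd Q hQ Q hQ'
    rw [disjoint_self] at h1
    have h2 := (h.1 Q hQ).1.card_eq
    rw [h1] at h2
    simp at h2; omega

/-- maximal tilings and exchange -/
lemma exch {n : ℕ} (Γ : SimpleGraph (Fin n)) (r : ℕ) (hr : 1 ≤ r) (R : Finset (Fin n)) :
    ∃ T : Finset (Finset (Fin n)), Til Γ r T R ∧ ∀ B ⊆ T, ∀ T' : Finset (Finset (Fin n)),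
      Til Γ r T' ((R \ T.biUnion id) ∪ B.biUnion id) → T'.card ≤ B.card := by
  obtain ⟨T, hT, hmax⟩ := exists_max_image (univ.filter (fun T : Finset (Finset (Fin n)) => Til Γ r T R)) card
    ⟨∅, by rw [mem_filter]; exact ⟨mem_univ _, by simp [Til]⟩⟩
  simp only [mem_filter, mem_univ, true_and] at hT hmax
  refine ⟨T, hT, ?_⟩
  intro B hB T' hT'
  have h1 : Til Γ r (T \ B) R := ⟨fun Q hQ => hT.1 Q (mem_sdiff.1 hQ).1, fun Q hQ Q' hQ' => hT.2 Q (mem_sdiff.1 hQ).1 Q' (mem_sdiff.1 hQ').1⟩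
  obtain ⟨h2, h3⟩ := Til_union hr h1 hT' (by
    intro Q hQ Q' hQ'
    rw [mem_sdiff] at hQ
    refine Disjoint.mono_right (hT'.1 Q' hQ').2 ?_
    rw [disjoint_union_right]
    constructor
    · rw [disjoint_left]
      intro v hv hv'
      rw [mem_sdiff, mem_biUnion] at hv'
      exact hv'.2 ⟨Q, hQ.1, hv⟩
    · rw [disjoint_biUnion_right]
      intro Q2 hQ2
      exact hT.2 Q hQ.1 Q2 (hB hQ2) (fun hh => hQ.2 (hh ▸ hQ2)))
  have h4 : Til Γ r (T \ B ∪ T') R := by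
    refine ⟨fun Q hQ => ⟨(h2.1 Q hQ).1, (h2.1 Q hQ).2.trans ?_⟩, h2.2⟩
    intro v hv
    simp only [mem_union, mem_sdiff, mem_biUnion, id] at hv
    rcases hv with hv | hv | ⟨Q, hQ, hv⟩
    · exact hv
    · exact hv.1
    · exact (hT.1 Q (hB hQ)).2 hv
  have h5 := hmax _ h4
  rw [h3, card_sdiff_of_subset hB] at h5
  have := card_le_card hB
  omega

/-- greedy tiling with `k` vertices in `A` and `s` in `U`. -/
lemma greedyT {n : ℕ} {Γ G : SimpleGraph (Fin n)} {k s : ℕ} {d : ℝ} (hk : 1 ≤ k) (hT1 : T1 Γ G k s d)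
    (A U : Finset (Fin n)) (hAU : Disjoint A U) (x w : ℝ) (hx : ∀ a ∈ A, x ≤ (nbh G a U).card)
    (hw : 0 ≤ w) (hd : d * (n : ℝ) ^ 2 ≤ w * (x / 2)) :
    ∀ t : ℕ, w + k * t ≤ A.card → (s : ℝ) * t ≤ x / 2 → 
      ∃ T : Finset (Finset (Fin n)), T.card = t ∧ Til Γ (k + s) T (A ∪ U) ∧
        ∀ Q ∈ T, (Q ∩ A).card = k ∧ (Q ∩ U).card = s := by
  intro t
  induction t with
  | zero => intro _ _; exact ⟨∅, by simp, by simp [Til], by simp⟩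
  | succ t ih =>
    intro h1 h2
    push_cast at h1 h2
    obtain ⟨T, hTc, hT, hTQ⟩ := ih (by nlinarith [(by positivity : (0:ℝ) ≤ k)]) (by nlinarith [(by positivity : (0:ℝ) ≤ s)])
    set X := T.biUnion id with hX
    have hXA : (X ∩ A).card ≤ k * t := by
      rw [hX, biUnion_inter]
      refine card_biUnion_le.trans ?_
      simp only [id]
      rw [sum_const_nat (m := k) (fun Q hQ => (hTQ Q hQ).1), hTc, mul_comm]
    have hXU : (X ∩ U).card ≤ s * t := by
      rw [hX, biUnion_inter]
      refine card_biUnion_le.trans ?_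
      simp only [id]
      rw [sum_const_nat (m := s) (fun Q hQ => (hTQ Q hQ).2), hTc, mul_comm]
    have hA' : w ≤ (A \ X).card := by
      have h3 := card_sdiff_add_card_inter A X
      rw [inter_comm] at h3
      have h3' : ((A \ X).card : ℝ) + (X ∩ A).card = A.card := by exact_mod_cast h3
      have h4 : ((X ∩ A).card : ℝ) ≤ k * t := by exact_mod_cast hXA
      nlinarith [(by positivity : (0:ℝ) ≤ k)]
    have hdeg : ∀ a ∈ A \ X, x / 2 ≤ (nbh G a (U \ X)).card := by
      intro a ha
      have h3 := hx a (mem_sdiff.1 ha).1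
      have h4 : nbh G a U ⊆ nbh G a (U \ X) ∪ (X ∩ U) := by
        intro v hv
        simp only [nbh, mem_filter, mem_union, mem_sdiff, mem_inter] at hv ⊢
        tauto
      have h5 := (card_le_card h4).trans (card_union_le _ _)
      have h6 : ((nbh G a U).card : ℝ) ≤ (nbh G a (U \ X)).card + s * t := by
        exact_mod_cast h5.trans (by omega)
      nlinarith [(by positivity : (0:ℝ) ≤ s)]
    have hx0 : 0 ≤ x / 2 := le_trans (by positivity) h2
    obtain ⟨K, L, hKA, hLU, hK, hL, hKL, hcl⟩ := hT1 (A \ X) (U \ X) (by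
      rw [eG_sum]
      push_cast
      calc d * (n : ℝ) ^ 2 ≤ w * (x / 2) := hd
        _ ≤ (A \ X).card * (x / 2) := by gcongr
        _ = ∑ a ∈ A \ X, (x / 2) := by rw [sum_const, nsmul_eq_mul]
        _ ≤ _ := sum_le_sum hdeg)
    have hKA2 : K ⊆ A := hKA.trans sdiff_subset
    have hLU2 : L ⊆ U := hLU.trans sdiff_subset
    have hdisj : ∀ Q ∈ T, Disjoint Q (K ∪ L) := by
      intro Q hQ
      rw [disjoint_left]
      intro v hv hv'
      have hvX : v ∈ X := mem_biUnion.2 ⟨Q, hQ, hv⟩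
      rcases mem_union.1 hv' with h | h
      · exact (mem_sdiff.1 (hKA h)).2 hvX
      · exact (mem_sdiff.1 (hLU h)).2 hvX
    obtain ⟨h7, h8⟩ := Til_union (W' := A ∪ U) (T' := {K ∪ L}) (by omega) hT (by
      refine ⟨?_, ?_⟩
      · intro Q hQ
        rw [mem_singleton] at hQ; subst hQ
        exact ⟨hcl, union_subset_union hKA2 hLU2⟩
      · intro Q hQ Q' hQ' hne
        rw [mem_singleton] at hQ hQ'; subst hQ; subst hQ'; exact absurd rfl hne) (by
      intro Q hQ Q' hQ'
      rw [mem_singleton] at hQ'; subst hQ'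
      exact hdisj Q hQ)
    rw [union_self] at h7
    refine ⟨_, ?_, h7, ?_⟩
    · rw [h8, hTc, card_singleton]
    · intro Q hQ
      rcases mem_union.1 hQ with hQ | hQ
      · exact hTQ Q hQ
      · rw [mem_singleton] at hQ; subst hQ
        have e1 : (K ∪ L) ∩ A = K := by
          ext v; simp only [mem_inter, mem_union]
          constructor
          · rintro ⟨h | h, h'⟩
            · exact h
            · exact absurd (hLU2 h) (disjoint_left.1 hAU h')
          · intro h; exact ⟨Or.inl h, hKA2 h⟩
        have e2 : (K ∪ L) ∩ U = L := by
          ext v; simp only [mem_inter, mem_union]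
          constructor
          · rintro ⟨h | h, h'⟩
            · exact absurd h' (disjoint_left.1 hAU (hKA2 h))
            · exact h
          · intro h; exact ⟨Or.inr h, hLU2 h⟩
        rw [e1, e2]; exact ⟨hK, hL⟩

/-- greedy tiling inside a dense set -/
lemma greedyY {n : ℕ} {Γ G : SimpleGraph (Fin n)} {k s : ℕ} {d : ℝ} (hk : 1 ≤ k) (hT1 : T1 Γ G k s d)
    (Y : Finset (Fin n)) : ∀ t : ℕ, d * (n : ℝ) ^ 2 + 2 * n * ((k + s) * t) ≤ eG G Y Y →
      ∃ T : Finset (Finset (Fin n)), T.card = t ∧ Til Γ (k + s) T Y := by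
  intro t
  induction t with
  | zero => intro _; exact ⟨∅, by simp, by simp [Til]⟩
  | succ t ih =>
    intro h1
    push_cast at h1
    have hn0 : (0:ℝ) ≤ 2 * n * (k + s) := by positivity
    obtain ⟨T, hTc, hT⟩ := ih (by nlinarith)
    set X := T.biUnion id with hX
    have hXc : X.card = (k + s) * t := by rw [hX, Til_card hT, hTc]
    have h3 := eG_sdiff G Y X
    have h3' : (eG G Y Y : ℝ) ≤ eG G (Y \ X) (Y \ X) + 2 * n * ((k + s) * t) := by
      rw [hXc] at h3; exact_mod_cast h3
    obtain ⟨K, L, hKA, hLU, hK, hL, hKL, hcl⟩ := hT1 (Y \ X) (Y \ X) (by nlinarith)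
    have hdisj : ∀ Q ∈ T, Disjoint Q (K ∪ L) := by
      intro Q hQ
      rw [disjoint_left]
      intro v hv hv'
      have hvX : v ∈ X := mem_biUnion.2 ⟨Q, hQ, hv⟩
      rcases mem_union.1 hv' with h | h
      · exact (mem_sdiff.1 (hKA h)).2 hvX
      · exact (mem_sdiff.1 (hLU h)).2 hvX
    obtain ⟨h7, h8⟩ := Til_union (W' := Y) (T' := {K ∪ L}) (by omega) hT (by
      refine ⟨?_, ?_⟩
      · intro Q hQ
        rw [mem_singleton] at hQ; subst hQ
        exact ⟨hcl, union_subset (hKA.trans sdiff_subset) (hLU.trans sdiff_subset)⟩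
      · intro Q hQ Q' hQ' hne
        rw [mem_singleton] at hQ hQ'; subst hQ; subst hQ'; exact absurd rfl hne) (by
      intro Q hQ Q' hQ'
      rw [mem_singleton] at hQ'; subst hQ'
      exact hdisj Q hQ)
    rw [union_self] at h7
    refine ⟨_, ?_, h7⟩
    rw [h8, hTc, card_singleton]

open Finset
open scoped Classical

lemma Til_mono {n : ℕ} {Γ : SimpleGraph (Fin n)} {r : ℕ} {T : Finset (Finset (Fin n))} {W W' : Finset (Fin n)}
    (h : Til Γ r T W) (hW : W ⊆ W') : Til Γ r T W' :=
  ⟨fun Q hQ => ⟨(h.1 Q hQ).1, (h.1 Q hQ).2.trans hW⟩, h.2⟩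

/-- joined vertices of `Q` -/
noncomputable def jn {n : ℕ} (G : SimpleGraph (Fin n)) (U : Finset (Fin n)) (x : ℝ) (Q : Finset (Fin n)) : Finset (Fin n) :=
  Q.filter (fun v => x ≤ (nbh G v U).card)

lemma tile_step1 {n : ℕ} {Γ G : SimpleGraph (Fin n)} {k s : ℕ} {d : ℝ} (hk : 1 ≤ k) (hT1 : T1 Γ G k s d)
    (R : Finset (Fin n)) (T : Finset (Finset (Fin n))) (hT : Til Γ (k + s) T R)
    (hex : ∀ B ⊆ T, ∀ T' : Finset (Finset (Fin n)),
      Til Γ (k + s) T' ((R \ T.biUnion id) ∪ B.biUnion id) → T'.card ≤ B.card)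
    (x w : ℝ) (m : ℕ) (hw : 0 ≤ w) (hm : w + k ≤ m) (hs : (s : ℝ) * (m + 1) ≤ x / 2)
    (hd : d * (n : ℝ) ^ 2 ≤ w * (x / 2)) :
    (T.filter (fun Q => k + 1 ≤ (jn G (R \ T.biUnion id) x Q).card)).card < m := by
  by_contra hcon
  push Not at hcon
  set U := R \ T.biUnion id with hU
  obtain ⟨B, hBs, hBc⟩ := exists_subset_card_eq hcon
  have h1 : ∀ Q ∈ B, ∃ f ⊆ jn G U x Q, f.card = k + 1 := by
    intro Q hQ
    exact exists_subset_card_eq (mem_filter.1 (hBs hQ)).2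
  choose! f hf1 hf2 using h1
  have hBT : B ⊆ T := hBs.trans (filter_subset _ _)
  have hfQ : ∀ Q ∈ B, f Q ⊆ Q := fun Q hQ => (hf1 Q hQ).trans (filter_subset _ _)
  set A := B.biUnion f with hA
  have hAc : A.card = (k + 1) * m := by
    rw [hA, card_biUnion, sum_const_nat (m := k + 1) hf2, hBc, mul_comm]
    intro Q hQ Q' hQ' hne
    exact Disjoint.mono (hfQ Q hQ) (hfQ Q' hQ') (hT.2 Q (hBT hQ) Q' (hBT hQ') hne)
  have hAB : A ⊆ B.biUnion id := by
    intro v hv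
    obtain ⟨Q, hQ, hv⟩ := mem_biUnion.1 hv
    exact mem_biUnion.2 ⟨Q, hQ, hfQ Q hQ hv⟩
  have hAU : Disjoint A U := by
    rw [disjoint_left]
    intro v hv hvU
    obtain ⟨Q, hQ, hv⟩ := mem_biUnion.1 hv
    exact (mem_sdiff.1 hvU).2 (mem_biUnion.2 ⟨Q, hBT hQ, hfQ Q hQ hv⟩)
  obtain ⟨T', hT'c, hT', _⟩ := greedyT hk hT1 A U hAU x w (by
    intro a ha
    obtain ⟨Q, hQ, hv⟩ := mem_biUnion.1 ha
    exact (mem_filter.1 (hf1 Q hQ hv)).2) hw hd (m + 1) (by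
      rw [hAc]; push_cast; nlinarith) (by push_cast; exact hs)
  have := hex B hBT T' (Til_mono hT' (by
    rw [union_comm]; exact union_subset_union_right hAB))
  omega

lemma tile_step3 {n : ℕ} {Γ G : SimpleGraph (Fin n)} {k s : ℕ}
    (hdeg : ∀ v, k * n ≤ (k + s) * (nbh G v univ).card)
    (R : Finset (Fin n)) (T : Finset (Finset (Fin n))) (hT : Til Γ (k + s) T R)
    (x : ℝ) (hx : 0 ≤ x) :
    let U := R \ T.biUnion id
    (k : ℝ) * n * U.card ≤ (k + s) * (eG G U U + (univ \ R).card * U.card + n * x +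
      (k * T.card - (T.filter (fun Q => (jn G U x Q).card < k)).card
        + (k + s) * (T.filter (fun Q => k + 1 ≤ (jn G U x Q).card)).card) * U.card) := by
  intro U
  have h1 : (k : ℝ) * n * U.card ≤ (k + s) * eG G univ U := by
    rw [eG_comm, eG_sum]
    push_cast
    rw [mul_sum]
    have : ∑ v ∈ U, ((k:ℝ) * n) ≤ ∑ v ∈ U, ((k:ℝ) + s) * (nbh G v univ).card :=
      sum_le_sum (fun v _ => by exact_mod_cast hdeg v)
    rw [sum_const, nsmul_eq_mul] at this
    linarith
  refine h1.trans ?_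
  apply mul_le_mul_of_nonneg_left _ (by positivity)
  have hTR : T.biUnion id ⊆ R := by
    intro v hv
    obtain ⟨Q, hQ, hv⟩ := mem_biUnion.1 hv
    exact (hT.1 Q hQ).2 hv
  have hsplit : (univ : Finset (Fin n)) = (univ \ R) ∪ (U ∪ T.biUnion id) := by
    ext v; simp only [mem_univ, mem_union, mem_sdiff, U, true_and, true_iff]
    by_cases h : v ∈ R <;> by_cases h' : v ∈ T.biUnion id <;> simp [h, h']
  have hd1 : Disjoint (univ \ R) (U ∪ T.biUnion id) := by
    rw [disjoint_left]; intro v hv hv'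
    rw [mem_sdiff] at hv
    rcases mem_union.1 hv' with h | h
    · exact hv.2 (mem_sdiff.1 h).1
    · exact hv.2 (hTR h)
  have hd2 : Disjoint U (T.biUnion id) := sdiff_disjoint
  have e1 : (eG G univ U : ℝ) = ∑ v ∈ univ \ R, ((nbh G v U).card : ℝ) + (eG G U U + ∑ Q ∈ T, ∑ v ∈ Q, ((nbh G v U).card : ℝ)) := by
    rw [eG_sum, eG_sum]
    push_cast
    conv_lhs => rw [hsplit]
    rw [sum_union hd1, sum_union hd2, sum_biUnion (t := id) (fun Q hQ Q' hQ' hne => hT.2 Q hQ Q' hQ' hne)]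
    rfl
  have e2 : ∑ v ∈ univ \ R, ((nbh G v U).card : ℝ) ≤ (univ \ R).card * U.card := by
    have : ∑ v ∈ univ \ R, ((nbh G v U).card : ℝ) ≤ ∑ v ∈ univ \ R, (U.card : ℝ) :=
      sum_le_sum (fun v _ => by exact_mod_cast nbh_card_le G v U)
    rw [sum_const, nsmul_eq_mul] at this
    exact this
  have e3 : ∀ Q ∈ T, ∑ v ∈ Q, ((nbh G v U).card : ℝ) ≤ (k + s) * x + (k - (if (jn G U x Q).card < k then 1 else 0)
      + (k + s) * (if k + 1 ≤ (jn G U x Q).card then 1 else 0)) * U.card := by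
    intro Q hQ
    have hQc : Q.card = k + s := (hT.1 Q hQ).1.card_eq
    have h2 : ∑ v ∈ Q, ((nbh G v U).card : ℝ) ≤ ∑ v ∈ Q, (x + if x ≤ (nbh G v U).card then (U.card : ℝ) else 0) := by
      apply sum_le_sum
      intro v _
      split_ifs with h
      · have : ((nbh G v U).card : ℝ) ≤ U.card := by exact_mod_cast nbh_card_le G v U
        linarith
      · push Not at h; linarith
    rw [sum_add_distrib, sum_const, nsmul_eq_mul, hQc, ← sum_filter, sum_const, nsmul_eq_mul] at h2
    rw [Nat.cast_add] at h2
    refine h2.trans ?_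
    refine add_le_add le_rfl (mul_le_mul_of_nonneg_right ?_ (Nat.cast_nonneg _))
    change ((jn G U x Q).card : ℝ) ≤ _
    have h3 : (jn G U x Q).card ≤ k + s := hQc ▸ card_filter_le _ _
    split_ifs with ha hb hb
    · omega
    · have : ((jn G U x Q).card : ℝ) + 1 ≤ k := by exact_mod_cast ha
      linarith
    · have : ((jn G U x Q).card : ℝ) ≤ k + s := by exact_mod_cast h3
      have hk0 : (0:ℝ) ≤ k := by positivity
      linarith
    · have : ((jn G U x Q).card : ℝ) ≤ k := by exact_mod_cast (by omega : (jn G U x Q).card ≤ k)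
      linarith
  have e4 := sum_le_sum e3
  have hTc : ((k:ℝ) + s) * T.card ≤ n := by
    have := Til_card hT
    have h5 : (T.biUnion id).card ≤ n := by simpa using card_le_univ (T.biUnion id)
    rw [this] at h5
    exact_mod_cast h5
  have e5 : ∑ Q ∈ T, (((k:ℝ) + s) * x + (k - (if (jn G U x Q).card < k then 1 else 0)
      + (k + s) * (if k + 1 ≤ (jn G U x Q).card then 1 else 0)) * U.card) = 
      (k + s) * T.card * x + (k * T.card - (T.filter (fun Q => (jn G U x Q).card < k)).card
        + (k + s) * (T.filter (fun Q => k + 1 ≤ (jn G U x Q).card)).card) * U.card := by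
    rw [sum_add_distrib, sum_const, ← sum_mul, sum_add_distrib, sum_sub_distrib, sum_const, ← mul_sum, card_filter, card_filter]
    push_cast
    simp only [nsmul_eq_mul]
    ring
  rw [e5] at e4
  have e6 : ((k:ℝ) + s) * T.card * x ≤ n * x := mul_le_mul_of_nonneg_right hTc hx
  rw [e1]
  linarith

lemma tile_step4 {n : ℕ} {Γ G : SimpleGraph (Fin n)} {k s : ℕ} {d : ℝ} (hk : 1 ≤ k) (hT1 : T1 Γ G k s d)
    (R : Finset (Fin n)) (T : Finset (Finset (Fin n))) (hT : Til Γ (k + s) T R)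
    (hex : ∀ B ⊆ T, ∀ T' : Finset (Finset (Fin n)),
      Til Γ (k + s) T' ((R \ T.biUnion id) ∪ B.biUnion id) → T'.card ≤ B.card)
    (x w : ℝ) (m : ℕ) (hw : 0 ≤ w) (hm : w + 1 ≤ m)
    (hs1 : ((k:ℝ) + s) * m ≤ x / 2) (hs2 : (s:ℝ) * ((k + s) * m) ≤ x / 4)
    (hd : d * (n : ℝ) ^ 2 ≤ w * (x / 4)) (Y : Finset (Fin n))
    (hY : Y ⊆ (R \ T.biUnion id) ∪ ((T.filter (fun Q => (jn G (R \ T.biUnion id) x Q).card = k)).biUnion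
      (fun Q => Q \ jn G (R \ T.biUnion id) x Q)))
    (hYe : d * (n : ℝ) ^ 2 + 2 * n * ((k + s) * m) ≤ eG G Y Y) : False := by
  set U := R \ T.biUnion id with hU
  set J := jn G U x with hJ
  obtain ⟨W, hWc, hW⟩ := greedyY hk hT1 Y m hYe
  set X := W.biUnion id with hX
  have hXc : X.card = (k + s) * m := by rw [hX, Til_card hW, hWc]
  have hXY : X ⊆ Y := by
    intro v hv
    obtain ⟨Q, hQ, hv⟩ := mem_biUnion.1 hv
    exact (hW.1 Q hQ).2 hv
  set E := T.filter (fun Q => (J Q).card = k) with hE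
  set B := E.filter (fun Q => ¬ Disjoint Q X) with hB
  have hBE : B ⊆ E := filter_subset _ _
  have hBT : B ⊆ T := hBE.trans (filter_subset _ _)
  have hJQ : ∀ Q, J Q ⊆ Q := fun Q => filter_subset _ _
  have hBc : B.card ≤ (k + s) * m := by
    rw [← hXc]
    have h1 : ∀ Q ∈ B, ∃ v ∈ X, v ∈ Q := by
      intro Q hQ
      obtain ⟨v, hv, hv'⟩ := not_disjoint_iff.1 (mem_filter.1 hQ).2
      exact ⟨v, hv', hv⟩
    rcases B.eq_empty_or_nonempty with h0 | ⟨Q0, hQ0⟩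
    · rw [h0]; simp
    haveI : Nonempty (Fin n) := ⟨(h1 Q0 hQ0).choose⟩
    choose! g hg1 hg2 using h1
    apply card_le_card_of_injOn g (fun Q hQ => hg1 Q hQ)
    intro Q hQ Q' hQ' hgg
    by_contra hne
    exact disjoint_left.1 (hT.2 Q (hBT hQ) Q' (hBT hQ') hne) (hg2 Q hQ) (hgg ▸ hg2 Q' hQ')
  set A := B.biUnion J with hA
  have hAc : A.card = k * B.card := by
    rw [hA, card_biUnion, sum_const_nat (m := k) (fun Q hQ => (mem_filter.1 (hBE hQ)).2), mul_comm]
    intro Q hQ Q' hQ' hne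
    exact Disjoint.mono (hJQ Q) (hJQ Q') (hT.2 Q (hBT hQ) Q' (hBT hQ') hne)
  have hAT : ∀ v ∈ A, v ∉ U := by
    intro v hv hvU
    obtain ⟨Q, hQ, hv⟩ := mem_biUnion.1 hv
    exact (mem_sdiff.1 hvU).2 (mem_biUnion.2 ⟨Q, hBT hQ, hJQ Q hv⟩)
  have hAX : Disjoint A X := by
    rw [disjoint_left]
    intro v hv hvX
    rcases mem_union.1 (hY (hXY hvX)) with h | h
    · exact hAT v hv h
    · obtain ⟨Q, hQ, hvQ⟩ := mem_biUnion.1 h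
      obtain ⟨Q', hQ', hvQ'⟩ := mem_biUnion.1 hv
      by_cases hne : Q = Q'
      · subst hne; exact (mem_sdiff.1 hvQ).2 hvQ'
      · exact disjoint_left.1 (hT.2 Q (mem_filter.1 hQ).1 Q' (hBT hQ') hne) (mem_sdiff.1 hvQ).1 (hJQ Q' hvQ')
  have hAB : A ⊆ B.biUnion id := by
    intro v hv
    obtain ⟨Q, hQ, hv⟩ := mem_biUnion.1 hv
    exact mem_biUnion.2 ⟨Q, hQ, hJQ Q hv⟩
  have hXB : X ⊆ U ∪ B.biUnion id := by
    intro v hv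
    rcases mem_union.1 (hY (hXY hv)) with h | h
    · exact mem_union_left _ h
    · obtain ⟨Q, hQ, hvQ⟩ := mem_biUnion.1 h
      refine mem_union_right _ (mem_biUnion.2 ⟨Q, ?_, (mem_sdiff.1 hvQ).1⟩)
      exact mem_filter.2 ⟨hQ, not_disjoint_iff.2 ⟨v, (mem_sdiff.1 hvQ).1, hv⟩⟩
  have hWU : Til Γ (k + s) W (U ∪ B.biUnion id) := by
    refine ⟨fun Q hQ => ⟨(hW.1 Q hQ).1, ?_⟩, hW.2⟩
    exact (subset_biUnion_of_mem id hQ).trans hXB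
  set c := ⌈w⌉₊ with hc
  have hcw : w ≤ c := Nat.le_ceil w
  have hcm : c + 1 ≤ m := by
    have : c ≤ m - 1 := by
      apply Nat.ceil_le.2
      have : 1 ≤ m := by
        have h1 : (1:ℝ) ≤ m := by linarith
        exact_mod_cast h1
      push_cast [this]
      linarith
    have h1 : (1:ℝ) ≤ m := by linarith
    have h2 : 1 ≤ m := by exact_mod_cast h1
    omega
  have hBc' : (B.card : ℝ) ≤ (k + s) * m := by exact_mod_cast hBc
  by_cases hcb : B.card < c
  · have := hex B hBT W hWU
    omega
  push Not at hcb
  obtain ⟨T', hT'c, hT', _⟩ := greedyT hk hT1 A (U \ X) (by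
      rw [disjoint_left]; intro v hv hv'
      exact hAT v hv (mem_sdiff.1 hv').1) (x / 2) w (by
    intro a ha
    obtain ⟨Q, hQ, hv⟩ := mem_biUnion.1 ha
    have h3 := (mem_filter.1 hv).2
    have h4 : nbh G a U ⊆ nbh G a (U \ X) ∪ X := by
        intro v hv
        simp only [nbh, mem_filter, mem_union, mem_sdiff] at hv ⊢
        tauto
    have h5 := (card_le_card h4).trans (card_union_le _ _)
    rw [hXc] at h5
    have h6 : ((nbh G a U).card : ℝ) ≤ (nbh G a (U \ X)).card + (k + s) * m := by
        exact_mod_cast h5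
    linarith) hw (by linarith) (B.card - c) (by
      rw [hAc]
      push_cast [hcb]
      have hk1 : (1:ℝ) ≤ k := by exact_mod_cast hk
      nlinarith) (by
      push_cast [hcb]
      have : (s:ℝ) * (B.card - c) ≤ s * ((k + s) * m) := by
        apply mul_le_mul_of_nonneg_left _ (by positivity)
        have : (0:ℝ) ≤ c := by positivity
        linarith
      linarith)
  obtain ⟨h7, h8⟩ := Til_union (by omega) hWU (Til_mono hT' (W' := U ∪ B.biUnion id) (by
    intro v hv
    rcases mem_union.1 hv with h | h
    · exact mem_union_right _ (hAB h)
    · exact mem_union_left _ (mem_sdiff.1 h).1)) (by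
    intro Q hQ Q' hQ'
    refine Disjoint.mono (subset_biUnion_of_mem id hQ) (hT'.1 Q' hQ').2 ?_
    change Disjoint X _
    rw [disjoint_union_right]
    exact ⟨hAX.symm, disjoint_sdiff⟩)
  rw [union_self] at h7
  have := hex B hBT _ h7
  rw [h8, hWc, hT'c] at this
  omega

open Finset
open scoped Classical

set_option maxHeartbeats 1600000 in
theorem almost_tiling {k s : ℕ} (hk : 1 ≤ k) (hs : 1 ≤ s) (γ ξ ε : ℝ) (hξ : 0 < ξ) (hξ1 : ξ ≤ 1)
    (hξγ : 16 * s * ξ ≤ γ) (hε : 0 < ε) (hε1 : ε ≤ 1) :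
    ∃ d : ℝ, 0 < d ∧ ∃ n₀ : ℕ, ∀ n, n₀ ≤ n → (k + s) ∣ n → ∀ G Γ : SimpleGraph (Fin n),
      (∀ v, k * n ≤ (k + s) * (nbh G v univ).card) →
      (∀ Y : Finset (Fin n), (k + s) * Y.card = s * n → γ * (n:ℝ) ^ 2 ≤ eG G Y Y) →
      T1 Γ G k s d → ∀ R : Finset (Fin n), ((univ \ R).card : ℝ) ≤ ξ * n →
        ∃ U ⊆ R, (U.card : ℝ) ≤ ε * n ∧ TL Γ (k + s) (R \ U) := by
  obtain ⟨ρ, hρ⟩ : ∃ ρ : ℝ, ρ = (k:ℝ) + s := ⟨_, rfl⟩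
  have hk1 : (1:ℝ) ≤ k := by exact_mod_cast hk
  have hs1 : (1:ℝ) ≤ s := by exact_mod_cast hs
  have hρ1 : 1 ≤ ρ := by linarith
  obtain ⟨ω, hω⟩ : ∃ ω : ℝ, ω = ξ * ε / (200 * ρ ^ 2) := ⟨_, rfl⟩
  have hω0 : 0 < ω := by rw [hω]; positivity
  have hωρ : ρ ^ 2 * ω = ξ * ε / 200 := by rw [hω]; field_simp
  have hρ2 : 1 ≤ ρ ^ 2 := by nlinarith
  have hξε : ξ * ε ≤ 1 := by nlinarith
  have hω1 : ω ≤ 1 := by nlinarith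
  refine ⟨ω * (ξ * ε) / 64, by positivity, ⌈((k:ℝ) + 4) / ω⌉₊ + 1, ?_⟩
  intro n hn hdvd G Γ hdeg hedge hT1 R hR
  have hn1 : (k + 4) / ω ≤ n := by
    have h1 := Nat.le_ceil (((k:ℝ) + 4) / ω)
    have h2 : ((⌈((k:ℝ) + 4) / ω⌉₊ : ℕ) : ℝ) ≤ n := Nat.cast_le.2 (by omega)
    linarith
  have hnω : k + 4 ≤ ω * n := by rw [div_le_iff₀ hω0] at hn1; linarith
  have hn0 : (0:ℝ) < n := by
    have : 1 ≤ n := by omega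
    exact_mod_cast this
  obtain ⟨T, hT, hex⟩ := exch Γ (k + s) (by omega) R
  set U := R \ T.biUnion id with hU
  have hTR : T.biUnion id ⊆ R := by
    intro v hv
    obtain ⟨Q, hQ, hv⟩ := mem_biUnion.1 hv
    exact (hT.1 Q hQ).2 hv
  refine ⟨U, sdiff_subset, ?_, ?_⟩
  swap
  · rw [hU, sdiff_sdiff_right_self]
    refine ⟨T, fun Q hQ => (hT.1 Q hQ).1, hT.2, ?_⟩
    exact (inter_eq_right.2 hTR).symm
  by_contra hcon
  push Not at hcon
  obtain ⟨u, hu⟩ : ∃ u : ℝ, u = U.card := ⟨_, rfl⟩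
  rw [← hu] at hcon
  have hu0 : 0 < u := by
    have : 0 < ε * n := by positivity
    linarith
  obtain ⟨x, hx⟩ : ∃ x : ℝ, x = ξ * u / 8 := ⟨_, rfl⟩
  obtain ⟨w, hw⟩ : ∃ w : ℝ, w = ω * n := ⟨_, rfl⟩
  have hw0 : 0 < w := by rw [hw]; positivity
  have hx0 : 0 < x := by rw [hx]; positivity
  obtain ⟨m, hm⟩ : ∃ m : ℕ, m = ⌈w⌉₊ + k + 1 := ⟨_, rfl⟩
  have hm1 : w + k + 1 ≤ m := by
    have := Nat.le_ceil w
    rw [hm]; push_cast; linarith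
  have hm2 : (m : ℝ) + 1 ≤ 2 * (ω * n) := by
    have := Nat.ceil_lt_add_one hw0.le
    rw [hm]; push_cast
    rw [hw] at this ⊢
    linarith
  have hF : ρ ^ 2 * (m + 1) ≤ ξ * (ε * n) / 100 := by
    have h1 : ρ ^ 2 * ((m:ℝ) + 1) ≤ ρ ^ 2 * (2 * (ω * n)) := by gcongr
    have h2 : ρ ^ 2 * (2 * (ω * n)) = 2 * n * (ρ ^ 2 * ω) := by ring
    rw [h2, hωρ] at h1
    linarith
  have hF1 : ρ ^ 2 * (m + 1) ≤ ξ * u / 100 := by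
    have : ξ * (ε * n) ≤ ξ * u := by gcongr
    linarith
  have hF2 : ρ ^ 2 * (m + 1) ≤ ξ * n / 100 := by
    have : ξ * (ε * n) ≤ ξ * n := by
      apply mul_le_mul_of_nonneg_left _ hξ.le
      exact mul_le_of_le_one_left hn0.le hε1
    linarith
  have hm0 : (0:ℝ) ≤ m := by positivity
  have hρρ : ρ ≤ ρ ^ 2 := le_self_pow₀ hρ1 (by norm_num)
  have hρm : ρ * m ≤ ρ ^ 2 * (m + 1) := mul_le_mul hρρ (by linarith) hm0 (by positivity)
  have hsρ : (s:ℝ) ≤ ρ := by linarith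
  have hxu : 0 ≤ ξ * u := by positivity
  have hdn : ω * (ξ * ε) / 64 * (n:ℝ) ^ 2 ≤ w * (x / 4) := by
    rw [hw, hx]
    have : ω * n * (ξ * (ε * n)) ≤ ω * n * (ξ * u) := by gcongr
    have h1 : 0 ≤ ω * n * (ξ * u) := by positivity
    have h2 : ω * (ξ * ε) / 64 * (n:ℝ) ^ 2 = ω * n * (ξ * (ε * n)) / 64 := by ring
    linarith
  have hdn2 : w * (x / 4) ≤ w * (x / 2) := mul_le_mul_of_nonneg_left (by linarith) hw0.le
  have hc := tile_step1 hk hT1 R T hT hex x w m hw0.le (by linarith) (by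
    rw [hx]
    have : (s:ℝ) * (m + 1) ≤ ρ ^ 2 * (m + 1) := by
      apply mul_le_mul_of_nonneg_right _ (by positivity); linarith
    linarith) (hdn.trans hdn2)
  have h3 := tile_step3 hdeg R T hT x hx0.le
  simp only at h3
  rw [← hU] at hc h3
  rw [← hu] at h3
  set cc := (T.filter (fun Q => k + 1 ≤ (jn G U x Q).card)) with hcc
  set aa := (T.filter (fun Q => (jn G U x Q).card < k)) with haa
  set bb := (T.filter (fun Q => (jn G U x Q).card = k)) with hbb
  have habc : T.card = aa.card + bb.card + cc.card := by
    rw [haa, hbb, hcc]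
    have e1 := card_filter_add_card_filter_not (s := T) (fun Q => (jn G U x Q).card < k)
    have e2 := card_filter_add_card_filter_not (s := T.filter (fun Q => ¬ (jn G U x Q).card < k)) (fun Q => (jn G U x Q).card = k)
    rw [filter_filter, filter_filter] at e2
    have e3 : T.filter (fun Q => ¬ (jn G U x Q).card < k ∧ (jn G U x Q).card = k) = T.filter (fun Q => (jn G U x Q).card = k) := by
      apply filter_congr; intro Q _; constructor
      · exact fun h => h.2
      · intro h; exact ⟨by omega, h⟩
    have e4 : T.filter (fun Q => ¬ (jn G U x Q).card < k ∧ ¬ (jn G U x Q).card = k) = T.filter (fun Q => k + 1 ≤ (jn G U x Q).card) := by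
      apply filter_congr; intro Q _; constructor
      · intro h; omega
      · intro h; omega
    rw [e3, e4] at e2
    omega
  have hUU : (eG G U U : ℝ) < ω * (ξ * ε) / 64 * (n:ℝ) ^ 2 := by
    by_contra hh
    push Not at hh
    obtain ⟨K, L, hKA, hLU, _, _, _, hcl⟩ := hT1 U U hh
    have := hex ∅ (by simp) {K ∪ L} ⟨by
      intro Q hQ
      rw [mem_singleton] at hQ; subst hQ
      exact ⟨hcl, (union_subset hKA hLU).trans subset_union_left⟩, by
      intro Q hQ Q' hQ' hne
      rw [mem_singleton] at hQ hQ'; subst hQ; subst hQ'; exact absurd rfl hne⟩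
    simp at this
  have hUU2 : (eG G U U : ℝ) ≤ ξ * n / 64 * u := by
    refine hUU.le.trans ?_
    have h1 : (ξ * n) * (ε * n) ≤ (ξ * n) * u := by gcongr
    have h2 : ω * ((ξ * n) * (ε * n)) ≤ 1 * ((ξ * n) * (ε * n)) := by gcongr
    have h3 : ω * (ξ * ε) / 64 * (n:ℝ) ^ 2 = ω * ((ξ * n) * (ε * n)) / 64 := by ring
    linarith
  have hTcN := Til_card hT
  have hTn : ρ * T.card ≤ n := by
    have h5 : (T.biUnion id).card ≤ n := by simpa using card_le_univ (T.biUnion id)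
    rw [hTcN] at h5
    rw [hρ]; exact_mod_cast h5
  have hccm : (cc.card : ℝ) ≤ m := by exact_mod_cast hc.le
  rw [← hρ] at h3
  have ha : (aa.card : ℝ) ≤ 2 * ξ * n := by
    have hρcc : ρ * cc.card ≤ ξ * n / 100 := by
      have : ρ * cc.card ≤ ρ * m := by gcongr
      linarith
    have h5 : (eG G U U : ℝ) + (univ \ R).card * u + n * x + (k * T.card - aa.card + ρ * cc.card) * u
        ≤ (ξ * n / 64 + ξ * n + ξ * n / 8 + (k * T.card - aa.card + ξ * n / 100)) * u := by
      have h6 : ((univ \ R).card : ℝ) * u ≤ ξ * n * u := by gcongr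
      have h7 : (k * T.card - aa.card + ρ * cc.card) * u ≤ (k * T.card - aa.card + ξ * n / 100) * u := by gcongr
      rw [hx]
      linarith
    have h8 := h3.trans (mul_le_mul_of_nonneg_left h5 (by linarith))
    have h9 : (k:ℝ) * n ≤ ρ * (ξ * n / 64 + ξ * n + ξ * n / 8 + (k * T.card - aa.card + ξ * n / 100)) := by
      have : (k:ℝ) * n * u ≤ (ρ * (ξ * n / 64 + ξ * n + ξ * n / 8 + (k * T.card - aa.card + ξ * n / 100))) * u := by linarith
      exact le_of_mul_le_mul_right this hu0
    have h10 : (k:ℝ) * (ρ * T.card) ≤ k * n := by gcongr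
    have h11 : 0 ≤ ρ * (ξ * n / 64 + ξ * n + ξ * n / 8 - aa.card + ξ * n / 100) := by linarith
    have h12 := nonneg_of_mul_nonneg_right h11 (by linarith : 0 < ρ)
    have : 0 < ξ * n := by positivity
    linarith
  -- the set Y
  set Y := U ∪ bb.biUnion (fun Q => Q \ jn G U x Q) with hY
  have hYc : Y.card = U.card + s * bb.card := by
    rw [hY, card_union_of_disjoint, card_biUnion, sum_const_nat (m := s), mul_comm]
    · intro Q hQ
      rw [card_sdiff_of_subset (show jn G U x Q ⊆ Q from filter_subset _ _), (mem_filter.1 hQ).2]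
      rw [(hT.1 Q (mem_filter.1 hQ).1).1.card_eq]; omega
    · intro Q hQ Q' hQ' hne
      exact Disjoint.mono sdiff_subset sdiff_subset (hT.2 Q (mem_filter.1 hQ).1 Q' (mem_filter.1 hQ').1 hne)
    · rw [disjoint_left]
      intro v hv hv'
      obtain ⟨Q, hQ, hvQ⟩ := mem_biUnion.1 hv'
      exact (mem_sdiff.1 hv).2 (mem_biUnion.2 ⟨Q, (mem_filter.1 hQ).1, (mem_sdiff.1 hvQ).1⟩)
  have hRc : u + ρ * T.card = R.card := by
    have h1 := card_sdiff_add_card_eq_card hTR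
    rw [hTcN] at h1
    rw [hu, hρ, hU]; exact_mod_cast h1
  have hRn : (n:ℝ) - ξ * n ≤ R.card := by
    have h1 := card_sdiff_add_card_eq_card (subset_univ R)
    rw [card_univ, Fintype.card_fin] at h1
    have : ((univ \ R).card : ℝ) + R.card = n := by exact_mod_cast h1
    linarith
  obtain ⟨q, hq⟩ := hdvd
  have hnq : (n:ℝ) = ρ * q := by rw [hρ, hq]; push_cast; ring
  have hYlow : (s:ℝ) * q - 31 / 10 * s * ξ * n ≤ Y.card := by
    have h1 : (Y.card : ℝ) = u + s * bb.card := by rw [hYc, hu]; push_cast; ring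
    have h2 : (T.card : ℝ) = aa.card + bb.card + cc.card := by rw [habc]; push_cast; ring
    have h3 : ρ * (s * q - 31 / 10 * s * ξ * n) ≤ ρ * (u + s * bb.card) := by
      have h4 : (s:ℝ) * u ≤ ρ * u := by gcongr
      have h5 : (s:ℝ) * (ρ * aa.card) ≤ s * (ρ * (2 * ξ * n)) := by gcongr
      have h6 : (cc.card : ℝ) ≤ ξ * n / 100 := by
        have : 1 * ((m:ℝ) + 1) ≤ ρ ^ 2 * (m + 1) := by gcongr
        linarith
      have h7 : (s:ℝ) * (ρ * cc.card) ≤ s * (ρ * (ξ * n / 100)) := by gcongr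
      have h8 : (s:ℝ) * (n - ξ * n) ≤ s * (u + ρ * T.card) := by rw [hRc]; gcongr
      rw [h2] at h8
      have h9 : (s:ℝ) * (ξ * n) ≤ s * (ρ * (ξ * n)) := by
        refine mul_le_mul_of_nonneg_left ?_ (by linarith)
        exact le_mul_of_one_le_left (by positivity) hρ1
      have h10 : ρ * (s * q) = s * n := by rw [hnq]; ring
      have h11 : 0 < s * (ρ * (ξ * n)) := by positivity
      have h12 : ρ * (s * q - 31 / 10 * s * ξ * n) = ρ * (s * q) - 31 / 10 * (s * (ρ * (ξ * n))) := by ring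
      have h13 : ρ * (u + s * bb.card) = ρ * u + s * (ρ * bb.card) := by ring
      have h14 : (s:ℝ) * (ρ * (2 * ξ * n)) = 2 * (s * (ρ * (ξ * n))) := by ring
      have h15 : (s:ℝ) * (ρ * (ξ * n / 100)) = (s * (ρ * (ξ * n))) / 100 := by ring
      have h16 : (s:ℝ) * (u + ρ * (aa.card + bb.card + cc.card)) = s * u + s * (ρ * aa.card) + s * (ρ * bb.card) + s * (ρ * cc.card) := by ring
      have h17 : (s:ℝ) * (n - ξ * n) = s * n - s * (ξ * n) := by ring
      linarith
    rw [h1]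
    exact le_of_mul_le_mul_left h3 (by linarith)
  have hsξ : ξ ≤ s * ξ := le_mul_of_one_le_left hξ.le hs1
  have hρmξ : 2 * n * ((k + s) * m) ≤ ξ * (n:ℝ) ^ 2 / 50 := by
    rw [← hρ]
    have h1 : ρ * m ≤ ξ * n / 100 := by linarith
    calc 2 * n * (ρ * m) ≤ 2 * n * (ξ * n / 100) := by gcongr
      _ = _ := by ring
  have hdξ : ω * (ξ * ε) / 64 * (n:ℝ) ^ 2 ≤ ξ * (n:ℝ)^2 / 64 := by
    have h2 : ω * (ξ * ε) ≤ 1 * (ξ * 1) := by gcongr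
    calc ω * (ξ * ε) / 64 * (n:ℝ) ^ 2 ≤ 1 * (ξ * 1) / 64 * (n:ℝ) ^ 2 := by gcongr
      _ = _ := by ring
  have hξn2 : 16 * ξ * (n:ℝ)^2 ≤ γ * (n:ℝ)^2 := by
    apply mul_le_mul_of_nonneg_right _ (by positivity); linarith
  obtain ⟨Y', hY'Y, hY'e⟩ : ∃ Y' ⊆ Y, γ * (n:ℝ)^2 / 2 ≤ eG G Y' Y' := by
    by_cases hcase : s * q ≤ Y.card
    · obtain ⟨Y', hY', hY'c⟩ := exists_subset_card_eq hcase
      refine ⟨Y', hY', ?_⟩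
      have := hedge Y' (by rw [hY'c, hq]; ring)
      have h00 : 0 ≤ 16 * ξ * (n:ℝ)^2 := by positivity
      have h0 : 0 ≤ γ * (n:ℝ)^2 := by linarith
      linarith
    · push Not at hcase
      have hle : s * q ≤ Fintype.card (Fin n) := by rw [Fintype.card_fin, hq]; exact Nat.mul_le_mul_right q (by omega)
      obtain ⟨Y', hY', hY'c⟩ := exists_superset_card_eq hcase.le hle
      refine ⟨Y, subset_rfl, ?_⟩
      have h1 := hedge Y' (by rw [hY'c, hq]; ring)
      have h2 := eG_sdiff G Y' (Y' \ Y)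
      have h3 : Y' \ (Y' \ Y) = Y := by rw [sdiff_sdiff_right_self]; exact inter_eq_right.2 hY'
      have h4 := card_sdiff_add_card_eq_card hY'
      rw [hY'c] at h4
      have h4' : ((Y' \ Y).card : ℝ) + Y.card = s * q := by exact_mod_cast h4
      rw [h3] at h2
      have h2' : (eG G Y' Y' : ℝ) ≤ eG G Y Y + 2 * n * (Y' \ Y).card := by exact_mod_cast h2
      have h5 : 2 * n * ((Y' \ Y).card : ℝ) ≤ 2 * n * (31 / 10 * s * ξ * n) := by
        gcongr; linarith
      have h6 : (16 * s * ξ) * (n:ℝ)^2 ≤ γ * (n:ℝ)^2 := by gcongr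
      have h7 : 2 * n * (31 / 10 * s * ξ * n) ≤ γ * (n:ℝ)^2 / 2 := by
        have h8 : 0 ≤ s * ξ * (n:ℝ)^2 := by positivity
        have h9 : 2 * n * (31 / 10 * s * ξ * n) = 62 / 10 * (s * ξ * (n:ℝ)^2) := by ring
        linarith
      linarith
  refine tile_step4 hk hT1 R T hT hex x w m hw0.le (by linarith) ?_ ?_ hdn Y' hY'Y ?_
  · rw [← hρ, hx]; linarith
  · rw [← hρ, hx]
    have : (s:ℝ) * (ρ * m) ≤ ρ ^ 2 * (m + 1) := by
      calc (s:ℝ) * (ρ * m) ≤ ρ * (ρ * m) := by gcongr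
        _ = ρ ^ 2 * m := by ring
        _ ≤ _ := by gcongr; linarith
    linarith
  · have : 0 ≤ ξ * (n:ℝ)^2 := by positivity
    linarith

open Finset
open scoped Classical

lemma clique_image {n : ℕ} {Γ : SimpleGraph (Fin n)} {r : ℕ} {ι : Type*} (a : ι → Fin n) (S : Finset ι)
    (hS : S.card = r) (h : ∀ i ∈ S, ∀ j ∈ S, i ≠ j → Γ.Adj (a i) (a j)) : Γ.IsNClique r (S.image a) := by
  have hinj : Set.InjOn a S := by
    intro i hi j hj hij
    by_contra hne
    have := h i hi j hj hne
    rw [hij] at this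
    exact Γ.irrefl this
  rw [SimpleGraph.isNClique_iff]
  refine ⟨?_, ?_⟩
  · intro x hx y hy hne
    rw [mem_coe, mem_image] at hx hy
    obtain ⟨i, hi, rfl⟩ := hx
    obtain ⟨j, hj, rfl⟩ := hy
    exact h i hi j hj (fun hh => hne (by rw [hh]))
  · rw [card_image_of_injOn hinj, hS]

theorem T1_event (k s : ℕ) (hk : 1 ≤ k) (hks : k ≤ s) (d : ℝ) (hd : 0 < d) :
    ∃ Λ : ℝ, ∃ n₀ : ℕ, 0 < Λ ∧ ∀ n, n₀ ≤ n → ∀ p, GoodP n s p Λ → ∀ G : SimpleGraph (Fin n),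
      Pr n p (fun H => ¬ T1 (G ⊔ H) G k s d) ≤ 1 / n := by
  set l : List (Finset (Fin k ⊕ Fin s)) := [univ.image Sum.inl, univ.image Sum.inr] with hl
  have hFL : FL s l := by
    refine ⟨⟨Sum.inl ⟨0, hk⟩, by simp, ?_⟩, ?_, ⟨Sum.inr ⟨0, by omega⟩, by simp, ?_⟩, ?_, trivial⟩
    · intro x hx _ B hB
      simp only [List.mem_singleton] at hB
      subst hB
      simp only [mem_image, mem_univ, true_and] at hx ⊢
      obtain ⟨y, rfl⟩ := hx
      simp
    · exact card_image_le.trans (by simpa using hks)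
    · simp
    · exact card_image_le.trans (by simp)
  obtain ⟨Λ, n₁, hΛ, h⟩ := star_forest s l hFL 2 (d ^ (k * s)) (by norm_num) (by positivity)
  refine ⟨Λ, max n₁ 3, hΛ, fun n hn p hg G => ?_⟩
  have hn3 : 3 ≤ n := (le_max_right _ _).trans hn
  set A : Finset (Fin n) × Finset (Fin n) → Finset (Fin k ⊕ Fin s → Fin n) := fun x =>
    univ.filter (fun f => ∀ i j, f (Sum.inl i) ∈ x.1 ∧ f (Sum.inr j) ∈ x.2 ∧ G.Adj (f (Sum.inl i)) (f (Sum.inr j))) with hA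
  refine le_trans (Pr_mono hg.nonneg hg.le_one ?_) (h n ((le_max_left _ _).trans hn) p hg (Finset (Fin n) × Finset (Fin n)) ?_ A)
  · intro H hno hall
    apply hno
    intro A0 B0 he
    obtain ⟨a, ha, hinj, hcl⟩ := hall (A0, B0) (by
      have h5 := blow2 (τ₁ := Fin k) (τ₂ := Fin s) (fun u v => u ∈ A0 ∧ v ∈ B0 ∧ G.Adj u v) d hd.le
        ((A0 ×ˢ B0).filter (fun p => G.Adj p.1 p.2)) (by
          intro x hx; simp only [mem_filter, mem_product] at hx; tauto) he (A (A0, B0)) (by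
          intro f hf
          simp only [hA, mem_filter, mem_univ, true_and]
          exact hf)
      simpa using h5)
    simp only [hA, mem_filter, mem_univ, true_and] at ha
    have hc1 : Cl H a (univ.image Sum.inl) := hcl _ (by simp [hl])
    have hc2 : Cl H a (univ.image Sum.inr) := hcl _ (by simp [hl])
    refine ⟨univ.image (fun i => a (Sum.inl i)), univ.image (fun j => a (Sum.inr j)), ?_, ?_, ?_, ?_, ?_, ?_⟩
    · intro v hv
      obtain ⟨i, _, rfl⟩ := mem_image.1 hv
      exact (ha i ⟨0, by omega⟩).1
    · intro v hv
      obtain ⟨i, _, rfl⟩ := mem_image.1 hv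
      exact (ha ⟨0, by omega⟩ i).2.1
    · exact (card_image_of_injective univ (hinj.comp Sum.inl_injective)).trans (by simp)
    · exact (card_image_of_injective univ (hinj.comp Sum.inr_injective)).trans (by simp)
    · rw [disjoint_left]
      intro v hv hv'
      obtain ⟨i, _, rfl⟩ := mem_image.1 hv
      obtain ⟨j, _, hij⟩ := mem_image.1 hv'
      have := hinj hij
      simp at this
    · have e : univ.image (fun i => a (Sum.inl i)) ∪ univ.image (fun j => a (Sum.inr j)) = univ.image a := by
        ext v
        simp only [mem_union, mem_image, mem_univ, true_and]
        constructor
        · rintro (⟨i, rfl⟩ | ⟨i, rfl⟩) <;> exact ⟨_, rfl⟩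
        · rintro ⟨i | i, rfl⟩
          · exact Or.inl ⟨i, rfl⟩
          · exact Or.inr ⟨i, rfl⟩
      rw [e]
      apply clique_image a univ (by simp)
      rintro (i | i) _ (j | j) _ hij
      · exact Or.inr (hc1 _ (by simp) _ (by simp) hij)
      · exact Or.inl (ha i j).2.2
      · exact Or.inl (ha j i).2.2.symm
      · exact Or.inr (hc2 _ (by simp) _ (by simp) hij)
  · rw [Fintype.card_prod, Fintype.card_finset, Fintype.card_fin]
    push_cast
    have h1 := two_pow_le_exp n hn3
    calc (2:ℝ) ^ n * 2 ^ n ≤ Real.exp (n * Real.log n) * Real.exp (n * Real.log n) := by gcongr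
      _ = _ := by rw [← Real.exp_add]; ring_nf

open Finset
open scoped Classical

lemma card_transfer {n : ℕ} {ι κ : Type*} [Fintype ι] [Fintype κ] (e : ι ≃ κ) (Z : Finset (κ → Fin n)) :
    (univ.filter (fun g : ι → Fin n => g ∘ e.symm ∈ Z)).card = Z.card := by
  apply Finset.card_bij (fun g _ => g ∘ e.symm)
  · intro g hg; simpa using hg
  · intro g _ g' _ h
    funext i
    have := congrFun h (e i)
    simpa using this
  · intro f hf
    refine ⟨f ∘ e, ?_, ?_⟩
    · simp only [mem_filter, mem_univ, true_and]
      have : (f ∘ e) ∘ e.symm = f := by funext x; simp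
      rw [this]; exact hf
    · funext x; simp

lemma blow2R {κ : Type*} [Fintype κ] (ρ : κ → Prop) (c : ℝ) (hc : 0 < c) :
    ∃ c' : ℝ, 0 < c' ∧ ∀ n : ℕ, ∀ (P : Fin n → Fin n → Prop) (Y : Finset (Fin n × Fin n)),
      (∀ x ∈ Y, P x.1 x.2) → c * (n:ℝ) ^ 2 ≤ (Y.card : ℝ) → ∀ Z : Finset (κ → Fin n),
      (∀ f : κ → Fin n, (∀ i j, ρ i → ¬ ρ j → P (f i) (f j)) → f ∈ Z) →
      c' * (n:ℝ) ^ (Fintype.card κ) ≤ (Z.card : ℝ) := by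
  refine ⟨c ^ (Fintype.card {i // ρ i} * Fintype.card {i // ¬ ρ i}), by positivity, ?_⟩
  intro n P Y hY h Z hZ
  let e : {i // ρ i} ⊕ {i // ¬ ρ i} ≃ κ := Equiv.sumCompl ρ
  have h1 := blow2 P c hc.le Y hY h (univ.filter (fun g => g ∘ e.symm ∈ Z)) (by
    intro f hf
    simp only [mem_filter, mem_univ, true_and]
    apply hZ
    intro i j hi hj
    have h1 : e.symm i = Sum.inl ⟨i, hi⟩ := Equiv.sumCompl_symm_apply_of_pos hi
    have h2 : e.symm j = Sum.inr ⟨j, hj⟩ := Equiv.sumCompl_symm_apply_of_neg hj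
    simp only [Function.comp, h1, h2]
    exact hf _ _)
  rw [Fintype.card_congr e] at h1
  have h2 := card_transfer (n := n) e Z
  refine h1.trans (le_of_eq ?_)
  rw [← h2]
  congr
  funext a b
  exact Subsingleton.elim _ _

lemma blow3R {κ : Type*} [Fintype κ] (ρ : κ → Fin 3) (hρ : ∀ x, ∃ i, ρ i = x) (c : ℝ) (hc : 0 < c) :
    ∃ c' : ℝ, 0 < c' ∧ ∀ n : ℕ, ∀ (G : SimpleGraph (Fin n)) (Y : Finset (Fin n × Fin n × Fin n)),
      (∀ x ∈ Y, G.Adj x.1 x.2.1 ∧ G.Adj x.1 x.2.2 ∧ G.Adj x.2.1 x.2.2) → c * (n:ℝ) ^ 3 ≤ (Y.card : ℝ) →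
      ∀ Z : Finset (κ → Fin n),
      (∀ f : κ → Fin n, (∀ i j, ρ i ≠ ρ j → G.Adj (f i) (f j)) → f ∈ Z) →
      c' * (n:ℝ) ^ (Fintype.card κ) ≤ (Z.card : ℝ) := by
  refine ⟨c ^ (Fintype.card {i // ρ i = 0} * Fintype.card {i // ρ i = 1} * Fintype.card {i // ρ i = 2}), by positivity, ?_⟩
  intro n G Y hY h Z hZ
  let e0 : {i // ρ i = 0} ⊕ {i // ρ i = 1} ⊕ {i // ρ i = 2} → κ :=
    Sum.elim Subtype.val (Sum.elim Subtype.val Subtype.val)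
  have hb : Function.Bijective e0 := by
    constructor
    · rintro (⟨a, ha⟩ | ⟨a, ha⟩ | ⟨a, ha⟩) (⟨b, hb⟩ | ⟨b, hb⟩ | ⟨b, hb⟩) hab <;>
        simp only [e0, Sum.elim_inl, Sum.elim_inr] at hab <;> subst hab <;> first | rfl | (rw [ha] at hb; exact absurd hb (by decide))
    · intro i
      have : ρ i = 0 ∨ ρ i = 1 ∨ ρ i = 2 := by
        generalize ρ i = x; revert x; decide
      rcases this with hi | hi | hi
      · exact ⟨Sum.inl ⟨i, hi⟩, rfl⟩
      · exact ⟨Sum.inr (Sum.inl ⟨i, hi⟩), rfl⟩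
      · exact ⟨Sum.inr (Sum.inr ⟨i, hi⟩), rfl⟩
  let e := Equiv.ofBijective e0 hb
  have h1 := blow3 (fun a b c => G.Adj a b ∧ G.Adj a c ∧ G.Adj b c) c hc.le Y hY h (univ.filter (fun g => g ∘ e.symm ∈ Z)) (by
    intro f hf
    simp only [mem_filter, mem_univ, true_and]
    apply hZ
    obtain ⟨i0, h0⟩ := hρ 0
    obtain ⟨i1, h1⟩ := hρ 1
    obtain ⟨i2, h2⟩ := hρ 2
    have key : ∀ u v : {i // ρ i = 0} ⊕ {i // ρ i = 1} ⊕ {i // ρ i = 2}, ρ (e u) ≠ ρ (e v) → G.Adj (f u) (f v) := by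
      rintro (⟨a, ha⟩ | ⟨a, ha⟩ | ⟨a, ha⟩) (⟨b, hb⟩ | ⟨b, hb⟩ | ⟨b, hb⟩) hab
      · exact absurd (ha.trans hb.symm) hab
      · exact (hf ⟨a, ha⟩ ⟨b, hb⟩ ⟨i2, h2⟩).1
      · exact (hf ⟨a, ha⟩ ⟨i1, h1⟩ ⟨b, hb⟩).2.1
      · exact (hf ⟨b, hb⟩ ⟨a, ha⟩ ⟨i2, h2⟩).1.symm
      · exact absurd (ha.trans hb.symm) hab
      · exact (hf ⟨i0, h0⟩ ⟨a, ha⟩ ⟨b, hb⟩).2.2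
      · exact (hf ⟨b, hb⟩ ⟨i1, h1⟩ ⟨a, ha⟩).2.1.symm
      · exact (hf ⟨i0, h0⟩ ⟨b, hb⟩ ⟨a, ha⟩).2.2.symm
      · exact absurd (ha.trans hb.symm) hab
    intro i j hij
    exact key (e.symm i) (e.symm j) (by simpa using hij))
  rw [Fintype.card_congr e] at h1
  have h2 := card_transfer (n := n) e Z
  refine h1.trans (le_of_eq ?_)
  rw [← h2]
  congr
  funext a b
  exact Subsingleton.elim _ _

/-- Density of a family of gadgets, one per index, together with a joint part. -/
lemma gadget_count {J Q M : Type*} [Fintype J] [Fintype Q] [Fintype M] (c c' : ℝ) (hc : 0 < c) (hc' : 0 < c') (n : ℕ)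
    (A : J → Finset (Q → Fin n)) (hA : ∀ j, c * (n:ℝ) ^ Fintype.card Q ≤ (A j).card)
    (B : Finset (J × M → Fin n)) (hB : c' * (n:ℝ) ^ Fintype.card (J × M) ≤ B.card)
    (Z : Finset (J × (Q ⊕ M) → Fin n))
    (hZ : ∀ f : J × (Q ⊕ M) → Fin n, (∀ j, (fun q => f (j, Sum.inl q)) ∈ A j) → (fun x : J × M => f (x.1, Sum.inr x.2)) ∈ B → f ∈ Z) :
    c ^ Fintype.card J * c' * (n:ℝ) ^ Fintype.card (J × (Q ⊕ M)) ≤ Z.card := by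
  have h1 : (Fintype.piFinset A ×ˢ B).card ≤ Z.card := by
    apply Finset.card_le_card_of_injOn (fun x => fun u => Sum.elim (fun q => x.1 u.1 q) (fun m => x.2 (u.1, m)) u.2)
    · intro x hx
      simp only [mem_coe, mem_product, Fintype.mem_piFinset] at hx
      apply hZ
      · intro j; exact hx.1 j
      · exact hx.2
    · intro x _ y _ h
      refine Prod.ext ?_ ?_
      · funext j q
        exact congrFun h (j, Sum.inl q)
      · funext u
        exact congrFun h (u.1, Sum.inr u.2)
  rw [card_product, Fintype.card_piFinset] at h1
  have h2 : (∏ j, ((A j).card : ℝ)) * B.card ≤ Z.card := by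
    have : (((∏ j, (A j).card) * B.card : ℕ) : ℝ) ≤ (Z.card : ℕ) := Nat.cast_le.2 h1
    push_cast at this
    exact this
  refine le_trans ?_ h2
  have h3 : ∏ _j : J, (c * (n:ℝ) ^ Fintype.card Q) ≤ ∏ j, ((A j).card : ℝ) :=
    Finset.prod_le_prod (fun j _ => by positivity) (fun j _ => hA j)
  rw [prod_const, card_univ] at h3
  have h4 := mul_le_mul h3 hB (by positivity) (Finset.prod_nonneg (fun j _ => by positivity))
  refine le_trans (le_of_eq ?_) h4
  simp only [Fintype.card_prod, Fintype.card_sum]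
  rw [mul_pow, ← pow_mul]
  ring

/-- A labelling of an injective tuple by tiles. -/
lemma TL_cover {n : ℕ} {Γ : SimpleGraph (Fin n)} {r : ℕ} {ω τ : Type*} [Fintype ω] [Fintype τ] (b : ω → Fin n)
    (hb : Function.Injective b) (lab : ω → τ) (hcard : ∀ t, (univ.filter (fun u => lab u = t)).card = r)
    (hadj : ∀ u v, lab u = lab v → u ≠ v → Γ.Adj (b u) (b v)) (S : Finset (Fin n)) (hS : ∀ v, v ∈ S ↔ ∃ u, b u = v) : TL Γ r S := by
  have e : S = (univ : Finset τ).biUnion (fun t => (univ.filter (fun u => lab u = t)).image b) := by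
    ext v
    rw [hS]
    simp
  rw [e]
  apply TL_biUnion
  · intro t _
    apply TL_clique
    apply clique_image _ _ (hcard t)
    intro i hi j hj hij
    simp only [mem_filter, mem_univ, true_and] at hi hj
    exact hadj i j (hi.trans hj.symm) hij
  · intro t _ t' _ htt
    rw [disjoint_left]
    intro v hv hv'
    simp only [mem_image, mem_filter, mem_univ, true_and] at hv hv'
    obtain ⟨u, hu, rfl⟩ := hv
    obtain ⟨w, hw, hwu⟩ := hv'
    have := hb hwu
    subst this
    exact htt (hu.symm.trans hw)

lemma FL_gadget_aux {J κ : Type*} [DecidableEq J] [DecidableEq κ] (s : ℕ) (z : κ) (j : J) (rest : List (Finset (J × κ))) (hr : FL s rest)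
    (hrest : ∀ B ∈ rest, ∀ u ∈ B, u.1 = j → u.2 = z) :
    ∀ L : List (Finset κ), FL s (L ++ [{z}]) → FL s (L.map (fun B => B.image (Prod.mk j)) ++ rest) := by
  intro L
  induction L with
  | nil => intro _; exact hr
  | cons B L ih =>
    intro h
    obtain ⟨⟨v, hv, h1⟩, h2, h3⟩ := h
    refine ⟨⟨(j, v), mem_image_of_mem _ hv, ?_⟩, card_image_le.trans h2, ih h3⟩
    intro x hx hxv B' hB'
    obtain ⟨y, hy, rfl⟩ := mem_image.1 hx
    have hyv : y ≠ v := fun hh => hxv (by rw [hh])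
    rcases List.mem_append.1 hB' with hB' | hB'
    · obtain ⟨B'', hB'', rfl⟩ := List.mem_map.1 hB'
      intro hmem
      obtain ⟨w, hw, hwy⟩ := mem_image.1 hmem
      have : w = y := (Prod.ext_iff.1 hwy).2
      subst this
      exact h1 _ hy hyv B'' (List.mem_append_left _ hB'') hw
    · intro hmem
      have := hrest B' hB' _ hmem rfl
      exact h1 y hy hyv {z} (by simp) (by simpa using this)

lemma FL_gadget {J κ : Type*} [DecidableEq J] [DecidableEq κ] (s : ℕ) (L : List (Finset κ)) (z : κ) (hL : FL s (L ++ [{z}]))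
    (fin : List (Finset (J × κ))) (hfin : FL s fin) (hz : ∀ B ∈ fin, ∀ u ∈ B, u.2 = z) :
    ∀ js : List J, js.Nodup → FL s (js.flatMap (fun j => L.map (fun B => B.image (Prod.mk j))) ++ fin) := by
  intro js
  induction js with
  | nil => intro _; exact hfin
  | cons j js ih =>
    intro hnd
    rw [List.nodup_cons] at hnd
    rw [List.flatMap_cons, List.append_assoc]
    apply FL_gadget_aux s z j _ (ih hnd.2) _ L hL
    intro B hB u hu huj
    rw [List.mem_append] at hB
    rcases hB with hB | hB
    · obtain ⟨j', hj', hB⟩ := List.mem_flatMap.1 hB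
      obtain ⟨B', _, rfl⟩ := List.mem_map.1 hB
      obtain ⟨w, _, rfl⟩ := mem_image.1 hu
      exact absurd (huj ▸ hj') hnd.1
    · exact hz B hB u hu

/-- The complete block list of an absorber. -/
noncomputable def blocks (k s : ℕ) {κ : Type} [Fintype κ] (L : List (Finset κ)) (z : κ) :
    List (Finset ((Fin k ⊕ Fin s) × κ)) :=
  (univ : Finset (Fin k ⊕ Fin s)).toList.flatMap (fun j => L.map (fun B => B.image (Prod.mk j))) ++
    [univ.image (fun i => (Sum.inl i, z)), univ.image (fun i => (Sum.inr i, z))]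

lemma FL_blocks (k s : ℕ) (hk : 1 ≤ k) (hks : k ≤ s) {κ : Type} [Fintype κ] (L : List (Finset κ)) (z : κ)
    (hL : FL s (L ++ [{z}])) : FL s (blocks k s L z) := by
  unfold blocks
  refine FL_gadget s L z hL _ ?_ ?_ _ (nodup_toList _)
  · refine ⟨⟨(Sum.inl ⟨0, hk⟩, z), by simp, ?_⟩, ?_, ⟨(Sum.inr ⟨0, by omega⟩, z), by simp, ?_⟩, ?_, trivial⟩
    · intro x hx _ B hB
      simp only [List.mem_singleton] at hB
      subst hB
      simp only [mem_image, mem_univ, true_and] at hx ⊢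
      obtain ⟨y, rfl⟩ := hx
      simp
    · exact card_image_le.trans (by simpa using hks)
    · simp
    · exact card_image_le.trans (by simp)
  · intro B hB u hu
    simp only [List.mem_cons, List.not_mem_nil, or_false] at hB
    rcases hB with rfl | rfl <;> simp only [mem_image, mem_univ, true_and] at hu <;> obtain ⟨y, rfl⟩ := hu <;> rfl

lemma blocks_spec {k s n : ℕ} {κ : Type} [Fintype κ] {L : List (Finset κ)} {z : κ} {H : SimpleGraph (Fin n)}
    {a : (Fin k ⊕ Fin s) × κ → Fin n} (h : ∀ B ∈ blocks k s L z, Cl H a B) :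
    (∀ j, ∀ B ∈ L, ∀ x ∈ B, ∀ y ∈ B, x ≠ y → H.Adj (a (j, x)) (a (j, y))) ∧
    (∀ i j, i ≠ j → H.Adj (a (Sum.inl i, z)) (a (Sum.inl j, z))) ∧
    (∀ i j, i ≠ j → H.Adj (a (Sum.inr i, z)) (a (Sum.inr j, z))) := by
  refine ⟨?_, ?_, ?_⟩
  · intro j B hB x hx y hy hxy
    apply h (B.image (Prod.mk j)) _ _ (mem_image_of_mem _ hx) _ (mem_image_of_mem _ hy)
    · intro hh; exact hxy (Prod.ext_iff.1 hh).2
    · rw [blocks, List.mem_append]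
      exact Or.inl (List.mem_flatMap.2 ⟨j, by simp, List.mem_map.2 ⟨B, hB, rfl⟩⟩)
  · intro i j hij
    apply h (univ.image (fun i => (Sum.inl i, z))) (by simp [blocks]) _ (by simp) _ (by simp)
    simpa using hij
  · intro i j hij
    apply h (univ.image (fun i => (Sum.inr i, z))) (by simp [blocks]) _ (by simp) _ (by simp)
    simpa using hij

lemma absorb_group {n : ℕ} {Γ : SimpleGraph (Fin n)} {r : ℕ} {ι J : Type} [Fintype J] [Nonempty J] (S : Finset (Fin n))
    (hS : Fintype.card J ∣ S.card) (Rem : Fin n → Finset (Fin n))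
    (hRem : ∀ v ∈ S, ∀ w ∈ S, v ≠ w → Disjoint (Rem v) (Rem w))
    (I : Finset ι) (D : ι → Finset (Fin n)) (hD : ∀ i ∈ I, ∀ j ∈ I, i ≠ j → Disjoint (D i) (D j))
    (hDR : ∀ i ∈ I, ∀ v ∈ S, Disjoint (D i) (Rem v)) (hT : ∀ i ∈ I, TL Γ r (D i))
    (hx : ∀ x : J → Fin n, Function.Injective x → (∀ j, x j ∈ S) →
      S.card ≤ (I.filter (fun i => TL Γ r (D i ∪ univ.biUnion (fun j => Rem (x j))))).card) :
    TL Γ r (I.biUnion D ∪ S.biUnion Rem) := by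
  obtain ⟨m, e, hm, he, heS⟩ := grouping (J := J) S hS
  have heM : ∀ i j, e i j ∈ S := fun i j => (heS _).2 ⟨i, j, rfl⟩
  have hu : S.biUnion Rem = (univ : Finset (Fin m)).biUnion (fun i => univ.biUnion (fun j => Rem (e i j))) := by
    ext v
    simp only [mem_biUnion, mem_univ, true_and]
    constructor
    · rintro ⟨w, hw, hv⟩
      obtain ⟨i, j, rfl⟩ := (heS w).1 hw
      exact ⟨i, j, hv⟩
    · rintro ⟨i, j, hv⟩
      exact ⟨_, heM i j, hv⟩
  rw [hu]
  apply absorb _ _ _ _ I hD _ hT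
  · intro i _
    have h1 := hx (e i) (fun j j' h => (he _ _ _ _ h).2) (heM i)
    refine le_trans ?_ h1
    rw [card_univ, Fintype.card_fin, ← hm]
    exact Nat.le_mul_of_pos_left _ Fintype.card_pos
  · intro i _ i' _ hii
    rw [disjoint_biUnion_left]
    intro j _
    rw [disjoint_biUnion_right]
    intro j' _
    exact hRem _ (heM _ _) _ (heM _ _) (fun hh => hii (he _ _ _ _ hh).1)
  · intro i hi x _
    rw [disjoint_biUnion_right]
    intro j _
    exact hDR i hi _ (heM _ _)

open Finset
open scoped Classical

/-! Gadgets for the balanced case `k = s = t + 1`. -/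

abbrev Qe (t : ℕ) := Unit ⊕ Fin t ⊕ Fin (t + 1)
abbrev Me (t : ℕ) := Fin t ⊕ Fin t ⊕ Unit ⊕ Unit

def ρQ (t : ℕ) : Qe t → Prop
  | Sum.inl _ => True
  | Sum.inr (Sum.inl _) => True
  | Sum.inr (Sum.inr _) => False

def ρM (k s t : ℕ) : (Fin k ⊕ Fin s) × Me t → Fin 3
  | (_, Sum.inl _) => 0
  | (Sum.inl _, Sum.inr (Sum.inl _)) => 1
  | (Sum.inr _, Sum.inr (Sum.inl _)) => 2
  | (Sum.inl _, Sum.inr (Sum.inr _)) => 2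
  | (Sum.inr _, Sum.inr (Sum.inr _)) => 1

/-- Block membership. -/
def be (t : ℕ) (i : Fin 6) : Qe t ⊕ Me t → Prop
  | Sum.inl (Sum.inl _) => i = 1 ∨ i = 2 ∨ i = 3 ∨ i = 4
  | Sum.inl (Sum.inr (Sum.inl _)) => i = 1
  | Sum.inl (Sum.inr (Sum.inr _)) => i = 0
  | Sum.inr (Sum.inl _) => i = 2
  | Sum.inr (Sum.inr (Sum.inl _)) => i = 3
  | Sum.inr (Sum.inr (Sum.inr (Sum.inl _))) => i = 4 ∨ i = 5
  | Sum.inr (Sum.inr (Sum.inr (Sum.inr _))) => i = 5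

def ze (t : ℕ) : Qe t ⊕ Me t := Sum.inr (Sum.inr (Sum.inr (Sum.inr ())))

noncomputable def Be (t : ℕ) (i : Fin 6) : Finset (Qe t ⊕ Me t) := univ.filter (be t i)

noncomputable def Le (t : ℕ) : List (Finset (Qe t ⊕ Me t)) :=
  [Be t 0, Be t 1, Be t 2, Be t 3, Be t 4, Be t 5]

lemma FL_Le (t : ℕ) (ht : 1 ≤ t) : FL (t + 1) (Le t ++ [{ze t}]) := by
  have hc : ∀ i, (Be t i).card ≤ t + 1 := by
    intro i
    unfold Be
    rw [card_filter]
    simp only [Fintype.sum_sum_type, be]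
    fin_cases i <;> simp <;> omega
  simp only [Le, List.cons_append, List.nil_append, FL, hc, true_and, and_true, List.mem_cons, List.not_mem_nil, or_false,
    forall_eq_or_imp, forall_eq, card_singleton, le_add_iff_nonneg_left, zero_le]
  refine ⟨⟨Sum.inl (Sum.inr (Sum.inr 0)), ?_, ?_⟩, ⟨Sum.inl (Sum.inl ()), ?_, ?_⟩, ⟨Sum.inl (Sum.inl ()), ?_, ?_⟩,
    ⟨Sum.inl (Sum.inl ()), ?_, ?_⟩, ⟨Sum.inr (Sum.inr (Sum.inr (Sum.inl ()))), ?_, ?_⟩, ⟨ze t, ?_, ?_⟩, ⟨ze t, ?_, ?_⟩⟩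
  all_goals first
    | (rintro ((⟨⟩ | _ | _) | (_ | _ | ⟨⟩ | ⟨⟩)) <;> simp [Be, be, ze])
    | simp [Be, be, ze]

def lab0 (J : Type) (t : ℕ) : J × (Qe t ⊕ Me t) → J × Bool
  | (j, Sum.inl _) => (j, true)
  | (j, Sum.inr _) => (j, false)

def lab1 (J : Type) (t : ℕ) : (J × (Qe t ⊕ Me t)) ⊕ J → Option (J × Bool)
  | Sum.inl (j, Sum.inl (Sum.inl _)) => some (j, false)
  | Sum.inl (j, Sum.inl (Sum.inr _)) => some (j, true)
  | Sum.inl (j, Sum.inr (Sum.inl _)) => some (j, false)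
  | Sum.inl (j, Sum.inr (Sum.inr (Sum.inl _))) => some (j, false)
  | Sum.inl (j, Sum.inr (Sum.inr (Sum.inr (Sum.inl _)))) => some (j, false)
  | Sum.inl (_, Sum.inr (Sum.inr (Sum.inr (Sum.inr _)))) => none
  | Sum.inr j => some (j, true)

lemma lab0_card (J : Type) [Fintype J] (t : ℕ) (x : J × Bool) : (univ.filter (fun u => lab0 J t u = x)).card = (t + 1) + (t + 1) := by
  obtain ⟨j, b⟩ := x
  rw [card_filter, Fintype.sum_prod_type]
  cases b <;> simp [Fintype.sum_sum_type, lab0] <;> omega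

lemma lab1_card (J : Type) [Fintype J] (t : ℕ) (hJ : Fintype.card J = (t + 1) + (t + 1)) (x : Option (J × Bool)) :
    (univ.filter (fun u => lab1 J t u = x)).card = (t + 1) + (t + 1) := by
  rw [card_filter, Fintype.sum_sum_type, Fintype.sum_prod_type]
  obtain _ | ⟨j, b⟩ := x
  · simpa [Fintype.sum_sum_type, lab1] using hJ
  · cases b <;> simp [Fintype.sum_sum_type, lab1, sum_add_distrib] <;> omega

/-- Structure of an absorber tuple in the balanced case. -/
def Abs_e {n : ℕ} (G : SimpleGraph (Fin n)) (t : ℕ) (x : Fin (t+1) ⊕ Fin (t+1) → Fin n)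
    (a : (Fin (t+1) ⊕ Fin (t+1)) × (Qe t ⊕ Me t) → Fin n) : Prop :=
  (∀ j, (∀ q, G.Adj (x j) (a (j, Sum.inl q))) ∧ ∀ q q', ρQ t q → ¬ ρQ t q' → G.Adj (a (j, Sum.inl q)) (a (j, Sum.inl q'))) ∧
  ∀ u v, ρM (t+1) (t+1) t u ≠ ρM (t+1) (t+1) t v → G.Adj (a (u.1, Sum.inr u.2)) (a (v.1, Sum.inr v.2))

lemma abs_e_adj {n : ℕ} {G H : SimpleGraph (Fin n)} {t : ℕ} {x : Fin (t+1) ⊕ Fin (t+1) → Fin n}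
    {a : (Fin (t+1) ⊕ Fin (t+1)) × (Qe t ⊕ Me t) → Fin n} (hA : Abs_e G t x a)
    (hB : ∀ B ∈ blocks (t+1) (t+1) (Le t) (ze t), Cl H a B) (u v : (Fin (t+1) ⊕ Fin (t+1)) × (Qe t ⊕ Me t))
    (huv : u ≠ v) (h : (∃ i, be t i u.2 ∧ be t i v.2 ∧ u.1 = v.1) ∨ (u.2 = ze t ∧ v.2 = ze t) ∨
      (∃ q q', u.1 = v.1 ∧ u.2 = Sum.inl q ∧ v.2 = Sum.inl q' ∧ (ρQ t q ↔ ¬ ρQ t q')) ∨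
      (∃ q q', u.2 = Sum.inr q ∧ v.2 = Sum.inr q' ∧ ρM (t+1) (t+1) t (u.1, q) ≠ ρM (t+1) (t+1) t (v.1, q'))) :
    (G ⊔ H).Adj (a u) (a v) := by
  obtain ⟨h1, h2, h3⟩ := blocks_spec hB
  obtain ⟨hA1, hA2⟩ := hA
  rcases h with ⟨i, hi1, hi2, hj⟩ | ⟨hu, hv⟩ | ⟨q, q', hj, hu, hv, hq⟩ | ⟨q, q', hu, hv, hq⟩
  · right
    obtain ⟨j, u⟩ := u
    obtain ⟨j', v⟩ := v
    dsimp only at hj hi1 hi2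
    subst hj
    apply h1 j (Be t i) _ u (by simpa [Be] using hi1) v (by simpa [Be] using hi2) (fun hh => huv (by rw [hh]))
    fin_cases i <;> simp [Le]
  · obtain ⟨j, u⟩ := u
    obtain ⟨j', v⟩ := v
    dsimp only at hu hv
    subst hu hv
    have hjj : j ≠ j' := fun hh => huv (by rw [hh])
    rcases j with j | j <;> rcases j' with j' | j'
    · right; exact h2 j j' (fun hh => hjj (by rw [hh]))
    · left; exact hA2 (Sum.inl j, Sum.inr (Sum.inr (Sum.inr ()))) (Sum.inr j', Sum.inr (Sum.inr (Sum.inr ()))) (by simp [ρM])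
    · left; exact hA2 (Sum.inr j, Sum.inr (Sum.inr (Sum.inr ()))) (Sum.inl j', Sum.inr (Sum.inr (Sum.inr ()))) (by simp [ρM])
    · right; exact h3 j j' (fun hh => hjj (by rw [hh]))
  · obtain ⟨j, u⟩ := u
    obtain ⟨j', v⟩ := v
    dsimp only at hu hv hj
    subst hu hv hj
    left
    by_cases hq1 : ρQ t q
    · exact (hA1 j).2 q q' hq1 (hq.1 hq1)
    · have : ρQ t q' := by by_contra hh; exact hq1 (hq.2 hh)
      exact ((hA1 j).2 q' q this hq1).symm
  · obtain ⟨j, u⟩ := u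
    obtain ⟨j', v⟩ := v
    dsimp only at hu hv hq
    subst hu hv
    left; exact hA2 (j, q) (j', q') hq

lemma abs_e_default {n : ℕ} {G H : SimpleGraph (Fin n)} {t : ℕ} {x : Fin (t+1) ⊕ Fin (t+1) → Fin n}
    {a : (Fin (t+1) ⊕ Fin (t+1)) × (Qe t ⊕ Me t) → Fin n} (hA : Abs_e G t x a) (hinj : Function.Injective a)
    (hB : ∀ B ∈ blocks (t+1) (t+1) (Le t) (ze t), Cl H a B) :
    TL (G ⊔ H) ((t+1) + (t+1)) (univ.image a) := by
  apply TL_cover a hinj (lab0 _ t) (fun x => by convert lab0_card _ t x) _ _ (by simp)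
  intro u v huv hne
  apply abs_e_adj hA hB u v hne
  obtain ⟨j, u⟩ := u
  obtain ⟨j', v⟩ := v
  have hj : j = j' := by
    rcases u with u | u <;> rcases v with v | v <;> simp [lab0] at huv <;> exact huv
  subst hj
  rcases u with (⟨⟩ | u | u) | (u | u | ⟨⟩ | ⟨⟩) <;> rcases v with (⟨⟩ | v | v) | (v | v | ⟨⟩ | ⟨⟩) <;>
    first
    | (simp [lab0] at huv; done)
    | (refine Or.inl ⟨0, ?_⟩; simp [be]; done)
    | (refine Or.inl ⟨1, ?_⟩; simp [be]; done)
    | (refine Or.inl ⟨2, ?_⟩; simp [be]; done)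
    | (refine Or.inl ⟨3, ?_⟩; simp [be]; done)
    | (refine Or.inl ⟨5, ?_⟩; simp [be]; done)
    | (refine Or.inr (Or.inr (Or.inl ⟨_, _, rfl, rfl, rfl, ?_⟩)); simp [ρQ]; done)
    | (refine Or.inr (Or.inr (Or.inr ⟨_, _, rfl, rfl, ?_⟩)); rcases j with j | j <;> simp [ρM]; done)

lemma abs_e_with {n : ℕ} {G H : SimpleGraph (Fin n)} {t : ℕ} {x : Fin (t+1) ⊕ Fin (t+1) → Fin n}
    {a : (Fin (t+1) ⊕ Fin (t+1)) × (Qe t ⊕ Me t) → Fin n} (hA : Abs_e G t x a) (hinj : Function.Injective a)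
    (hB : ∀ B ∈ blocks (t+1) (t+1) (Le t) (ze t), Cl H a B) (hx : Function.Injective x) (hxa : ∀ j u, x j ≠ a u) :
    TL (G ⊔ H) ((t+1) + (t+1)) (univ.image a ∪ univ.biUnion (fun j => {x j})) := by
  have hb : Function.Injective (Sum.elim a x) := hinj.sumElim hx (fun u j => (hxa j u).symm)
  apply TL_cover (Sum.elim a x) hb (lab1 _ t) (fun x => by convert lab1_card _ t (by simp) x) _ _ (by
    intro v
    simp only [mem_union, mem_image, mem_univ, true_and, mem_biUnion, mem_singleton, Sum.exists, Sum.elim_inl, Sum.elim_inr]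
    exact or_congr Iff.rfl (or_congr (exists_congr fun j => eq_comm) (exists_congr fun j => eq_comm)))
  have key : ∀ j q v, lab1 (Fin (t+1) ⊕ Fin (t+1)) t (Sum.inr j) = lab1 _ t (Sum.inl (q, v)) → (G ⊔ H).Adj (x j) (a (q, v)) := by
    intro j q v h
    rcases v with (⟨⟩ | v) | (v | v | ⟨⟩ | ⟨⟩) <;> simp [lab1] at h
    subst h
    left
    exact (hA.1 _).1 _
  rintro (u | j) (v | j') huv hne
  · apply abs_e_adj hA hB u v (fun hh => hne (by rw [hh]))
    obtain ⟨j, u⟩ := u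
    obtain ⟨j', v⟩ := v
    rcases u with (⟨⟩ | u | u) | (u | u | ⟨⟩ | ⟨⟩) <;> rcases v with (⟨⟩ | v | v) | (v | v | ⟨⟩ | ⟨⟩) <;>
    simp only [lab1, Option.some.injEq, Prod.mk.injEq, and_true, reduceCtorEq, and_false] at huv <;> (try subst huv) <;>
    first
    | exact Or.inr (Or.inl ⟨rfl, rfl⟩)
    | (refine Or.inl ⟨0, ?_⟩; simp [be]; done)
    | (refine Or.inl ⟨1, ?_⟩; simp [be]; done)
    | (refine Or.inl ⟨2, ?_⟩; simp [be]; done)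
    | (refine Or.inl ⟨3, ?_⟩; simp [be]; done)
    | (refine Or.inl ⟨4, ?_⟩; simp [be]; done)
    | (refine Or.inr (Or.inr (Or.inl ⟨_, _, rfl, rfl, rfl, ?_⟩)); simp [ρQ]; done)
    | (refine Or.inr (Or.inr (Or.inr ⟨_, _, rfl, rfl, ?_⟩)); rcases j with j | j <;> simp [ρM]; done)
  · exact (key j' u.1 u.2 huv.symm).symm
  · exact key j v.1 v.2 huv
  · simp [lab1] at huv
    exact absurd (by rw [huv]) hne

open Finset
open scoped Classical

lemma nbh_edges {n s : ℕ} (hs : 1 ≤ s) (hd : (s + s) ∣ n) (G : SimpleGraph (Fin n)) (γ : ℝ)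
    (hdeg : ∀ v, s * n ≤ (s + s) * (nbh G v univ).card)
    (hE : ∀ Y : Finset (Fin n), (s + s) * Y.card = s * n → γ * (n:ℝ) ^ 2 ≤ eG G Y Y) (v : Fin n) :
    γ * (n:ℝ) ^ 2 ≤ eG G (nbh G v univ) (nbh G v univ) := by
  obtain ⟨m, rfl⟩ := hd
  have h1 : s * m ≤ (nbh G v univ).card := by
    have := hdeg v
    have e : s * ((s + s) * m) = (s + s) * (s * m) := by ring
    rw [e] at this
    exact Nat.le_of_mul_le_mul_left this (by omega)
  obtain ⟨Y, hY, hYc⟩ := exists_subset_card_eq h1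
  refine (hE Y (by rw [hYc]; ring)).trans ?_
  apply Nat.cast_le.2
  apply card_le_card
  apply filter_subset_filter
  exact product_subset_product hY hY

lemma triangles {n : ℕ} (G : SimpleGraph (Fin n)) (γ : ℝ)
    (h : ∀ v, γ * (n:ℝ) ^ 2 ≤ eG G (nbh G v univ) (nbh G v univ)) :
    γ * (n:ℝ) ^ 3 ≤ ((univ.filter (fun x : Fin n × Fin n × Fin n =>
      G.Adj x.1 x.2.1 ∧ G.Adj x.1 x.2.2 ∧ G.Adj x.2.1 x.2.2)).card : ℝ) := by
  have h1 : ∑ v, eG G (nbh G v univ) (nbh G v univ) ≤ (univ.filter (fun x : Fin n × Fin n × Fin n =>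
      G.Adj x.1 x.2.1 ∧ G.Adj x.1 x.2.2 ∧ G.Adj x.2.1 x.2.2)).card := by
    unfold eG
    rw [← Finset.card_sigma]
    apply card_le_card_of_injOn (fun y => (y.1, y.2.1, y.2.2))
    · intro y hy
      simp only [coe_sigma, Set.mem_sigma_iff, mem_coe, mem_univ, true_and, mem_filter, mem_product, nbh] at hy ⊢
      exact ⟨hy.1.1, hy.1.2, hy.2⟩
    · intro y _ y' _ hyy
      obtain ⟨a, b, c⟩ := y
      obtain ⟨a', b', c'⟩ := y'
      simp only [Prod.mk.injEq] at hyy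
      obtain ⟨rfl, rfl, rfl⟩ := hyy
      rfl
  have h2 : ∑ _v : Fin n, γ * (n:ℝ) ^ 2 ≤ ∑ v, (eG G (nbh G v univ) (nbh G v univ) : ℝ) := sum_le_sum (fun v _ => h v)
  rw [sum_const, card_univ, Fintype.card_fin, nsmul_eq_mul] at h2
  calc γ * (n:ℝ) ^ 3 = n * (γ * (n:ℝ) ^ 2) := by ring
    _ ≤ _ := h2
    _ = ((∑ v, eG G (nbh G v univ) (nbh G v univ) : ℕ) : ℝ) := by push_cast; rfl
    _ ≤ _ := Nat.cast_le.2 h1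

lemma ρM_surj (t : ℕ) (ht : 1 ≤ t) : ∀ x, ∃ i, ρM (t+1) (t+1) t i = x := by
  intro x
  fin_cases x
  · exact ⟨(Sum.inl 0, Sum.inl ⟨0, ht⟩), rfl⟩
  · exact ⟨(Sum.inr 0, Sum.inr (Sum.inr (Sum.inl ()))), rfl⟩
  · exact ⟨(Sum.inl 0, Sum.inr (Sum.inr (Sum.inl ()))), rfl⟩

lemma abs_e_count (t : ℕ) (ht : 1 ≤ t) (γ : ℝ) (hγ : 0 < γ) : ∃ c : ℝ, 0 < c ∧ ∀ n, ∀ G : SimpleGraph (Fin n),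
    (∀ v, γ * (n:ℝ) ^ 2 ≤ eG G (nbh G v univ) (nbh G v univ)) → ∀ x : Fin (t+1) ⊕ Fin (t+1) → Fin n,
    c * (n:ℝ) ^ (Fintype.card ((Fin (t+1) ⊕ Fin (t+1)) × (Qe t ⊕ Me t))) ≤ ((univ.filter (Abs_e G t x)).card : ℝ) := by
  obtain ⟨c1, hc1, h1⟩ := blow2R (ρQ t) γ hγ
  obtain ⟨c2, hc2, h2⟩ := blow3R (ρM (t+1) (t+1) t) (ρM_surj t ht) γ hγ
  refine ⟨c1 ^ Fintype.card (Fin (t+1) ⊕ Fin (t+1)) * c2, by positivity, ?_⟩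
  intro n G hG x
  apply gadget_count c1 c2 hc1 hc2 n
    (fun j => univ.filter (fun f : Qe t → Fin n => (∀ q, G.Adj (x j) (f q)) ∧ ∀ q q', ρQ t q → ¬ ρQ t q' → G.Adj (f q) (f q')))
    _ (univ.filter (fun f : (Fin (t+1) ⊕ Fin (t+1)) × Me t → Fin n =>
      ∀ u v, ρM (t+1) (t+1) t u ≠ ρM (t+1) (t+1) t v → G.Adj (f u) (f v)))
  · apply h2 n G _ _ (triangles G γ hG)
    · intro f hf; simpa using hf
    · intro y hy; simpa using hy
  · intro f hf hf'
    simp only [mem_filter, mem_univ, true_and] at hf hf' ⊢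
    exact ⟨hf, hf'⟩
  · intro j
    apply h1 n (fun a b => G.Adj (x j) a ∧ G.Adj (x j) b ∧ G.Adj a b) _ _ (hG (x j))
    · intro f hf
      simp only [mem_filter, mem_univ, true_and]
      refine ⟨?_, fun q q' hq hq' => (hf q q' hq hq').2.2⟩
      intro q
      by_cases hq : ρQ t q
      · exact (hf q (Sum.inr (Sum.inr 0)) hq (by simp [ρQ])).1
      · exact (hf (Sum.inl ()) q (by simp [ρQ]) hq).2.1
    · intro y hy
      simp only [mem_filter, mem_product, nbh, mem_univ, true_and] at hy
      tauto

lemma Pr_add_bound {n : ℕ} {p : ℝ} (hp : 0 ≤ p) (hp1 : p ≤ 1) {P Q R : SimpleGraph (Fin n) → Prop} {a b : ℝ}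
    (hP : Pr n p (fun H => ¬ P H) ≤ a) (hQ : Pr n p (fun H => ¬ Q H) ≤ b) (h : ∀ H, P H → Q H → R H) :
    Pr n p (fun H => ¬ R H) ≤ a + b := by
  refine le_trans (Pr_mono hp hp1 (Q := fun H => ¬ P H ∨ ¬ Q H) ?_) ((Pr_or_le hp hp1 _ _).trans (add_le_add hP hQ))
  intro H hR
  by_contra hh
  push Not at hh
  exact hR (h H hh.1 hh.2)

lemma card_biUnion_tuple {n : ℕ} {ι : Type} [Fintype ι] (I : Finset (Fin n)) (a : Fin n → ι → Fin n) (η ξ : ℝ)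
    (hI : (I.card : ℝ) ≤ η * n) (h : Fintype.card ι * η ≤ ξ) :
    ((I.biUnion (fun i => univ.image (a i))).card : ℝ) ≤ ξ * n := by
  have h1 : (I.biUnion (fun i => univ.image (a i))).card ≤ I.card * Fintype.card ι :=
    card_biUnion_le_card_mul _ _ _ (fun i _ => card_image_le)
  have h2 : ((I.biUnion (fun i => univ.image (a i))).card : ℝ) ≤ I.card * Fintype.card ι := by exact_mod_cast h1
  refine h2.trans ?_
  calc (I.card : ℝ) * Fintype.card ι ≤ η * n * Fintype.card ι := by gcongr
    _ = Fintype.card ι * η * n := by ring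
    _ ≤ ξ * n := by gcongr

theorem case_eq (t : ℕ) (ht : 1 ≤ t) (γ : ℝ) (hγ : 0 < γ) : ∃ Λ : ℝ, ∃ n₀ : ℕ, 0 < Λ ∧ ∀ n, n₀ ≤ n →
    ((t+1) + (t+1)) ∣ n → ∀ p, GoodP n (t+1) p Λ → ∀ G : SimpleGraph (Fin n),
    (∀ v, (t+1) * n ≤ ((t+1) + (t+1)) * (nbh G v univ).card) →
    (∀ Y : Finset (Fin n), ((t+1) + (t+1)) * Y.card = (t+1) * n → γ * (n:ℝ) ^ 2 ≤ eG G Y Y) →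
    Pr n p (fun H => ¬ HasCliqueFactor (G ⊔ H) ((t+1) + (t+1))) ≤ 2 / n := by
  obtain ⟨c, hc, hcount⟩ := abs_e_count t ht γ hγ
  obtain ⟨ξ, hξ⟩ : ∃ ξ : ℝ, ξ = min 1 (γ / (16 * ((t + 1 : ℕ) : ℝ))) := ⟨_, rfl⟩
  have hξ0 : 0 < ξ := by rw [hξ]; positivity
  have hξ1 : ξ ≤ 1 := by rw [hξ]; exact min_le_left _ _
  have hξγ : 16 * ((t + 1 : ℕ) : ℝ) * ξ ≤ γ := by
    have : ξ ≤ γ / (16 * ((t + 1 : ℕ) : ℝ)) := by rw [hξ]; exact min_le_right _ _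
    rw [le_div_iff₀ (by positivity)] at this
    linarith
  obtain ⟨N, hN⟩ : ∃ N : ℕ, N = Fintype.card ((Fin (t+1) ⊕ Fin (t+1)) × (Qe t ⊕ Me t)) := ⟨_, rfl⟩
  obtain ⟨θ, hθ, Λ₁, n₁, hΛ₁, habs⟩ := absorbers (J := Fin (t+1) ⊕ Fin (t+1)) (t+1) (blocks (t+1) (t+1) (Le t) (ze t))
    (FL_blocks (t+1) (t+1) (by omega) le_rfl _ _ (FL_Le t ht)) 1 c (ξ / (N + 1)) one_pos hc (by positivity)
  obtain ⟨d, hd, n₂, htile⟩ := almost_tiling (k := t+1) (s := t+1) (by omega) (by omega) γ ξ (min 1 θ) hξ0 hξ1 hξγ (by positivity) (min_le_left _ _)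
  obtain ⟨Λ₂, n₃, hΛ₂, hT1⟩ := T1_event (t+1) (t+1) (by omega) le_rfl d hd
  refine ⟨max Λ₁ Λ₂, max (max n₁ n₂) (max n₃ 1), lt_max_of_lt_left hΛ₁, ?_⟩
  intro n hn hdvd p hg G hdeg hE
  simp only [max_le_iff] at hn
  obtain ⟨⟨hn1, hn2⟩, hn3, hn4⟩ := hn
  have hE2 := nbh_edges (by omega) hdvd G γ hdeg hE
  have ev1 := habs n hn1 p (hg.mono hn4 (le_max_left _ _)) Unit (by
    simp only [Fintype.card_unit, Nat.cast_one]
    apply Real.one_le_exp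
    have : 0 ≤ Real.log n := Real.log_natCast_nonneg n
    positivity) (fun _ => univ) (fun _ x => univ.filter (Abs_e G t x))
  have ev2 := hT1 n hn3 p (hg.mono hn4 (le_max_right _ _)) G
  have e2 : (2:ℝ) / n = 1 / n + 1 / n := by ring
  rw [e2]
  refine Pr_add_bound hg.nonneg hg.le_one ev1 ev2 ?_
  intro H hA hT
  obtain ⟨I, a, hI, hIa, hdis, hmany⟩ := hA () (fun x _ => by convert hcount n G hE2 x)
  have hA' : ∀ i x, a i ∈ univ.filter (Abs_e G t x) → Abs_e G t x (a i) := fun i x h => (mem_filter.1 h).2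
  obtain ⟨W, hW⟩ : ∃ W, W = I.biUnion (fun i => univ.image (a i)) := ⟨_, rfl⟩
  have hWc : ((univ \ (univ \ W)).card : ℝ) ≤ ξ * n := by
    rw [sdiff_sdiff_right_self, inf_eq_inter, univ_inter, hW]
    apply card_biUnion_tuple I a _ _ hI
    rw [← hN, mul_div_assoc', div_le_iff₀ (by positivity)]
    nlinarith
  obtain ⟨U, hUW, hUc, hTL⟩ := htile n hn2 hdvd G (G ⊔ H) hdeg hE hT (univ \ W) hWc
  have hDT : ∀ i ∈ I, TL (G ⊔ H) ((t+1)+(t+1)) (univ.image (a i)) := by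
    intro i hi
    obtain ⟨hinj, hcl, x, _, hx⟩ := hIa i hi
    exact abs_e_default (hA' i x hx) hinj hcl
  have hDd : ∀ i ∈ I, ∀ j ∈ I, i ≠ j → Disjoint (univ.image (a i)) (univ.image (a j)) := by
    intro i hi j hj hij
    rw [disjoint_left]
    intro v hv hv'
    obtain ⟨u, _, rfl⟩ := mem_image.1 hv
    obtain ⟨w, _, hw⟩ := mem_image.1 hv'
    exact hdis i hi j hj hij u w hw.symm
  have hWT : TL (G ⊔ H) ((t+1)+(t+1)) W := by rw [hW]; exact TL_biUnion _ _ hDT hDd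
  have hUd : Disjoint W U := by
    rw [disjoint_left]; intro v hv hv'
    exact (mem_sdiff.1 (hUW hv')).2 hv
  have hUcard : ((t+1)+(t+1)) ∣ U.card := by
    have h1 := TL_dvd hWT
    have h2 := TL_dvd hTL
    have h3 : n = W.card + ((univ \ W) \ U).card + U.card := by
      have h4 := card_sdiff_add_card_eq_card hUW
      have h5 := card_sdiff_add_card_eq_card (subset_univ W)
      rw [card_univ, Fintype.card_fin] at h5
      omega
    have h4 : ((t+1)+(t+1)) ∣ W.card + ((univ \ W) \ U).card := Dvd.dvd.add h1 h2
    exact (Nat.dvd_add_right h4).1 (h3 ▸ hdvd)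
  have hUI : ∀ i ∈ I, ∀ v ∈ U, ∀ u, v ≠ a i u := by
    intro i hi v hv u hh
    refine disjoint_left.1 hUd ?_ hv
    rw [hW, mem_biUnion]
    exact ⟨i, hi, mem_image.2 ⟨u, mem_univ _, hh.symm⟩⟩
  have hfin := absorb_group (Γ := G ⊔ H) (r := (t+1)+(t+1)) (J := Fin (t+1) ⊕ Fin (t+1)) U (by simpa using hUcard) (fun v => {v})
    (by intro v _ w _ hvw; simpa using hvw) I (fun i => univ.image (a i)) hDd (by
      intro i hi v hv
      rw [disjoint_singleton_right, mem_image]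
      rintro ⟨u, _, hu⟩
      exact hUI i hi v hv u hu.symm) hDT (by
      intro x hx hxU
      have h1 := hmany x (mem_univ _)
      have h2 : (U.card : ℝ) ≤ θ * n := hUc.trans (by gcongr; exact min_le_right _ _)
      have h3 : U.card ≤ (I.filter (fun i => a i ∈ univ.filter (Abs_e G t x))).card := by exact_mod_cast h2.trans h1
      refine h3.trans (card_le_card ?_)
      intro i hi
      rw [mem_filter] at hi ⊢
      refine ⟨hi.1, ?_⟩
      obtain ⟨hinj, hcl, _⟩ := hIa i hi.1
      exact abs_e_with (hA' i x hi.2) hinj hcl hx (fun j u => hUI i hi.1 _ (hxU j) u))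
  apply TL_factor (by omega)
  have e : (univ : Finset (Fin n)) = ((univ \ W) \ U) ∪ (I.biUnion (fun i => univ.image (a i)) ∪ U.biUnion (fun v => {v})) := by
    ext v
    simp only [← hW, mem_univ, mem_union, mem_sdiff, true_and, biUnion_singleton_eq_self, true_iff]
    tauto
  rw [e]
  apply TL_union hTL hfin
  rw [← hW, biUnion_singleton_eq_self, disjoint_left]
  intro v hv hv'
  simp only [mem_union, mem_sdiff, mem_univ, true_and] at hv hv'
  tauto

open Finset
open scoped Classical

/-! Gadgets for the unbalanced case `k ≤ t`, `s = t + 1`. -/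

abbrev RQ (k t : ℕ) := Fin t ⊕ Fin k
abbrev EQ (k t : ℕ) := Fin k ⊕ Fin (t + 1) ⊕ Fin t ⊕ Fin (k + 1)

def ρL (k t : ℕ) : RQ k t ⊕ EQ k t → Prop
  | Sum.inl (Sum.inl _) => False
  | Sum.inl (Sum.inr _) => True
  | Sum.inr (Sum.inl _) => True
  | Sum.inr (Sum.inr (Sum.inl _)) => False
  | Sum.inr (Sum.inr (Sum.inr (Sum.inl _))) => False
  | Sum.inr (Sum.inr (Sum.inr (Sum.inr _))) => True

/-- Block membership. -/
def bl (k t : ℕ) (i : Fin 4) : EQ k t ⊕ Unit → Prop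
  | Sum.inl (Sum.inl _) => i = 2
  | Sum.inl (Sum.inr (Sum.inl _)) => i = 0
  | Sum.inl (Sum.inr (Sum.inr (Sum.inl _))) => i = 3
  | Sum.inl (Sum.inr (Sum.inr (Sum.inr _))) => i = 1
  | Sum.inr _ => i = 2 ∨ i = 3

def zl (k t : ℕ) : EQ k t ⊕ Unit := Sum.inr ()

noncomputable def Bl (k t : ℕ) (i : Fin 4) : Finset (EQ k t ⊕ Unit) := univ.filter (bl k t i)

noncomputable def Ll (k t : ℕ) : List (Finset (EQ k t ⊕ Unit)) := [Bl k t 0, Bl k t 1, Bl k t 2, Bl k t 3]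

lemma FL_Ll (k t : ℕ) (hkt : k ≤ t) : FL (t + 1) (Ll k t ++ [{zl k t}]) := by
  have hc : ∀ i, (Bl k t i).card ≤ t + 1 := by
    intro i
    unfold Bl
    rw [card_filter]
    simp only [Fintype.sum_sum_type, bl]
    fin_cases i <;> simp <;> omega
  simp only [Ll, List.cons_append, List.nil_append, FL, hc, true_and, and_true, List.mem_cons, List.not_mem_nil, or_false,
    forall_eq_or_imp, forall_eq, card_singleton, le_add_iff_nonneg_left, zero_le]
  refine ⟨⟨Sum.inl (Sum.inr (Sum.inl 0)), ?_, ?_⟩, ⟨Sum.inl (Sum.inr (Sum.inr (Sum.inr 0))), ?_, ?_⟩, ⟨zl k t, ?_, ?_⟩,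
    ⟨zl k t, ?_, ?_⟩, ⟨zl k t, ?_, ?_⟩⟩
  all_goals first
    | (rintro ((_ | _ | _ | _) | ⟨⟩) <;> simp [Bl, bl, zl])
    | simp [Bl, bl, zl]

def labl0 (J : Type) (k t : ℕ) : J × (EQ k t ⊕ Unit) → Option (J × Bool)
  | (j, Sum.inl (Sum.inl _)) => some (j, true)
  | (j, Sum.inl (Sum.inr (Sum.inl _))) => some (j, true)
  | (j, Sum.inl (Sum.inr (Sum.inr _))) => some (j, false)
  | (_, Sum.inr _) => none

def labl1 (J : Type) (k t : ℕ) : (J × (EQ k t ⊕ Unit)) ⊕ (J × RQ k t) → J × Fin 3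
  | Sum.inl (j, Sum.inl (Sum.inl _)) => (j, 2)
  | Sum.inl (j, Sum.inl (Sum.inr (Sum.inl _))) => (j, 0)
  | Sum.inl (j, Sum.inl (Sum.inr (Sum.inr (Sum.inl _)))) => (j, 2)
  | Sum.inl (j, Sum.inl (Sum.inr (Sum.inr (Sum.inr _)))) => (j, 1)
  | Sum.inl (j, Sum.inr _) => (j, 2)
  | Sum.inr (j, Sum.inl _) => (j, 1)
  | Sum.inr (j, Sum.inr _) => (j, 0)

lemma labl0_card (J : Type) [Fintype J] (k t : ℕ) (hJ : Fintype.card J = k + (t + 1)) (x : Option (J × Bool)) :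
    (univ.filter (fun u => labl0 J k t u = x)).card = k + (t + 1) := by
  rw [card_filter, Fintype.sum_prod_type]
  obtain _ | ⟨j, b⟩ := x
  · simpa [Fintype.sum_sum_type, labl0] using hJ
  · cases b <;> simp [Fintype.sum_sum_type, labl0, sum_add_distrib] <;> omega

lemma labl1_card (J : Type) [Fintype J] (k t : ℕ) (x : J × Fin 3) :
    (univ.filter (fun u => labl1 J k t u = x)).card = k + (t + 1) := by
  rw [card_filter, Fintype.sum_sum_type, Fintype.sum_prod_type, Fintype.sum_prod_type]
  obtain ⟨j, b⟩ := x
  fin_cases b <;> simp [Fintype.sum_sum_type, labl1, sum_add_distrib] <;> omega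

/-- `g` extends the remainder `f`. -/
def ExtOK {n : ℕ} (G : SimpleGraph (Fin n)) (k t : ℕ) (f : RQ k t → Fin n) (g : EQ k t → Fin n) : Prop :=
  ∀ i j, ρL k t i → ¬ ρL k t j → G.Adj (Sum.elim f g i) (Sum.elim f g j)

/-- Structure of an absorber tuple for the remainders `y j`. -/
def Abs_l {n : ℕ} (G : SimpleGraph (Fin n)) (k t : ℕ) (y : Fin k ⊕ Fin (t+1) → RQ k t → Fin n)
    (a : (Fin k ⊕ Fin (t+1)) × (EQ k t ⊕ Unit) → Fin n) : Prop :=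
  (∀ j, ExtOK G k t (y j) (fun q => a (j, Sum.inl q))) ∧
  ∀ i j, G.Adj (a (Sum.inl i, Sum.inr ())) (a (Sum.inr j, Sum.inr ()))

lemma abs_l_adj {n : ℕ} {G H : SimpleGraph (Fin n)} {k t : ℕ} {y : Fin k ⊕ Fin (t+1) → RQ k t → Fin n}
    {a : (Fin k ⊕ Fin (t+1)) × (EQ k t ⊕ Unit) → Fin n} (hA : Abs_l G k t y a)
    (hB : ∀ B ∈ blocks k (t+1) (Ll k t) (zl k t), Cl H a B) (u v : (Fin k ⊕ Fin (t+1)) × (EQ k t ⊕ Unit))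
    (huv : u ≠ v) (h : (∃ i, bl k t i u.2 ∧ bl k t i v.2 ∧ u.1 = v.1) ∨ (u.2 = zl k t ∧ v.2 = zl k t) ∨
      (∃ q q', u.1 = v.1 ∧ u.2 = Sum.inl q ∧ v.2 = Sum.inl q' ∧ (ρL k t (Sum.inr q) ↔ ¬ ρL k t (Sum.inr q')))) :
    (G ⊔ H).Adj (a u) (a v) := by
  obtain ⟨h1, h2, h3⟩ := blocks_spec hB
  obtain ⟨hA1, hA2⟩ := hA
  rcases h with ⟨i, hi1, hi2, hj⟩ | ⟨hu, hv⟩ | ⟨q, q', hj, hu, hv, hq⟩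
  · right
    obtain ⟨j, u⟩ := u
    obtain ⟨j', v⟩ := v
    dsimp only at hj hi1 hi2
    subst hj
    apply h1 j (Bl k t i) _ u (by simpa [Bl] using hi1) v (by simpa [Bl] using hi2) (fun hh => huv (by rw [hh]))
    fin_cases i <;> simp [Ll]
  · obtain ⟨j, u⟩ := u
    obtain ⟨j', v⟩ := v
    dsimp only at hu hv
    subst hu hv
    have hjj : j ≠ j' := fun hh => huv (by rw [hh])
    rcases j with j | j <;> rcases j' with j' | j'
    · right; exact h2 j j' (fun hh => hjj (by rw [hh]))
    · left; exact hA2 j j'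
    · left; exact (hA2 j' j).symm
    · right; exact h3 j j' (fun hh => hjj (by rw [hh]))
  · obtain ⟨j, u⟩ := u
    obtain ⟨j', v⟩ := v
    dsimp only at hu hv hj
    subst hu hv hj
    left
    by_cases hq1 : ρL k t (Sum.inr q)
    · exact hA1 j (Sum.inr q) (Sum.inr q') hq1 (hq.1 hq1)
    · have : ρL k t (Sum.inr q') := by by_contra hh; exact hq1 (hq.2 hh)
      exact (hA1 j (Sum.inr q') (Sum.inr q) this hq1).symm

lemma abs_l_default {n : ℕ} {G H : SimpleGraph (Fin n)} {k t : ℕ} {y : Fin k ⊕ Fin (t+1) → RQ k t → Fin n}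
    {a : (Fin k ⊕ Fin (t+1)) × (EQ k t ⊕ Unit) → Fin n} (hA : Abs_l G k t y a) (hinj : Function.Injective a)
    (hB : ∀ B ∈ blocks k (t+1) (Ll k t) (zl k t), Cl H a B) :
    TL (G ⊔ H) (k + (t+1)) (univ.image a) := by
  apply TL_cover a hinj (labl0 _ k t) (fun x => by convert labl0_card _ k t (by simp) x) _ _ (by simp)
  intro u v huv hne
  apply abs_l_adj hA hB u v hne
  obtain ⟨j, u⟩ := u
  obtain ⟨j', v⟩ := v
  rcases u with (u | u | u | u) | ⟨⟩ <;> rcases v with (v | v | v | v) | ⟨⟩ <;>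
    simp only [labl0, Option.some.injEq, Prod.mk.injEq, and_true, reduceCtorEq, and_false] at huv <;> (try subst huv) <;>
    first
    | exact Or.inr (Or.inl ⟨rfl, rfl⟩)
    | (refine Or.inl ⟨0, ?_⟩; simp [bl]; done)
    | (refine Or.inl ⟨1, ?_⟩; simp [bl]; done)
    | (refine Or.inl ⟨2, ?_⟩; simp [bl]; done)
    | (refine Or.inl ⟨3, ?_⟩; simp [bl]; done)
    | (refine Or.inr (Or.inr ⟨_, _, rfl, rfl, rfl, ?_⟩); simp [ρL]; done)

lemma abs_l_with {n : ℕ} {G H : SimpleGraph (Fin n)} {k t : ℕ} {y : Fin k ⊕ Fin (t+1) → RQ k t → Fin n}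
    {a : (Fin k ⊕ Fin (t+1)) × (EQ k t ⊕ Unit) → Fin n} (hA : Abs_l G k t y a) (hinj : Function.Injective a)
    (hB : ∀ B ∈ blocks k (t+1) (Ll k t) (zl k t), Cl H a B)
    (hy : ∀ j i j' i', y j i = y j' i' → j = j' ∧ i = i') (hya : ∀ j i u, y j i ≠ a u)
    (hy1 : ∀ j i i', i ≠ i' → H.Adj (y j (Sum.inl i)) (y j (Sum.inl i')))
    (hy2 : ∀ j i i', i ≠ i' → H.Adj (y j (Sum.inr i)) (y j (Sum.inr i'))) :
    TL (G ⊔ H) (k + (t+1)) (univ.image a ∪ univ.biUnion (fun j => univ.image (y j))) := by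
  have hyi : Function.Injective (fun u : (Fin k ⊕ Fin (t+1)) × RQ k t => y u.1 u.2) := by
    intro u v h
    obtain ⟨h1, h2⟩ := hy _ _ _ _ h
    exact Prod.ext h1 h2
  have hb : Function.Injective (Sum.elim a (fun u : (Fin k ⊕ Fin (t+1)) × RQ k t => y u.1 u.2)) :=
    hinj.sumElim hyi (fun u j => (hya j.1 j.2 u).symm)
  apply TL_cover _ hb (labl1 _ k t) (fun x => by convert labl1_card _ k t x) _ _ (by
    intro v
    simp only [mem_union, mem_image, mem_univ, true_and, mem_biUnion]
    constructor
    · rintro (⟨u, hu⟩ | ⟨j, i, hu⟩)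
      · exact ⟨Sum.inl u, hu⟩
      · exact ⟨Sum.inr (j, i), hu⟩
    · rintro ⟨u | ⟨j, i⟩, hu⟩
      · exact Or.inl ⟨u, hu⟩
      · exact Or.inr ⟨j, i, hu⟩)
  have key : ∀ u v, labl1 (Fin k ⊕ Fin (t+1)) k t (Sum.inr u) = labl1 _ k t (Sum.inl v) → (G ⊔ H).Adj (y u.1 u.2) (a v) := by
    rintro ⟨j, u⟩ ⟨j', v⟩ h
    rcases u with u | u <;> rcases v with (v | v | v | v) | ⟨⟩ <;> simp [labl1] at h <;> subst h <;> left
    · exact (hA.1 j (Sum.inr (Sum.inr (Sum.inr (Sum.inr v)))) (Sum.inl (Sum.inl u)) (by simp [ρL]) (by simp [ρL])).symm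
    · exact hA.1 j (Sum.inl (Sum.inr u)) (Sum.inr (Sum.inr (Sum.inl v))) (by simp [ρL]) (by simp [ρL])
  rintro (u | u) (v | v) huv hne
  · apply abs_l_adj hA hB u v (fun hh => hne (by rw [hh]))
    obtain ⟨j, u⟩ := u
    obtain ⟨j', v⟩ := v
    rcases u with (u | u | u | u) | ⟨⟩ <;> rcases v with (v | v | v | v) | ⟨⟩ <;>
    simp [labl1] at huv <;> subst huv <;>
    first
    | (refine Or.inl ⟨0, ?_⟩; simp [bl]; done)
    | (refine Or.inl ⟨1, ?_⟩; simp [bl]; done)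
    | (refine Or.inl ⟨2, ?_⟩; simp [bl]; done)
    | (refine Or.inl ⟨3, ?_⟩; simp [bl]; done)
    | (refine Or.inr (Or.inr ⟨_, _, rfl, rfl, rfl, ?_⟩); simp [ρL]; done)
  · exact (key v u huv.symm).symm
  · exact key u v huv
  · right
    obtain ⟨j, u⟩ := u
    obtain ⟨j', v⟩ := v
    rcases u with u | u <;> rcases v with v | v <;> simp [labl1] at huv <;> subst huv
    · exact hy1 j u v (fun hh => hne (by rw [hh]))
    · exact hy2 j u v (fun hh => hne (by rw [hh]))

open Finset
open scoped Classical

lemma pairs2 {n : ℕ} (G : SimpleGraph (Fin n)) (W : Finset (Fin n)) (α : ℝ) (hα : 0 ≤ α)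
    (h : ∀ v, α * n ≤ ((nbh G v W).card : ℝ)) (v : Fin n) :
    α ^ 2 * (n:ℝ) ^ 2 ≤ ((univ.filter (fun x : Fin n × Fin n =>
      x.1 ∈ W ∧ G.Adj v x.1 ∧ x.2 ∈ W ∧ G.Adj x.1 x.2)).card : ℝ) := by
  have h1 : ∑ a ∈ nbh G v W, (nbh G a W).card ≤ (univ.filter (fun x : Fin n × Fin n =>
      x.1 ∈ W ∧ G.Adj v x.1 ∧ x.2 ∈ W ∧ G.Adj x.1 x.2)).card := by
    rw [← Finset.card_sigma]
    apply card_le_card_of_injOn (fun y => (y.1, y.2))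
    · intro y hy
      simp only [coe_sigma, Set.mem_sigma_iff, mem_coe, mem_univ, true_and, mem_filter, nbh] at hy ⊢
      tauto
    · intro y _ y' _ hyy
      obtain ⟨a, b⟩ := y
      obtain ⟨a', b'⟩ := y'
      simp only [Prod.mk.injEq] at hyy
      obtain ⟨rfl, rfl⟩ := hyy
      rfl
  have h2 : ∑ _a ∈ nbh G v W, α * (n:ℝ) ≤ ∑ a ∈ nbh G v W, ((nbh G a W).card : ℝ) := sum_le_sum (fun a _ => h a)
  rw [sum_const, nsmul_eq_mul] at h2
  calc α ^ 2 * (n:ℝ) ^ 2 = (α * n) * (α * n) := by ring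
    _ ≤ (nbh G v W).card * (α * n) := by
        have := h v
        gcongr
    _ ≤ _ := h2
    _ = ((∑ a ∈ nbh G v W, (nbh G a W).card : ℕ) : ℝ) := by push_cast; rfl
    _ ≤ _ := Nat.cast_le.2 h1

lemma blow2S {κ : Type*} [Fintype κ] (ρ : κ → Prop) (c : ℝ) (hc : 0 < c) :
    ∃ c' : ℝ, 0 < c' ∧ ∀ n : ℕ, 1 ≤ n → ∀ (P : Fin n → Fin n → Prop) (Y : Finset (Fin n × Fin n)),
      (∀ x ∈ Y, P x.1 x.2) → c * (n:ℝ) ^ 2 ≤ (Y.card : ℝ) → ∀ Z : Finset (κ → Fin n),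
      (∀ f : κ → Fin n, (∀ i j, ρ i → ¬ ρ j → P (f i) (f j)) → (∀ i, ρ i → ∃ b, P (f i) b) →
        (∀ j, ¬ ρ j → ∃ a, P a (f j)) → f ∈ Z) →
      c' * (n:ℝ) ^ (Fintype.card κ) ≤ (Z.card : ℝ) := by
  obtain ⟨c', hc', h⟩ := blow2R (κ := κ ⊕ Bool) (Sum.elim ρ (fun b => b = true)) c hc
  refine ⟨c', hc', ?_⟩
  intro n hn P Y hY hYc Z hZ
  have h1 := h n P Y hY hYc (univ.filter (fun f : κ ⊕ Bool → Fin n => (fun i => f (Sum.inl i)) ∈ Z)) (by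
    intro f hf
    simp only [mem_filter, mem_univ, true_and]
    apply hZ
    · intro i j hi hj
      exact hf (Sum.inl i) (Sum.inl j) hi hj
    · intro i hi
      exact ⟨_, hf (Sum.inl i) (Sum.inr false) hi (by simp)⟩
    · intro j hj
      exact ⟨_, hf (Sum.inr true) (Sum.inl j) (by simp) hj⟩)
  have h2 : (univ.filter (fun f : κ ⊕ Bool → Fin n => (fun i => f (Sum.inl i)) ∈ Z)).card ≤
      (Z ×ˢ (univ : Finset (Bool → Fin n))).card := by
    apply card_le_card_of_injOn (fun f => (fun i => f (Sum.inl i), fun b => f (Sum.inr b)))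
    · intro f hf
      simp only [mem_coe, mem_filter, mem_univ, true_and, mem_product, and_true] at hf ⊢
      exact hf
    · intro f _ f' _ hff
      simp only [Prod.mk.injEq] at hff
      funext x
      rcases x with x | x
      · exact congrFun hff.1 x
      · exact congrFun hff.2 x
  rw [card_product, card_univ, Fintype.card_fun, Fintype.card_fin, Fintype.card_bool] at h2
  have h3 : c' * (n:ℝ) ^ (Fintype.card (κ ⊕ Bool)) ≤ Z.card * (n:ℝ) ^ 2 := by
    refine h1.trans ?_
    exact_mod_cast h2
  rw [Fintype.card_sum, Fintype.card_bool, pow_add, ← mul_assoc] at h3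
  have : (0:ℝ) < (n:ℝ) ^ 2 := by positivity
  exact le_of_mul_le_mul_right h3 this

lemma row_count (k t : ℕ) (α : ℝ) (hα : 0 < α) : ∃ c : ℝ, 0 < c ∧ ∀ n, 1 ≤ n → ∀ G : SimpleGraph (Fin n),
    (∀ v, α * n ≤ ((nbh G v univ).card : ℝ)) → ∀ v, ∀ Z : Finset (RQ k t → Fin n),
    (∀ f : RQ k t → Fin n, (∀ i, G.Adj v (f (Sum.inr i))) → (∀ i j, G.Adj (f (Sum.inr i)) (f (Sum.inl j))) →
      c * (n:ℝ) ^ Fintype.card (EQ k t) ≤ ((univ.filter (ExtOK G k t f)).card : ℝ) → f ∈ Z) →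
    c * (n:ℝ) ^ Fintype.card (RQ k t) ≤ Z.card := by
  obtain ⟨c, hc, h⟩ := blow2S (ρL k t) (α ^ 2) (by positivity)
  refine ⟨c / 2, by positivity, ?_⟩
  intro n hn G hG v Z hZ
  obtain ⟨S, hS⟩ : ∃ S : Finset (RQ k t ⊕ EQ k t → Fin n), ∀ F, F ∈ S ↔ (∀ i, ρL k t i → G.Adj v (F i)) ∧
      ∀ i j, ρL k t i → ¬ ρL k t j → G.Adj (F i) (F j) :=
    ⟨univ.filter (fun F => (∀ i, ρL k t i → G.Adj v (F i)) ∧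
      ∀ i j, ρL k t i → ¬ ρL k t j → G.Adj (F i) (F j)), fun F => by simp only [mem_filter, mem_univ, true_and]⟩
  have h1 := h n hn (fun a b => G.Adj v a ∧ G.Adj a b) _ (by
    intro x hx
    have := (mem_filter.1 hx).2
    exact ⟨this.2.1, this.2.2.2⟩) (pairs2 G univ α hα.le hG v)
    S (by
    intro f hf hf1 hf2
    rw [hS]
    refine ⟨fun i hi => ?_, fun i j hi hj => (hf i j hi hj).2⟩
    obtain ⟨b, hb⟩ := hf1 i hi
    exact hb.1)
  obtain ⟨Y, hYm⟩ : ∃ Y : Finset ((RQ k t → Fin n) × (EQ k t → Fin n)), ∀ x, x ∈ Y ↔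
    (∀ i, G.Adj v (x.1 (Sum.inr i))) ∧ ExtOK G k t x.1 x.2 :=
    ⟨univ.filter (fun x => (∀ i, G.Adj v (x.1 (Sum.inr i))) ∧ ExtOK G k t x.1 x.2),
      fun x => by simp only [mem_filter, mem_univ, true_and]⟩
  have hY : S.card ≤ Y.card := by
    apply card_le_card_of_injOn (fun F => (fun i => F (Sum.inl i), fun i => F (Sum.inr i)))
    · intro F hF
      rw [mem_coe, hS] at hF
      rw [mem_coe, hYm]
      refine ⟨fun i => hF.1 _ (by simp [ρL]), ?_⟩
      intro i j hi hj
      have := hF.2 i j hi hj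
      rcases i with i | i <;> rcases j with j | j <;> exact this
    · intro f _ f' _ hff
      simp only [Prod.mk.injEq] at hff
      funext x
      rcases x with x | x
      · exact congrFun hff.1 x
      · exact congrFun hff.2 x
  have eA : (Fintype.card (RQ k t → Fin n) : ℝ) = (n:ℝ) ^ Fintype.card (RQ k t) := by
    rw [Fintype.card_fun, Fintype.card_fin]; push_cast; rfl
  have eB : (Fintype.card (EQ k t → Fin n) : ℝ) = (n:ℝ) ^ Fintype.card (EQ k t) := by
    rw [Fintype.card_fun, Fintype.card_fin]; push_cast; rfl
  have hBpos : 0 < Fintype.card (EQ k t → Fin n) := by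
    rw [Fintype.card_fun, Fintype.card_fin]; positivity
  rw [← eA]
  refine rich_rows Y (c/2) ?_ (by positivity) hBpos Z ?_
  · rw [eA, eB]
    have hYr : (S.card : ℝ) ≤ (Y.card : ℝ) := by exact_mod_cast hY
    have h2 := le_trans h1 hYr
    rw [Fintype.card_sum (α := RQ k t), pow_add] at h2
    linarith
  · intro f hf
    have hpos := lt_of_lt_of_le (mul_pos (half_pos hc) (Nat.cast_pos.2 hBpos)) hf
    rw [Nat.cast_pos, card_pos] at hpos
    obtain ⟨g, hg⟩ := hpos
    simp only [mem_filter, mem_univ, true_and, hYm] at hg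
    apply hZ f hg.1
    · intro i j
      exact hg.2 (Sum.inl (Sum.inr i)) (Sum.inl (Sum.inl j)) (by simp [ρL]) (by simp [ρL])
    · rw [← eB]
      refine hf.trans (Nat.cast_le.2 (card_le_card ?_))
      intro g hg
      simp only [mem_filter, mem_univ, true_and, hYm] at hg ⊢
      exact hg.2

lemma abs_l_count (k t : ℕ) (hk : 1 ≤ k) (α c1 : ℝ) (hα : 0 < α) (hc1 : 0 < c1) : ∃ c : ℝ, 0 < c ∧ ∀ n, ∀ G : SimpleGraph (Fin n),
    (∀ v, α * n ≤ ((nbh G v univ).card : ℝ)) → ∀ y : Fin k ⊕ Fin (t+1) → RQ k t → Fin n,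
    (∀ j, c1 * (n:ℝ) ^ Fintype.card (EQ k t) ≤ ((univ.filter (ExtOK G k t (y j))).card : ℝ)) →
    c * (n:ℝ) ^ (Fintype.card ((Fin k ⊕ Fin (t+1)) × (EQ k t ⊕ Unit))) ≤ ((univ.filter (Abs_l G k t y)).card : ℝ) := by
  obtain ⟨c2, hc2, h2⟩ := blow2R (κ := (Fin k ⊕ Fin (t+1)) × Unit) (fun x => x.1.isLeft = true) α hα
  refine ⟨c1 ^ Fintype.card (Fin k ⊕ Fin (t+1)) * c2, by positivity, ?_⟩
  intro n G hG y hy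
  apply gadget_count c1 c2 hc1 hc2 n (fun j => univ.filter (ExtOK G k t (y j))) hy
    (univ.filter (fun f : (Fin k ⊕ Fin (t+1)) × Unit → Fin n =>
      ∀ i j, G.Adj (f (Sum.inl i, ())) (f (Sum.inr j, ()))))
  · apply h2 n G.Adj (univ.filter (fun x : Fin n × Fin n => G.Adj x.1 x.2))
    · intro x hx; exact (mem_filter.1 hx).2
    · have e1 : ∑ v, (nbh G v univ).card ≤ (univ.filter (fun x : Fin n × Fin n => G.Adj x.1 x.2)).card := by
        rw [← Finset.card_sigma]
        apply card_le_card_of_injOn (fun y => (y.1, y.2))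
        · intro y hy
          simp only [coe_sigma, Set.mem_sigma_iff, mem_coe, mem_univ, true_and, mem_filter, nbh] at hy ⊢
          exact hy
        · intro y _ y' _ hyy
          obtain ⟨a, b⟩ := y
          obtain ⟨a', b'⟩ := y'
          simp only [Prod.mk.injEq] at hyy
          obtain ⟨rfl, rfl⟩ := hyy
          rfl
      have e2 : ∑ _v : Fin n, α * (n:ℝ) ≤ ∑ v, ((nbh G v univ).card : ℝ) := sum_le_sum (fun v _ => hG v)
      rw [sum_const, card_univ, Fintype.card_fin, nsmul_eq_mul] at e2
      calc α * (n:ℝ) ^ 2 = n * (α * n) := by ring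
        _ ≤ _ := e2
        _ = ((∑ v, (nbh G v univ).card : ℕ) : ℝ) := by push_cast; rfl
        _ ≤ _ := Nat.cast_le.2 e1
    · intro f hf
      simp only [mem_filter, mem_univ, true_and]
      intro i j
      exact hf _ _ rfl (by simp)
  · intro f hf hf'
    simp only [mem_filter, mem_univ, true_and] at hf hf' ⊢
    exact ⟨hf, hf'⟩

lemma reservoir (α η : ℝ) (hα : 0 < α) (hη : 0 < η) : ∃ θ : ℝ, 0 < θ ∧ ∃ n₀ : ℕ, ∀ n, n₀ ≤ n → ∀ G : SimpleGraph (Fin n),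
    (∀ v, α * n ≤ ((nbh G v univ).card : ℝ)) → ∃ V : Finset (Fin n), (V.card : ℝ) ≤ η * n ∧
      ∀ v, θ * n ≤ ((nbh G v V).card : ℝ) := by
  obtain ⟨θ, hθ, Λ, n₀, hΛ, h⟩ := absorbers (ι := Unit) (J := Unit) 1 [] trivial 1 α η one_pos hα hη
  refine ⟨θ, hθ, max n₀ 2, ?_⟩
  intro n hn G hG
  have hn1 : n₀ ≤ n := le_trans (le_max_left _ _) hn
  have hn2 : 2 ≤ n := le_trans (le_max_right _ _) hn
  have ev := h n hn1 0 ⟨le_rfl, zero_le_one, fun i h2 h1 => by omega⟩ Unit (by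
    simp only [Fintype.card_unit, Nat.cast_one]
    apply Real.one_le_exp
    have : 0 ≤ Real.log n := Real.log_natCast_nonneg n
    positivity) (fun _ => univ) (fun _ x => univ.filter (fun a : Unit → Fin n => G.Adj (x ()) (a ())))
  have hex : ∃ H : SimpleGraph (Fin n), ∀ _y : Unit, (∀ x ∈ (univ : Finset (Unit → Fin n)), α * (n:ℝ) ^ (Fintype.card Unit) ≤
      ((univ.filter (fun a : Unit → Fin n => G.Adj (x ()) (a ()))).card : ℝ)) →
          ∃ (I : Finset (Fin n)) (a : Fin n → Unit → Fin n), (I.card : ℝ) ≤ η * n ∧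
            (∀ i ∈ I, ∀ j ∈ I, i ≠ j → ∀ u v, a i u ≠ a j v) ∧
            ∀ x ∈ (univ : Finset (Unit → Fin n)), θ * n ≤ ((I.filter (fun i => a i ∈ univ.filter (fun a : Unit → Fin n => G.Adj (x ()) (a ())))).card : ℝ) := by
    by_contra hno
    push Not at hno
    have e1 := Pr_mono (n := n) (p := 0) le_rfl zero_le_one (P := fun _ => True) (h := fun H _ => ?_) |>.trans ev
    · rw [Pr_true] at e1
      have : (1:ℝ) / n < 1 := by
        rw [div_lt_one (by positivity)]
        exact_mod_cast hn2
      linarith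
    · intro hh
      obtain ⟨y, hy1, hy2⟩ := hno H
      obtain ⟨I, a, h1, h2, h3, h4⟩ := hh y hy1
      obtain ⟨x, hx, hx2⟩ := hy2 I a h1 h3
      have := h4 x hx
      linarith
  obtain ⟨H, hH⟩ := hex
  obtain ⟨I, a, hI, hdis, hmany⟩ := hH () (by
    intro x _
    rw [Fintype.card_unit, pow_one]
    refine (hG (x ())).trans (Nat.cast_le.2 ?_)
    apply card_le_card_of_injOn (fun w => fun _ => w)
    · intro w hw
      simp only [nbh, mem_coe, mem_filter, mem_univ, true_and] at hw ⊢
      exact hw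
    · intro w _ w' _ hw
      exact congrFun hw ())
  refine ⟨I.image (fun i => a i ()), ?_, ?_⟩
  · exact le_trans (Nat.cast_le.2 card_image_le) hI
  · intro v
    refine (hmany (fun _ => v) (mem_univ _)).trans (Nat.cast_le.2 ?_)
    apply card_le_card_of_injOn (fun i => a i ())
    · intro i hi
      simp only [nbh, mem_coe, mem_filter, mem_univ, true_and] at hi ⊢
      exact ⟨mem_image_of_mem _ hi.1, hi.2⟩
    · intro i hi j hj hij
      by_contra hne
      exact hdis i (mem_filter.1 (mem_coe.1 hi)).1 j (mem_filter.1 (mem_coe.1 hj)).1 hne () () hij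

open Finset
open scoped Classical

lemma link_count (b t : ℕ) (θ : ℝ) (hθ : 0 < θ) : ∃ c : ℝ, 0 < c ∧ ∀ n, 1 ≤ n → ∀ (G : SimpleGraph (Fin n)) (V : Finset (Fin n)),
    (∀ v, θ * n ≤ ((nbh G v V).card : ℝ)) → ∀ u, ∀ Z : Finset (Fin b ⊕ Fin (t+1) → Fin n),
    (∀ f : Fin b ⊕ Fin (t+1) → Fin n, (∀ i, f i ∈ V) → (∀ i, G.Adj u (f (Sum.inr i))) →
      (∀ i j, G.Adj (f (Sum.inr i)) (f (Sum.inl j))) → f ∈ Z) →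
    c * (n:ℝ) ^ (b + (t + 1)) ≤ Z.card := by
  obtain ⟨c, hc, h⟩ := blow2S (κ := Fin b ⊕ Fin (t+1)) (fun x => x.isRight = true) (θ ^ 2) (by positivity)
  refine ⟨c, hc, ?_⟩
  intro n hn G V hV u Z hZ
  have h1 := h n hn (fun x y => x ∈ V ∧ G.Adj u x ∧ y ∈ V ∧ G.Adj x y) _ (by
    intro x hx
    exact (mem_filter.1 hx).2) (pairs2 G V θ hθ.le hV u) Z (by
    intro f hf hf1 hf2
    apply hZ
    · rintro (i | i)
      · obtain ⟨a, ha⟩ := hf2 (Sum.inl i) (by simp)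
        exact ha.2.2.1
      · obtain ⟨a, ha⟩ := hf1 (Sum.inr i) (by simp)
        exact ha.1
    · intro i
      obtain ⟨a, ha⟩ := hf1 (Sum.inr i) (by simp)
      exact ha.2.1
    · intro i j
      exact (hf (Sum.inr i) (Sum.inl j) (by simp) (by simp)).2.2.2)
  rwa [Fintype.card_sum, Fintype.card_fin, Fintype.card_fin] at h1

/-- `f` completes `v` to a clique. -/
structure Pin {n : ℕ} (G H : SimpleGraph (Fin n)) {t₁ t₂ : ℕ} (v : Fin n) (f : Fin t₁ ⊕ Fin t₂ → Fin n) : Prop where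
  inj : Function.Injective f
  root : ∀ i, H.Adj v (f (Sum.inl i))
  left : ∀ i j, i ≠ j → H.Adj (f (Sum.inl i)) (f (Sum.inl j))
  right : ∀ i j, i ≠ j → H.Adj (f (Sum.inr i)) (f (Sum.inr j))
  groot : ∀ i, G.Adj v (f (Sum.inr i))
  cross : ∀ i j, G.Adj (f (Sum.inr i)) (f (Sum.inl j))

lemma Pin.clique {n : ℕ} {G H : SimpleGraph (Fin n)} {t₁ t₂ : ℕ} {v : Fin n} {f : Fin t₁ ⊕ Fin t₂ → Fin n}
    (h : Pin G H v f) (r : ℕ) (hr : r = t₁ + t₂ + 1) : TL (G ⊔ H) r (insert v (univ.image f)) := by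
  apply TL_clique
  have e : insert v (univ.image f) = (univ : Finset (Option (Fin t₁ ⊕ Fin t₂))).image (fun o => o.elim v f) := by
    ext w
    simp only [mem_insert, mem_image, mem_univ, true_and, Option.exists, Option.elim]
    constructor
    · rintro (rfl | h)
      · exact Or.inl rfl
      · exact Or.inr h
    · rintro (h | h)
      · exact Or.inl h.symm
      · exact Or.inr h
  rw [e]
  apply clique_image
  · rw [card_univ, Fintype.card_option, Fintype.card_sum, Fintype.card_fin, Fintype.card_fin, hr]
  · rintro (_ | i | i) _ (_ | j | j) _ hij
    · exact absurd rfl hij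
    · exact Or.inr (h.root j)
    · exact Or.inl (h.groot j)
    · exact Or.inr (h.root i).symm
    · exact Or.inr (h.left i j (fun hh => hij (by rw [hh])))
    · exact Or.inl (h.cross j i).symm
    · exact Or.inl (h.groot i).symm
    · exact Or.inl (h.cross i j)
    · exact Or.inr (h.right i j (fun hh => hij (by rw [hh])))

lemma part_tile {n r : ℕ} {Γ : SimpleGraph (Fin n)} {W V Y U R V₁ Y₁ Y₂ : Finset (Fin n)} (hR : R = univ \ (W ∪ (V ∪ Y)))
    (hUR : U ⊆ R) (hV₁V : V₁ ⊆ V) (hWV : Disjoint W V) (hWY : Disjoint W Y) (hVY : Disjoint V Y) (hY12 : Disjoint Y₁ Y₂)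
    (hYY : Y = Y₁ ∪ Y₂) (hT : TL Γ r (R \ U)) (hTU : TL Γ r (U ∪ V₁)) (hfin : TL Γ r (W ∪ Y₁))
    (hQ2 : TL Γ r ((V \ V₁) ∪ Y₂)) : TL Γ r univ := by
  have f1 : ∀ v, v ∈ W → v ∉ V := fun v h h' => disjoint_left.1 hWV h h'
  have f2 : ∀ v, v ∈ W → v ∉ Y := fun v h h' => disjoint_left.1 hWY h h'
  have f3 : ∀ v, v ∈ V → v ∉ Y := fun v h h' => disjoint_left.1 hVY h h'
  have f4 : ∀ v, v ∈ Y₁ → v ∉ Y₂ := fun v h h' => disjoint_left.1 hY12 h h'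
  have f5 : ∀ v, v ∈ Y ↔ v ∈ Y₁ ∨ v ∈ Y₂ := fun v => by rw [hYY, mem_union]
  have f6 : ∀ v, v ∈ R ↔ v ∉ W ∧ v ∉ V ∧ v ∉ Y := fun v => by
    rw [hR]; simp only [mem_sdiff, mem_univ, true_and, mem_union, not_or]
  have e : (univ : Finset (Fin n)) = ((R \ U) ∪ (U ∪ V₁)) ∪ ((W ∪ Y₁) ∪ ((V \ V₁) ∪ Y₂)) := by
    clear hT hTU hfin hQ2 hR hYY
    ext v
    have g5 := f5 v
    have g6 := f6 v
    simp only [mem_univ, mem_union, mem_sdiff, true_iff]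
    clear f1 f2 f3 f4 f5 f6
    grind
  rw [e]
  apply TL_union (TL_union hT hTU ?_) (TL_union hfin hQ2 ?_)
  all_goals
    rw [disjoint_left]
    intro v hv hv'
    have g1 := f1 v; have g2 := f2 v; have g3 := f3 v; have g4 := f4 v; have g5 := f5 v; have g6 := f6 v
    have g7 := @hV₁V v; have g8 := @hUR v
    simp only [mem_union, mem_sdiff] at hv hv'
    clear f1 f2 f3 f4 f5 f6 hT hTU hfin hQ2 hR hYY e hWV hWY hVY hY12
    grind

set_option maxHeartbeats 1600000 in
lemma final_lt {n b t : ℕ} (G H : SimpleGraph (Fin n)) (hdvd : (b + 1 + (t + 1)) ∣ n) (V : Finset (Fin n))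
    (y : Fin n → RQ (b+1) t → Fin n) (hyp : ∀ v ∈ V, Pin G H v (y v)) (hyV : ∀ v ∈ V, ∀ q, y v q ∉ V)
    (hyd : ∀ v ∈ V, ∀ w ∈ V, v ≠ w → ∀ q q', y v q ≠ y w q')
    (I : Finset (Fin n)) (a : Fin n → (Fin (b+1) ⊕ Fin (t+1)) × (EQ (b+1) t ⊕ Unit) → Fin n)
    (hinj : ∀ i ∈ I, Function.Injective (a i))
    (hcl : ∀ i ∈ I, ∀ B ∈ blocks (b+1) (t+1) (Ll (b+1) t) (zl (b+1) t), Cl H (a i) B)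
    (haV : ∀ i ∈ I, ∀ u, a i u ∉ V) (hay : ∀ i ∈ I, ∀ u, ∀ v ∈ V, ∀ q, a i u ≠ y v q)
    (hab : ∀ i ∈ I, ∃ x : Fin (b+1) ⊕ Fin (t+1) → Fin n, Abs_l G (b+1) t (fun j => y (x j)) (a i))
    (had : ∀ i ∈ I, ∀ j ∈ I, i ≠ j → ∀ u v, a i u ≠ a j v) (M : ℕ)
    (hM : ∀ x : Fin (b+1) ⊕ Fin (t+1) → Fin n, (∀ j, x j ∈ V) →
      ∃ I' ⊆ I, M ≤ I'.card ∧ ∀ i ∈ I', Abs_l G (b+1) t (fun j => y (x j)) (a i))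
    (W Y U R : Finset (Fin n)) (hW : W = I.biUnion (fun i => univ.image (a i)))
    (hY : Y = V.biUnion (fun v => univ.image (y v))) (hR : R = univ \ (W ∪ (V ∪ Y)))
    (hUR : U ⊆ R) (hT : TL (G ⊔ H) (b + 1 + (t + 1)) (R \ U))
    (P : Fin n → Fin b ⊕ Fin (t+1) → Fin n) (hP : ∀ u ∈ U, Pin G H u (P u)) (hPV : ∀ u ∈ U, ∀ q, P u q ∈ V)
    (hPd : ∀ v ∈ U, ∀ w ∈ U, v ≠ w → ∀ q q', P v q ≠ P w q')
    (hMU : (b + (t + 1)) * U.card ≤ M) : TL (G ⊔ H) (b + 1 + (t + 1)) univ := by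
  have imd : ∀ {κ κ' : Type} [Fintype κ] [Fintype κ'] (f : κ → Fin n) (g : κ' → Fin n), (∀ u v, f u ≠ g v) →
      Disjoint (univ.image f) (univ.image g) := by
    intro κ κ' _ _ f g h
    rw [disjoint_left]
    intro v hv hv'
    obtain ⟨u, _, rfl⟩ := mem_image.1 hv
    obtain ⟨w, _, hw⟩ := mem_image.1 hv'
    exact h u w hw.symm
  have hDT : ∀ i ∈ I, TL (G ⊔ H) (b + 1 + (t+1)) (univ.image (a i)) := by
    intro i hi
    obtain ⟨x, hx⟩ := hab i hi
    exact abs_l_default hx (hinj i hi) (hcl i hi)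
  have hDd : ∀ i ∈ I, ∀ j ∈ I, i ≠ j → Disjoint (univ.image (a i)) (univ.image (a j)) :=
    fun i hi j hj hij => imd _ _ (had i hi j hj hij)
  have hWT : TL (G ⊔ H) (b + 1 + (t+1)) W := by rw [hW]; exact TL_biUnion _ _ hDT hDd
  have hWV : Disjoint W V := by
    rw [hW, disjoint_left]; intro v hv hv'
    obtain ⟨i, hi, hv⟩ := mem_biUnion.1 hv
    obtain ⟨u, _, rfl⟩ := mem_image.1 hv
    exact haV i hi u hv'
  have hWY : Disjoint W Y := by
    rw [hW, hY, disjoint_left]; intro v hv hv'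
    obtain ⟨i, hi, hv⟩ := mem_biUnion.1 hv
    obtain ⟨u, _, rfl⟩ := mem_image.1 hv
    obtain ⟨w, hw, hv'⟩ := mem_biUnion.1 hv'
    obtain ⟨q, _, hq⟩ := mem_image.1 hv'
    exact hay i hi u w hw q hq.symm
  have hVY : Disjoint V Y := by
    rw [hY, disjoint_left]; intro v hv hv'
    obtain ⟨w, hw, hv'⟩ := mem_biUnion.1 hv'
    obtain ⟨q, _, rfl⟩ := mem_image.1 hv'
    exact hyV w hw q hv
  have hQ : ∀ V' ⊆ V, TL (G ⊔ H) (b + 1 + (t+1)) (V' ∪ V'.biUnion (fun v => univ.image (y v))) := by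
    intro V' hV'
    have e : V' ∪ V'.biUnion (fun v => univ.image (y v)) = V'.biUnion (fun v => insert v (univ.image (y v))) := by
      ext w
      simp only [mem_union, mem_biUnion, mem_insert]
      constructor
      · rintro (h | ⟨v, hv, h⟩)
        · exact ⟨w, h, Or.inl rfl⟩
        · exact ⟨v, hv, Or.inr h⟩
      · rintro ⟨v, hv, (rfl | h)⟩
        · exact Or.inl hv
        · exact Or.inr ⟨v, hv, h⟩
    rw [e]
    apply TL_biUnion
    · intro v hv
      exact (hyp v (hV' hv)).clique _ (by omega)
    · intro v hv w hw hvw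
      rw [disjoint_left]
      intro x hx hx'
      rcases mem_insert.1 hx with rfl | hx
      · rcases mem_insert.1 hx' with h | h
        · exact hvw h
        · obtain ⟨q, _, hq⟩ := mem_image.1 h
          exact hyV w (hV' hw) q (hq ▸ hV' hv)
      · rcases mem_insert.1 hx' with rfl | h
        · obtain ⟨q, _, hq⟩ := mem_image.1 hx
          exact hyV v (hV' hv) q (hq ▸ hV' hw)
        · exact disjoint_left.1 (imd _ _ (hyd v (hV' hv) w (hV' hw) hvw)) hx h
  obtain ⟨V₁, hV₁⟩ : ∃ V₁, V₁ = U.biUnion (fun u => univ.image (P u)) := ⟨_, rfl⟩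
  have hV₁V : V₁ ⊆ V := by
    rw [hV₁]; intro v hv
    obtain ⟨u, hu, hv⟩ := mem_biUnion.1 hv
    obtain ⟨q, _, rfl⟩ := mem_image.1 hv
    exact hPV u hu q
  have hPd' : ∀ u ∈ U, ∀ w ∈ U, u ≠ w → Disjoint (univ.image (P u)) (univ.image (P w)) :=
    fun u hu w hw huw => imd _ _ (hPd u hu w hw huw)
  have hV₁c : V₁.card = (b + (t + 1)) * U.card := by
    rw [hV₁, card_biUnion hPd', sum_congr rfl (fun u hu => card_image_of_injective univ (hP u hu).inj), sum_const, card_univ,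
      Fintype.card_sum, Fintype.card_fin, Fintype.card_fin, smul_eq_mul, mul_comm]
  have hUn : ∀ v ∈ U, v ∉ W ∧ v ∉ V ∧ v ∉ Y := by
    intro v hv
    have := hUR hv
    rw [hR] at this
    simpa only [mem_sdiff, mem_univ, true_and, mem_union, not_or] using this
  have hUV : ∀ v ∈ U, v ∉ V := fun v hv => (hUn v hv).2.1
  have hUcard : (b + 1 + (t+1)) ∣ U.card := by
    have h1 := TL_dvd hWT
    have h2 := TL_dvd hT
    have h0 := TL_dvd (hQ V subset_rfl)
    rw [← hY] at h0
    have h3 : n = W.card + (V ∪ Y).card + (R \ U).card + U.card := by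
      have h4 := card_sdiff_add_card_eq_card hUR
      have h5 := card_sdiff_add_card_eq_card (subset_univ (W ∪ (V ∪ Y)))
      rw [card_univ, Fintype.card_fin, ← hR] at h5
      have h6 : (W ∪ (V ∪ Y)).card = W.card + (V ∪ Y).card :=
        card_union_of_disjoint (disjoint_union_right.2 ⟨hWV, hWY⟩)
      omega
    have h4 : (b + 1 + (t+1)) ∣ W.card + (V ∪ Y).card + (R \ U).card := (h1.add h0).add h2
    exact (Nat.dvd_add_right h4).1 (h3 ▸ hdvd)
  have hTU : TL (G ⊔ H) (b + 1 + (t+1)) (U ∪ V₁) := by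
    have e : U ∪ V₁ = U.biUnion (fun v => insert v (univ.image (P v))) := by
      rw [hV₁]
      ext w
      simp only [mem_union, mem_biUnion, mem_insert]
      constructor
      · rintro (h | ⟨v, hv, h⟩)
        · exact ⟨w, h, Or.inl rfl⟩
        · exact ⟨v, hv, Or.inr h⟩
      · rintro ⟨v, hv, (rfl | h)⟩
        · exact Or.inl hv
        · exact Or.inr ⟨v, hv, h⟩
    rw [e]
    apply TL_biUnion
    · intro v hv
      exact (hP v hv).clique _ (by omega)
    · intro v hv w hw hvw
      rw [disjoint_left]
      intro x hx hx'
      rcases mem_insert.1 hx with rfl | hx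
      · rcases mem_insert.1 hx' with h | h
        · exact hvw h
        · obtain ⟨q, _, hq⟩ := mem_image.1 h
          exact hUV _ hv (hq ▸ hPV w hw q)
      · rcases mem_insert.1 hx' with rfl | h
        · obtain ⟨q, _, hq⟩ := mem_image.1 hx
          exact hUV _ hw (hq ▸ hPV v hv q)
        · exact disjoint_left.1 (hPd' v hv w hw hvw) hx h
  have hfin : TL (G ⊔ H) (b + 1 + (t+1)) (W ∪ V₁.biUnion (fun v => univ.image (y v))) := by
    rw [hW]
    refine absorb_group (J := Fin (b+1) ⊕ Fin (t+1)) V₁ ?_ (fun v => univ.image (y v))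
      (fun v hv w hw hvw => imd _ _ (hyd v (hV₁V hv) w (hV₁V hw) hvw)) I (fun i => univ.image (a i)) hDd
      (fun i hi v hv => imd _ _ (fun u q => hay i hi u v (hV₁V hv) q)) hDT ?_
    · rw [hV₁c, Fintype.card_sum, Fintype.card_fin, Fintype.card_fin]
      exact Dvd.dvd.mul_left hUcard _
    · intro x hx hxV
      have hxV' : ∀ j, x j ∈ V := fun j => hV₁V (hxV j)
      obtain ⟨I', hI', hMc, hA⟩ := hM x hxV'
      rw [hV₁c]
      refine (hMU.trans hMc).trans (card_le_card ?_)
      intro i hi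
      rw [mem_filter]
      refine ⟨hI' hi, ?_⟩
      refine abs_l_with (hA i hi) (hinj i (hI' hi)) (hcl i (hI' hi)) ?_ ?_ ?_ ?_
      · intro j q j' q' hh
        have hj : j = j' := by
          by_contra hne
          exact hyd _ (hxV' j) _ (hxV' j') (fun h => hne (hx h)) q q' hh
        subst hj
        exact ⟨rfl, (hyp _ (hxV' j)).inj hh⟩
      · intro j q u hh
        exact hay i (hI' hi) u _ (hxV' j) q hh.symm
      · intro j
        exact (hyp _ (hxV' j)).left
      · intro j
        exact (hyp _ (hxV' j)).right
  obtain ⟨Y₁, hY₁⟩ : ∃ Y₁, Y₁ = V₁.biUnion (fun v => univ.image (y v)) := ⟨_, rfl⟩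
  obtain ⟨Y₂, hY₂⟩ : ∃ Y₂, Y₂ = (V \ V₁).biUnion (fun v => univ.image (y v)) := ⟨_, rfl⟩
  have hQ2 := hQ (V \ V₁) sdiff_subset
  rw [← hY₂] at hQ2
  rw [← hY₁] at hfin
  have hY12 : Disjoint Y₁ Y₂ := by
    rw [hY₁, hY₂, disjoint_left]
    intro v hv hv'
    obtain ⟨w, hw, hv⟩ := mem_biUnion.1 hv
    obtain ⟨w', hw', hv'⟩ := mem_biUnion.1 hv'
    refine disjoint_left.1 (imd _ _ (hyd w (hV₁V hw) w' (mem_sdiff.1 hw').1 ?_)) hv hv'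
    rintro rfl
    exact (mem_sdiff.1 hw').2 hw
  have hYY : Y = Y₁ ∪ Y₂ := by
    rw [hY, hY₁, hY₂, ← union_biUnion, union_sdiff_of_subset hV₁V]
  exact part_tile hR hUR hV₁V hWV hWY hVY hY12 hYY hT hTU hfin hQ2

open Finset
open scoped Classical

set_option maxHeartbeats 1600000 in
theorem case_lt (b t : ℕ) (hbt : b + 1 ≤ t) (γ : ℝ) (hγ : 0 < γ) : ∃ Λ : ℝ, ∃ n₀ : ℕ, 0 < Λ ∧ ∀ n, n₀ ≤ n →
    ((b+1) + (t+1)) ∣ n → ∀ p, GoodP n (t+1) p Λ → ∀ G : SimpleGraph (Fin n),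
    (∀ v, (b+1) * n ≤ ((b+1) + (t+1)) * (nbh G v univ).card) →
    (∀ Y : Finset (Fin n), ((b+1) + (t+1)) * Y.card = (t+1) * n → γ * (n:ℝ) ^ 2 ≤ eG G Y Y) →
    Pr n p (fun H => ¬ HasCliqueFactor (G ⊔ H) ((b+1) + (t+1))) ≤ 6 / n := by
  obtain ⟨α, hα⟩ : ∃ α : ℝ, α = ((b + 1 : ℕ) : ℝ) / ((b + 1 + (t + 1) : ℕ) : ℝ) := ⟨_, rfl⟩
  have hα0 : 0 < α := by rw [hα]; positivity
  obtain ⟨m, hm⟩ : ∃ m : ℕ, m = Fintype.card (RQ (b+1) t) := ⟨_, rfl⟩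
  obtain ⟨N, hN⟩ : ∃ N : ℕ, N = Fintype.card ((Fin (b+1) ⊕ Fin (t+1)) × (EQ (b+1) t ⊕ Unit)) := ⟨_, rfl⟩
  obtain ⟨E, hE'⟩ : ∃ E : ℕ, E = Fintype.card (EQ (b+1) t) := ⟨_, rfl⟩
  have hmt : m = t + (b + 1) := by rw [hm, Fintype.card_sum, Fintype.card_fin, Fintype.card_fin]
  obtain ⟨c1, hc1, hrow⟩ := row_count (b+1) t α hα0
  obtain ⟨cA, hcA, hcount⟩ := abs_l_count (b+1) t (by omega) α c1 hα0 hc1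
  rw [← hN] at hcount
  rw [← hE'] at hrow hcount
  rw [← hm] at hrow
  obtain ⟨η₁, hη₁, Λ₁, n₁, hΛ₁, hax1⟩ := hax_pair (t+1) t (b+1) le_rfl (by omega) (by omega) (c1/2) (by positivity)
  obtain ⟨ξ, hξ⟩ : ∃ ξ : ℝ, ξ = min 1 (γ / (16 * ((t + 1 : ℕ) : ℝ))) := ⟨_, rfl⟩
  have hξ0 : 0 < ξ := by rw [hξ]; positivity
  have hξ1 : ξ ≤ 1 := by rw [hξ]; exact min_le_left _ _
  have hξγ : 16 * ((t + 1 : ℕ) : ℝ) * ξ ≤ γ := by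
    have : ξ ≤ γ / (16 * ((t + 1 : ℕ) : ℝ)) := by rw [hξ]; exact min_le_right _ _
    rw [le_div_iff₀ (by positivity)] at this
    linarith
  obtain ⟨ζ, hζ⟩ : ∃ ζ : ℝ, ζ = min (ξ / 2) (cA / (4 * ((N : ℝ) + 1))) := ⟨_, rfl⟩
  have hζ0 : 0 < ζ := by rw [hζ]; positivity
  have hζ1 : ζ ≤ ξ / 2 := by rw [hζ]; exact min_le_left _ _
  have hζ2 : ζ ≤ cA / (4 * ((N : ℝ) + 1)) := by rw [hζ]; exact min_le_right _ _
  obtain ⟨η₀, hη₀⟩ : ∃ η₀ : ℝ, η₀ = min (min η₁ (c1 / (4 * ((m : ℝ) + 1)))) (ζ / ((m : ℝ) + 1)) := ⟨_, rfl⟩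
  have hη₀0 : 0 < η₀ := by rw [hη₀]; positivity
  have hη₀1 : η₀ ≤ η₁ := by rw [hη₀]; exact (min_le_left _ _).trans (min_le_left _ _)
  have hη₀2 : η₀ ≤ c1 / (4 * ((m : ℝ) + 1)) := by rw [hη₀]; exact (min_le_left _ _).trans (min_le_right _ _)
  have hη₀3 : ((m : ℝ) + 1) * η₀ ≤ ζ := by
    have : η₀ ≤ ζ / ((m : ℝ) + 1) := by rw [hη₀]; exact min_le_right _ _
    rw [le_div_iff₀ (by positivity)] at this
    linarith
  obtain ⟨θ₀, hθ₀, n₂, hres⟩ := reservoir α η₀ hα0 hη₀0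
  obtain ⟨c2, hc2, hlink⟩ := link_count b t θ₀ hθ₀
  obtain ⟨η₂, hη₂, Λ₂, n₃, hΛ₂, hax2⟩ := hax_pair (t+1) b (t+1) (by omega) le_rfl (by omega) c2 hc2
  obtain ⟨θ, hθ, Λ₃, n₄, hΛ₃, habs⟩ := absorbers (J := Fin (b+1) ⊕ Fin (t+1)) (t+1) (blocks (b+1) (t+1) (Ll (b+1) t) (zl (b+1) t))
    (FL_blocks (b+1) (t+1) (by omega) (by omega) _ _ (FL_Ll (b+1) t hbt)) ((m:ℝ) + 1) (cA/2) (ξ / 2 / (N + 1)) (by positivity)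
    (by positivity) (by positivity)
  rw [← hN] at habs
  obtain ⟨ε, hε⟩ : ∃ ε : ℝ, ε = min 1 (min η₂ (θ / ((b + (t + 1) : ℕ) : ℝ))) := ⟨_, rfl⟩
  have hε0 : 0 < ε := by rw [hε]; positivity
  have hε1 : ε ≤ 1 := by rw [hε]; exact min_le_left _ _
  have hε2 : ε ≤ η₂ := by rw [hε]; exact (min_le_right _ _).trans (min_le_left _ _)
  have hε3 : ((b + (t + 1) : ℕ) : ℝ) * ε ≤ θ := by
    have : ε ≤ θ / ((b + (t + 1) : ℕ) : ℝ) := by rw [hε]; exact (min_le_right _ _).trans (min_le_right _ _)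
    rw [le_div_iff₀ (by positivity)] at this
    linarith
  obtain ⟨d, hd, n₅, htile⟩ := almost_tiling (k := b+1) (s := t+1) (by omega) (by omega) γ ξ ε hξ0 hξ1 hξγ hε0 hε1
  obtain ⟨Λ₄, n₆, hΛ₄, hT1⟩ := T1_event (b+1) (t+1) (by omega) (by omega) d hd
  obtain ⟨n₇, hn₇⟩ : ∃ n₇ : ℕ, 4 * ((m : ℝ) + 1) ^ 2 / c1 + 1 ≤ n₇ := ⟨_, Nat.le_ceil _⟩
  obtain ⟨n₈, hn₈⟩ : ∃ n₈ : ℕ, 4 * ((N : ℝ) + 1) ^ 2 / cA + 1 ≤ n₈ := ⟨_, Nat.le_ceil _⟩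
  refine ⟨max (max Λ₁ Λ₂) (max Λ₃ Λ₄), n₁ + n₂ + n₃ + n₄ + n₅ + n₆ + n₇ + n₈ + 1, lt_max_of_lt_left (lt_max_of_lt_left hΛ₁), ?_⟩
  intro n hn hdvd p hg G hdeg hE
  have hn1 : 1 ≤ n := by omega
  have hdegα : ∀ v, α * n ≤ ((nbh G v univ).card : ℝ) := by
    intro v
    rw [hα, div_mul_eq_mul_div, div_le_iff₀ (by positivity), mul_comm ((nbh G v univ).card : ℝ)]
    exact_mod_cast hdeg v
  obtain ⟨V, hVc, hVd⟩ := hres n (by omega) G hdegα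
  have hn7 : 4 * ((m : ℝ) + 1) ^ 2 / c1 + 1 ≤ n := hn₇.trans (Nat.cast_le.2 (by omega))
  have hn8 : 4 * ((N : ℝ) + 1) ^ 2 / cA + 1 ≤ n := hn₈.trans (Nat.cast_le.2 (by omega))
  obtain ⟨Rel1, hRel1⟩ : ∃ Rel1 : Fin n → Finset (Fin t ⊕ Fin (b+1) → Fin n), ∀ v f, f ∈ Rel1 v ↔ (∀ q, f q ∉ V) ∧
      (∀ i, G.Adj v (f (Sum.inr i))) ∧ (∀ i j, G.Adj (f (Sum.inr i)) (f (Sum.inl j))) ∧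
      c1 * (n:ℝ) ^ E ≤ ((univ.filter (ExtOK G (b+1) t f)).card : ℝ) :=
    ⟨fun v => univ.filter (fun f => (∀ q, f q ∉ V) ∧
      (∀ i, G.Adj v (f (Sum.inr i))) ∧ (∀ i j, G.Adj (f (Sum.inr i)) (f (Sum.inl j))) ∧
      c1 * (n:ℝ) ^ E ≤ ((univ.filter (ExtOK G (b+1) t f)).card : ℝ)), fun v f => by simp only [mem_filter, mem_univ, true_and]⟩
  have hRel1c : ∀ v, c1 / 2 * (n:ℝ) ^ (t + (b + 1)) ≤ ((Rel1 v).card : ℝ) := by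
    intro v
    obtain ⟨Z, hZ⟩ : ∃ Z : Finset (RQ (b+1) t → Fin n), ∀ f, f ∈ Z ↔
      (∀ i, G.Adj v (f (Sum.inr i))) ∧ (∀ i j, G.Adj (f (Sum.inr i)) (f (Sum.inl j))) ∧
      c1 * (n:ℝ) ^ E ≤ ((univ.filter (ExtOK G (b+1) t f)).card : ℝ) :=
      ⟨univ.filter (fun f => (∀ i, G.Adj v (f (Sum.inr i))) ∧ (∀ i j, G.Adj (f (Sum.inr i)) (f (Sum.inl j))) ∧
        c1 * (n:ℝ) ^ E ≤ ((univ.filter (ExtOK G (b+1) t f)).card : ℝ)), fun f => by simp only [mem_filter, mem_univ, true_and]⟩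
    have h1 := hrow n hn1 G hdegα v Z (fun f h1 h2 h3 => (hZ f).2 ⟨h1, h2, h3⟩)
    rw [hm] at h1
    have h2 := clean c1 hc1 (by rw [← hm]; exact hn7) Z h1 V (by
      rw [← hm]
      refine hVc.trans ?_
      gcongr) (Rel1 v) (by
      intro f hf _ hfV
      rw [hRel1]
      exact ⟨hfV, (hZ f).1 hf⟩)
    rw [← hm, hmt] at h2
    exact h2
  obtain ⟨Rel2, hRel2⟩ : ∃ Rel2 : Fin n → Finset (Fin b ⊕ Fin (t+1) → Fin n), ∀ u f, f ∈ Rel2 u ↔ (∀ q, f q ∈ V) ∧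
      (∀ i, G.Adj u (f (Sum.inr i))) ∧ (∀ i j, G.Adj (f (Sum.inr i)) (f (Sum.inl j))) :=
    ⟨fun u => univ.filter (fun f => (∀ q, f q ∈ V) ∧
      (∀ i, G.Adj u (f (Sum.inr i))) ∧ (∀ i j, G.Adj (f (Sum.inr i)) (f (Sum.inl j)))),
      fun v f => by simp only [mem_filter, mem_univ, true_and]⟩
  have hRel2c : ∀ u, c2 * (n:ℝ) ^ (b + (t + 1)) ≤ ((Rel2 u).card : ℝ) := fun u =>
    hlink n hn1 G V hVd u (Rel2 u) (fun f h1 h2 h3 => (hRel2 u f).2 ⟨h1, h2, h3⟩)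
  obtain ⟨X₀, hX₀⟩ : ∃ X₀ : Finset (Fin (b+1) ⊕ Fin (t+1) → Fin n), ∀ x, x ∈ X₀ ↔ ∀ j, x j ∈ V :=
    ⟨univ.filter (fun x => ∀ j, x j ∈ V), fun x => by simp only [mem_filter, mem_univ, true_and]⟩
  obtain ⟨RR, hRR⟩ : ∃ RR : (Fin n → RQ (b+1) t → Fin n) → (Fin (b+1) ⊕ Fin (t+1) → Fin n) →
      Finset ((Fin (b+1) ⊕ Fin (t+1)) × (EQ (b+1) t ⊕ Unit) → Fin n), ∀ y x a, a ∈ RR y x ↔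
      (∀ u, a u ∉ V ∪ V.biUnion (fun v => univ.image (y v))) ∧ Abs_l G (b+1) t (fun j => y (x j)) a :=
    ⟨fun y x => univ.filter (fun a => (∀ u, a u ∉ V ∪ V.biUnion (fun v => univ.image (y v))) ∧
      Abs_l G (b+1) t (fun j => y (x j)) a), fun y x a => by simp only [mem_filter, mem_univ, true_and]⟩
  have hYc : ∀ y : Fin n → RQ (b+1) t → Fin n, ((V ∪ V.biUnion (fun v => univ.image (y v))).card : ℝ) ≤ ζ * n := by
    intro y
    have h1 := card_biUnion_tuple V y η₀ (m * η₀) hVc (by rw [hm])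
    have h2 : ((V ∪ V.biUnion (fun v => univ.image (y v))).card : ℝ) ≤ V.card + (V.biUnion (fun v => univ.image (y v))).card := by
      exact_mod_cast card_union_le _ _
    calc _ ≤ _ := h2
      _ ≤ η₀ * n + m * η₀ * n := add_le_add hVc h1
      _ = ((m : ℝ) + 1) * η₀ * n := by ring
      _ ≤ ζ * n := by gcongr
  have ev1 := hax1 n (by omega) p (hg.mono hn1 ((le_max_left _ _).trans (le_max_left _ _))) Rel1
  have ev2 := hax2 n (by omega) p (hg.mono hn1 ((le_max_right _ _).trans (le_max_left _ _))) Rel2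
  have ev3 := habs n (by omega) p (hg.mono hn1 ((le_max_left _ _).trans (le_max_right _ _))) (Fin n → RQ (b+1) t → Fin n) (by
    rw [Fintype.card_fun, Fintype.card_fun, Fintype.card_fin, ← hm, ← pow_mul, Nat.cast_pow, npow_eq_exp n _ hn1]
    apply Real.exp_le_exp.2
    have : 0 ≤ Real.log n := Real.log_natCast_nonneg n
    push_cast
    gcongr
    linarith) (fun _ => X₀) RR
  have ev4 := hT1 n (by omega) p (hg.mono hn1 ((le_max_right _ _).trans (le_max_right _ _))) G
  have e6 : (6:ℝ) / n = (2 / n + 2 / n) + (1 / n + 1 / n) := by ring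
  rw [e6]
  refine Pr_add_bound hg.nonneg hg.le_one
    (Pr_add_bound hg.nonneg hg.le_one ev1 ev2 (fun H h h' => And.intro h h'))
    (Pr_add_bound hg.nonneg hg.le_one ev3 ev4 (fun H h h' => And.intro h h')) ?_
  rintro H ⟨hH1, hH2⟩ ⟨hH3, hH4⟩
  obtain ⟨y, hy, hyd⟩ := hH1 V (hVc.trans (by gcongr)) (fun v _ => hRel1c v)
  obtain ⟨I, a, hI, hIa, hdis, hmany⟩ := hH3 y (by
    intro x hx
    rw [hX₀] at hx
    obtain ⟨Z, hZ⟩ : ∃ Z, Z = univ.filter (Abs_l G (b+1) t (fun j => y (x j))) := ⟨_, rfl⟩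
    have h1 := hcount n G hdegα (fun j => y (x j)) (fun j => ((hRel1 _ _).1 (hy _ (hx j)).1).2.2.2)
    rw [← hZ, hN] at h1
    rw [hN]
    refine clean cA hcA (by rw [← hN]; exact hn8) Z h1 (V ∪ V.biUnion (fun v => univ.image (y v))) ?_ (RR y x) ?_
    · rw [← hN]
      refine (hYc y).trans ?_
      gcongr
    · intro f hf _ hfV
      rw [hRR]
      refine ⟨hfV, ?_⟩
      rw [hZ] at hf
      exact (mem_filter.1 hf).2)
  obtain ⟨W, hW⟩ : ∃ W, W = I.biUnion (fun i => univ.image (a i)) := ⟨_, rfl⟩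
  obtain ⟨Y, hY⟩ : ∃ Y, Y = V.biUnion (fun v => univ.image (y v)) := ⟨_, rfl⟩
  obtain ⟨R, hR⟩ : ∃ R, R = univ \ (W ∪ (V ∪ Y)) := ⟨_, rfl⟩
  have hRc : ((univ \ R).card : ℝ) ≤ ξ * n := by
    rw [hR, sdiff_sdiff_right_self, inf_eq_inter, univ_inter]
    have h1 : (W.card : ℝ) ≤ ξ / 2 * n := by
      rw [hW]
      apply card_biUnion_tuple I a _ _ hI
      rw [← hN, mul_div_assoc', div_le_iff₀ (by positivity)]
      nlinarith
    have h2 : ((V ∪ Y).card : ℝ) ≤ ξ / 2 * n := by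
      rw [hY]
      refine (hYc y).trans ?_
      gcongr
    have h3 : ((W ∪ (V ∪ Y)).card : ℝ) ≤ W.card + (V ∪ Y).card := by exact_mod_cast card_union_le _ _
    linarith
  obtain ⟨U, hUR, hUc, hTL⟩ := htile n (by omega) hdvd G (G ⊔ H) hdeg hE hH4 R hRc
  obtain ⟨P, hP, hPd⟩ := hH2 U (hUc.trans (by gcongr)) (fun v _ => hRel2c v)
  have hMU : (((b + (t + 1)) * U.card : ℕ) : ℝ) ≤ θ * n := by
    rw [Nat.cast_mul]
    calc ((b + (t + 1) : ℕ) : ℝ) * U.card ≤ ((b + (t + 1) : ℕ) : ℝ) * (ε * n) := by gcongr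
      _ = ((b + (t + 1) : ℕ) : ℝ) * ε * n := by ring
      _ ≤ θ * n := by gcongr
  have hav : ∀ i ∈ I, (∀ u, a i u ∉ V ∪ V.biUnion (fun v => univ.image (y v))) ∧
      ∃ x : Fin (b+1) ⊕ Fin (t+1) → Fin n, Abs_l G (b+1) t (fun j => y (x j)) (a i) := by
    intro i hi
    obtain ⟨_, _, x, _, hx⟩ := hIa i hi
    rw [hRR] at hx
    exact ⟨hx.1, x, hx.2⟩
  apply TL_factor (by omega)
  refine final_lt G H hdvd V y ?_ ?_ hyd I a (fun i hi => (hIa i hi).1) (fun i hi => (hIa i hi).2.1) ?_ ?_ (fun i hi => (hav i hi).2)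
    hdis ((b + (t + 1)) * U.card) ?_ W Y U R hW hY hR hUR hTL P ?_ ?_ hPd le_rfl
  · intro v hv
    obtain ⟨h1, h2, h3, h4, h5⟩ := hy v hv
    rw [hRel1] at h1
    exact ⟨h2, h3, h4, h5, h1.2.1, h1.2.2.1⟩
  · intro v hv
    exact ((hRel1 _ _).1 (hy v hv).1).1
  · intro i hi u hu
    exact (hav i hi).1 u (mem_union_left _ hu)
  · intro i hi u v hv q hh
    exact (hav i hi).1 u (mem_union_right _ (mem_biUnion.2 ⟨v, hv, mem_image.2 ⟨q, mem_univ _, hh.symm⟩⟩))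
  · intro x hx
    have h1 := hmany x ((hX₀ x).2 hx)
    refine ⟨_, filter_subset (fun i => a i ∈ RR y x) I, ?_, ?_⟩
    · have h2 := hMU.trans h1
      exact_mod_cast h2
    · intro i hi
      exact ((hRR _ _ _).1 (mem_filter.1 hi).2).2
  · intro u hu
    obtain ⟨h1, h2, h3, h4, h5⟩ := hP u hu
    rw [hRel2] at h1
    exact ⟨h2, h3, h4, h5, h1.2.1, h1.2.2⟩
  · intro u hu
    exact ((hRel2 _ _).1 (hP u hu).1).1

open Finset
open scoped Classical

lemma pair_TL {n : ℕ} {Γ : SimpleGraph (Fin n)} {u x : Fin n} (h : Γ.Adj u x) : TL Γ 2 {u, x} := by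
  apply TL_clique
  rw [SimpleGraph.isNClique_iff]
  refine ⟨?_, card_pair h.ne⟩
  intro a ha b hb hab
  simp only [coe_insert, coe_singleton, Set.mem_insert_iff, Set.mem_singleton_iff] at ha hb
  rcases ha with rfl | rfl <;> rcases hb with rfl | rfl
  · exact absurd rfl hab
  · exact h
  · exact h.symm
  · exact absurd rfl hab

lemma matching {n : ℕ} (Γ : SimpleGraph (Fin n)) (hn : 2 ∣ n) (hdeg : ∀ v, n ≤ 2 * (nbh Γ v univ).card) : TL Γ 2 univ := by
  obtain ⟨S, hS, hmax⟩ := exists_max_image (univ.filter (fun S => TL Γ 2 S)) (fun S => S.card)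
    ⟨∅, mem_filter.2 ⟨mem_univ _, TL_empty Γ 2⟩⟩
  have hS : TL Γ 2 S := (mem_filter.1 hS).2
  have hmax : ∀ S', TL Γ 2 S' → S ⊆ S' → S' = S := by
    intro S' h1 h2
    exact (eq_of_subset_of_card_le h2 (hmax S' (mem_filter.2 ⟨mem_univ _, h1⟩))).symm
  have hSd := TL_dvd hS
  by_contra hno
  have hSu : S ≠ univ := by rintro rfl; exact hno hS
  have hlt : S.card < n := by
    have := card_lt_card ((ssubset_univ_iff).2 hSu)
    simpa using this
  have hc : 1 < Sᶜ.card := by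
    rw [card_compl, Fintype.card_fin]
    omega
  obtain ⟨u, hu, w, hw, huw⟩ := one_lt_card.1 hc
  rw [mem_compl] at hu hw
  have hnb : ∀ v, v ∉ S → nbh Γ v univ = nbh Γ v S := by
    intro v hv
    refine Subset.antisymm ?_ (nbh_mono Γ v (subset_univ _))
    intro x hx
    simp only [nbh, mem_filter, mem_univ, true_and] at hx ⊢
    refine ⟨?_, hx⟩
    by_contra hxS
    have h1 := hmax ({v, x} ∪ S) (TL_union (pair_TL hx) hS (by
      rw [disjoint_left]
      intro z hz hz'
      simp only [mem_insert, mem_singleton] at hz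
      rcases hz with rfl | rfl
      · exact hv hz'
      · exact hxS hz')) subset_union_right
    exact hv (h1 ▸ mem_union_left _ (mem_insert_self _ _))
  obtain ⟨T, hT1, hT2, hT3⟩ := id hS
  have hsum : ∀ v, v ∉ S → (nbh Γ v univ).card = ∑ Q ∈ T, (nbh Γ v Q).card := by
    intro v hv
    rw [hnb v hv, ← hT3]
    have : nbh Γ v (T.biUnion id) = T.biUnion (fun Q => nbh Γ v Q) := by
      unfold nbh
      rw [filter_biUnion]
      rfl
    rw [this, card_biUnion]
    intro Q hQ Q' hQ' hne
    exact disjoint_of_subset_left (filter_subset _ _) (disjoint_of_subset_right (filter_subset _ _) (hT2 Q hQ Q' hQ' hne))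
  have hTc : S.card = ∑ _Q ∈ T, 2 := by
    rw [← hT3, card_biUnion (t := id) (fun Q hQ Q' hQ' hne => hT2 Q hQ Q' hQ' hne)]
    exact sum_congr rfl (fun Q hQ => (hT1 Q hQ).card_eq)
  have hlt2 : ∑ _Q ∈ T, 2 < ∑ Q ∈ T, ((nbh Γ u Q).card + (nbh Γ w Q).card) := by
    rw [sum_add_distrib, ← hTc, ← hsum u hu, ← hsum w hw]
    have := hdeg u
    have := hdeg w
    omega
  obtain ⟨Q, hQ, hQ2⟩ := exists_lt_of_sum_lt hlt2
  obtain ⟨x, hx, y, hy, hxy, hux, hwy⟩ : ∃ x ∈ Q, ∃ y ∈ Q, x ≠ y ∧ Γ.Adj u x ∧ Γ.Adj w y := by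
    obtain ⟨p, q, hpq, rfl⟩ := card_eq_two.1 (hT1 Q hQ).card_eq
    by_cases h1 : Γ.Adj u p ∧ Γ.Adj w q
    · exact ⟨p, by simp, q, by simp, hpq, h1.1, h1.2⟩
    by_cases h2 : Γ.Adj u q ∧ Γ.Adj w p
    · exact ⟨q, by simp, p, by simp, hpq.symm, h2.1, h2.2⟩
    exfalso
    have e : ∀ v, (nbh Γ v {p, q}).card = (if Γ.Adj v p then 1 else 0) + (if Γ.Adj v q then 1 else 0) := by
      intro v
      unfold nbh
      rw [card_filter, sum_pair hpq]
    rw [e, e] at hQ2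
    split_ifs at hQ2 <;> first | omega | tauto
  have hQS : ∀ Q' ∈ T, ∀ z ∈ Q', z ∈ S := by
    intro Q' hQ' z hz
    rw [← hT3]
    exact mem_biUnion.2 ⟨Q', hQ', hz⟩
  have hxS := hQS Q hQ x hx
  have hyS := hQS Q hQ y hy
  have hTe : TL Γ 2 ((T.erase Q).biUnion id) := TL_biUnion _ _ (fun Q' hQ' => TL_clique (hT1 Q' (mem_of_mem_erase hQ')))
    (fun Q' hQ' Q'' hQ'' hne => hT2 Q' (mem_of_mem_erase hQ') Q'' (mem_of_mem_erase hQ'') hne)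
  have hTeS : ∀ z ∈ (T.erase Q).biUnion id, z ∈ S ∧ z ∉ Q := by
    intro z hz
    obtain ⟨Q', hQ', hz⟩ := mem_biUnion.1 hz
    refine ⟨hQS Q' (mem_of_mem_erase hQ') z hz, fun hzQ => ?_⟩
    exact disjoint_left.1 (hT2 Q' (mem_of_mem_erase hQ') Q hQ (mem_erase.1 hQ').1) hz hzQ
  have hQxy : Q = {x, y} := by
    refine (eq_of_subset_of_card_le ?_ ?_).symm
    · intro z hz
      simp only [mem_insert, mem_singleton] at hz
      rcases hz with rfl | rfl
      · exact hx
      · exact hy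
    · rw [(hT1 Q hQ).card_eq, card_pair hxy]
  have h1 := hmax ({u, x} ∪ ({w, y} ∪ (T.erase Q).biUnion id)) (TL_union (pair_TL hux) (TL_union (pair_TL hwy) hTe (by
      rw [disjoint_left]
      intro z hz hz'
      simp only [mem_insert, mem_singleton] at hz
      have := hTeS z hz'
      rcases hz with rfl | rfl
      · exact hw this.1
      · exact this.2 hy)) (by
      rw [disjoint_left]
      intro z hz hz'
      simp only [mem_insert, mem_singleton] at hz
      rcases mem_union.1 hz' with hz' | hz'
      · simp only [mem_insert, mem_singleton] at hz'
        rcases hz with rfl | rfl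
        · rcases hz' with rfl | rfl
          · exact huw rfl
          · exact hu hyS
        · rcases hz' with rfl | rfl
          · exact hw hxS
          · exact hxy rfl
      · have := hTeS z hz'
        rcases hz with rfl | rfl
        · exact hu this.1
        · exact this.2 hx)) (by
      intro z hz
      rw [← hT3] at hz
      obtain ⟨Q', hQ', hz⟩ := mem_biUnion.1 hz
      by_cases hQQ : Q' = Q
      · rw [hQQ, hQxy] at hz
        simp only [id, mem_insert, mem_singleton] at hz
        simp only [mem_union, mem_insert, mem_singleton]
        tauto
      · exact mem_union_right _ (mem_union_right _ (mem_biUnion.2 ⟨Q', mem_erase.2 ⟨hQQ, hQ'⟩, hz⟩)))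
  exact hu (h1 ▸ mem_union_left _ (mem_insert_self _ _))

lemma degR_eq {n : ℕ} (G : SimpleGraph (Fin n)) (v : Fin n) : degR G v = (nbh G v univ).card := by
  unfold degR nbh
  rw [Nat.card_eq_fintype_card, ← Set.toFinset_card]
  congr 1
  ext w
  simp

lemma edgesIn_le {n : ℕ} (G : SimpleGraph (Fin n)) (Y : Finset (Fin n)) : edgesIn G (Y : Set (Fin n)) ≤ eG G Y Y := by
  unfold edgesIn eG
  have e0 : ((Y ×ˢ Y).filter (fun p => G.Adj p.1 p.2)).card =
      Nat.card {p // p ∈ (Y ×ˢ Y).filter (fun p => G.Adj p.1 p.2)} := by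
    rw [Nat.card_eq_fintype_card, Fintype.card_coe]
  rw [e0]
  have hout : ∀ e : Sym2 (Fin n), s(e.out.1, e.out.2) = e := fun e => by
    have := Quot.out_eq e
    exact this
  refine Nat.card_le_card_of_injective (fun e => ⟨e.1.out, ?_⟩) ?_
  · obtain ⟨e, he, hv⟩ := e
    simp only [mem_filter, mem_product]
    have h1 := hout e
    refine ⟨⟨?_, ?_⟩, ?_⟩
    · exact hv _ (h1.subst (motive := fun z => e.out.1 ∈ z) (Sym2.mem_mk_left _ _))
    · exact hv _ (h1.subst (motive := fun z => e.out.2 ∈ z) (Sym2.mem_mk_right _ _))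
    · rw [← h1, SimpleGraph.mem_edgeSet] at he
      exact he
  · intro e e' h
    simp only [Subtype.mk.injEq] at h
    apply Subtype.ext
    rw [← hout e.1, ← hout e'.1, h]

lemma small_frac (c δ : ℝ) (hδ : 0 < δ) : ∃ n₀ : ℕ, 1 ≤ n₀ ∧ ∀ n, n₀ ≤ n → c / (n:ℝ) ≤ δ := by
  refine ⟨max 1 ⌈c / δ⌉₊, le_max_left _ _, ?_⟩
  intro n hn
  have h1 : 1 ≤ n := (le_max_left _ _).trans hn
  have h2 : c / δ ≤ n := (Nat.le_ceil _).trans (Nat.cast_le.2 ((le_max_right _ _).trans hn))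
  have : (0:ℝ) < n := by exact_mod_cast h1
  rw [div_le_iff₀ hδ] at h2
  rw [div_le_iff₀ this]
  linarith

/-- The uniform conclusion for `s ≥ 2`. -/
lemma case_all (k s : ℕ) (hk : 1 ≤ k) (hks : k ≤ s) (hs : 2 ≤ s) (γ : ℝ) (hγ : 0 < γ) : ∃ Λ : ℝ, ∃ n₀ : ℕ, 0 < Λ ∧ ∀ n, n₀ ≤ n →
    (k + s) ∣ n → ∀ p, GoodP n s p Λ → ∀ G : SimpleGraph (Fin n),
    (∀ v, k * n ≤ (k + s) * (nbh G v univ).card) →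
    (∀ Y : Finset (Fin n), (k + s) * Y.card = s * n → γ * (n:ℝ) ^ 2 ≤ eG G Y Y) →
    Pr n p (fun H => ¬ HasCliqueFactor (G ⊔ H) (k + s)) ≤ 6 / n := by
  obtain ⟨t, rfl⟩ : ∃ t, s = t + 1 := ⟨s - 1, by omega⟩
  obtain ⟨b, rfl⟩ : ∃ b, k = b + 1 := ⟨k - 1, by omega⟩
  by_cases hbt : b + 1 ≤ t
  · exact case_lt b t hbt γ hγ
  · obtain rfl : b = t := by omega
    obtain ⟨Λ, n₀, hΛ, h⟩ := case_eq b (by omega) γ hγ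
    refine ⟨Λ, n₀, hΛ, fun n hn hd p hp G h1 h2 => (h n hn hd p hp G h1 h2).trans ?_⟩
    gcongr
    norm_num

theorem statement5 (r s : ℕ) (hrs : r ≤ 2 * s) (hsr : s < r) (γ : ℝ) (hγ : 0 < γ) :
    ∃ C₀ : ℝ, ∀ C : ℝ, C₀ ≤ C →
      ∀ δ : ℝ, 0 < δ → ∃ n₀ : ℕ, ∀ n : ℕ, n₀ ≤ n → r ∣ n →
        ∀ G : SimpleGraph (Fin n),
          (∀ v, (1 - (s : ℝ) / (r : ℝ)) * n ≤ (degR G v : ℝ)) →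
          (∀ X : Set (Fin n), (X.ncard : ℝ) = (s : ℝ) * n / (r : ℝ) →
            γ * (n : ℝ) ^ 2 ≤ (edgesIn G X : ℝ)) →
          1 - δ ≤ Pr n (C * (n : ℝ) ^ (-(2 : ℝ) / (s : ℝ)) *
              (Real.log n) ^ ((2 : ℝ) / ((s : ℝ) * ((s : ℝ) - 1))))
            (fun H => HasCliqueFactor (G ⊔ H) r) := by
  obtain ⟨k, rfl⟩ : ∃ k, r = k + s := ⟨r - s, by omega⟩
  have hr0 : (0:ℝ) < ((k + s : ℕ) : ℝ) := by
    have : 0 < k + s := by omega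
    exact_mod_cast this
  have hconv : ∀ n : ℕ, ∀ G : SimpleGraph (Fin n), (∀ v, (1 - (s : ℝ) / ((k + s : ℕ) : ℝ)) * n ≤ (degR G v : ℝ)) →
      ∀ v, k * n ≤ (k + s) * (nbh G v univ).card := by
    intro n G h v
    have h1 := h v
    rw [degR_eq, one_sub_div hr0.ne', div_mul_eq_mul_div, div_le_iff₀ hr0] at h1
    have h2 : (k:ℝ) * n ≤ ((k + s : ℕ) : ℝ) * (nbh G v univ).card := by
      push_cast at h1 ⊢
      linarith
    exact_mod_cast h2
  by_cases hs : 2 ≤ s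
  · obtain ⟨Λ, n₁, hΛ, h⟩ := case_all k s (by omega) (by omega) hs γ hγ
    obtain ⟨C₀, _, hC⟩ := goodP_of_large s hs Λ hΛ
    refine ⟨C₀, fun C hC0 δ hδ => ?_⟩
    obtain ⟨n₂, hn₂⟩ := hC C hC0
    obtain ⟨n₃, hn₃, hfr⟩ := small_frac 6 δ hδ
    refine ⟨n₁ + n₂ + n₃, fun n hn hd G hdeg hE => ?_⟩
    have hg := hn₂ n (by omega)
    have h1 := h n (by omega) hd _ hg G (hconv n G hdeg) (by
      intro Y hY
      refine (hE (Y : Set (Fin n)) ?_).trans (Nat.cast_le.2 (edgesIn_le G Y))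
      rw [Set.ncard_coe_finset, eq_div_iff hr0.ne', mul_comm]
      exact_mod_cast hY)
    rw [Pr_compl]
    have h2 := hfr n (by omega)
    linarith
  · obtain rfl : s = 1 := by omega
    obtain rfl : k = 1 := by omega
    refine ⟨0, fun C hC δ hδ => ?_⟩
    obtain ⟨n₁, hn₁, hfr⟩ := small_frac C 1 one_pos
    refine ⟨n₁, fun n hn hd G hdeg _ => ?_⟩
    have hn0 : (1:ℝ) ≤ n := by exact_mod_cast hn₁.trans hn
    obtain ⟨p, hp⟩ : ∃ p : ℝ, p = C * (n : ℝ) ^ (-(2 : ℝ) / ((1 : ℕ) : ℝ)) *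
              (Real.log n) ^ ((2 : ℝ) / (((1 : ℕ) : ℝ) * (((1 : ℕ) : ℝ) - 1))) := ⟨_, rfl⟩
    rw [← hp]
    have hp2 : p = C / n / n := by
      rw [hp]
      have e : (n : ℝ) ^ (-(2 : ℝ) / ((1 : ℕ) : ℝ)) = ((n:ℝ) ^ 2)⁻¹ := by
        rw [Nat.cast_one, div_one, Real.rpow_neg (by positivity)]
        norm_num
      rw [e]
      norm_num
      field_simp
    have hp0 : 0 ≤ p := by rw [hp2]; positivity
    have hp1 : p ≤ 1 := by
      rw [hp2, div_le_one (by linarith)]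
      exact (hfr n hn).trans hn0
    have hall : ∀ H, HasCliqueFactor (G ⊔ H) (1 + 1) := by
      intro H
      apply TL_factor (by omega)
      apply matching (G ⊔ H) hd
      intro v
      have h1 := hconv n G hdeg v
      have h2 : (nbh G v univ).card ≤ (nbh (G ⊔ H) v univ).card := by
        apply card_le_card
        intro x hx
        simp only [nbh, mem_filter, mem_univ, true_and] at hx ⊢
        exact Or.inl hx
      omega
    have h3 := Pr_mono hp0 hp1 (P := fun _ => True) (Q := fun H => HasCliqueFactor (G ⊔ H) (1 + 1)) (fun H _ => hall H)
    rw [Pr_true] at h3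
    linarith
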